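/- There is a positive absolute constant C such that the following holds. For every ψ ∈ Ψ₁ (modulo p) and every s ∈ Ω₃, one has |L(s,ψ)L(s,χψ) − F(s,ψ) − Z̃(s,ψ)·F(1−s, ψ̄)| ≤ C·𝓛^{-179}, where F(1−s, ψ̄) = Σ_{n≤D⁴} ν(n)·conj(ψ(n))·n^{s−1}. -/

import Mathlib

open scoped Classical

noncomputable section

/-- The Dirichlet L-function of `χ` (extended to modulus `0` by `0`, a case never used below). -/
def Lfun {N : ℕ} (χ : DirichletCharacter ℂ N) (s : ℂ) : ℂ :=
  if h : N = 0 then 0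
  else
    haveI : NeZero N := ⟨h⟩
    DirichletCharacter.LFunction χ s

/-- A Dirichlet character is *real* if all of its values are real numbers. -/
def IsRealChar {N : ℕ} (χ : DirichletCharacter ℂ N) : Prop :=
  ∀ a : ZMod N, (χ a).im = 0

/-- `𝓛 = log D`. -/
def bigL (D : ℕ) : ℝ := Real.log D

/-- `P = exp (𝓛 ^ 9)`. -/
def bigP (D : ℕ) : ℝ := Real.exp (bigL D ^ 9)

/-- Assumption (A): `L(1, χ) < 𝓛 ^ (-2022)`. -/
def AssumptionA (D : ℕ) (χ : DirichletCharacter ℂ D) : Prop :=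
  (Lfun χ 1).re < bigL D ^ (-2022 : ℤ)

/-- `p ~ P`, i.e. `p` is a prime with `P < p < P * (1 + 𝓛 ^ (-68))`. -/
def SimP (D p : ℕ) : Prop :=
  p.Prime ∧ bigP D < (p : ℝ) ∧ (p : ℝ) < bigP D * (1 + bigL D ^ (-68 : ℤ))

/-- The finite set of primes `p ~ P`. -/
def primesP (D : ℕ) : Finset ℕ :=
  (Finset.range ⌈2 * bigP D⌉₊).filter (SimP D)

/-- `𝒫 = ∑_{p ~ P} p`. -/
def calP (D : ℕ) : ℝ := ∑ p ∈ primesP D, (p : ℝ)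

/-- `ν(n) = ∑_{d ∣ n} χ(d)`. -/
def nuF (D : ℕ) (χ : DirichletCharacter ℂ D) (n : ℕ) : ℂ :=
  ∑ d ∈ n.divisors, χ (d : ZMod D)

/-- `υ(n) = ∑_{ab = n} μ(a) μ(b) χ(b)`. -/
def upsF (D : ℕ) (χ : DirichletCharacter ℂ D) (n : ℕ) : ℂ :=
  ∑ d ∈ n.divisors,
    ((ArithmeticFunction.moebius (n / d) : ℤ) : ℂ) * ((ArithmeticFunction.moebius d : ℤ) : ℂ) *
      χ (d : ZMod D)

/-- `t₀ = 𝓛 ^ 519`. -/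
def t0 (D : ℕ) : ℝ := bigL D ^ 519

/-- `s₀ = 1/2 + 2 π i t₀`. -/
def s0 (D : ℕ) : ℂ := 1 / 2 + 2 * (Real.pi : ℂ) * Complex.I * (t0 D : ℂ)

/-- `𝓛₁ = 𝓛 ^ 405`. -/
def bigL1 (D : ℕ) : ℝ := bigL D ^ 405

/-- `ν` truncated to `n ≤ D ^ 4`, as an arithmetic function. -/
def nuT (D : ℕ) (χ : DirichletCharacter ℂ D) : ArithmeticFunction ℂ :=
  ⟨fun n => if n = 0 then 0 else if n ≤ D ^ 4 then nuF D χ n else 0, by simp⟩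

/-- `υ` truncated to `n ≤ D ^ 4`, as an arithmetic function. -/
def upsT (D : ℕ) (χ : DirichletCharacter ℂ D) : ArithmeticFunction ℂ :=
  ⟨fun n => if n = 0 then 0 else if n ≤ D ^ 4 then upsF D χ n else 0, by simp⟩

/-- `ν₂₀`, the 20-fold Dirichlet convolution of the truncation of `ν`. -/
def nu20 (D : ℕ) (χ : DirichletCharacter ℂ D) (n : ℕ) : ℂ := (nuT D χ ^ 20) n

/-- `υ₂₀`, the 20-fold Dirichlet convolution of the truncation of `υ`. -/
def ups20 (D : ℕ) (χ : DirichletCharacter ℂ D) (n : ℕ) : ℂ := (upsT D χ ^ 20) n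

/-- `ς(n) = ∑_{lm = n, l ≤ D⁴, m ≤ D⁴} ν(l) υ(m)`. -/
def sigF (D : ℕ) (χ : DirichletCharacter ℂ D) (n : ℕ) : ℂ :=
  ∑ d ∈ n.divisors,
    if d ≤ D ^ 4 ∧ n / d ≤ D ^ 4 then nuF D χ d * upsF D χ (n / d) else 0

/-- `X₁(x, ψ) = ∑_{n ≤ x} ν₂₀(n) ψ(n) n^{-s₀}`. -/
def X1 (D : ℕ) (χ : DirichletCharacter ℂ D) {p : ℕ} (ψ : DirichletCharacter ℂ p) (x : ℝ) : ℂ :=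
  ∑ n ∈ Finset.Icc 1 ⌊x⌋₊, nu20 D χ n * ψ (n : ZMod p) * (n : ℂ) ^ (-s0 D)

/-- `X₂(x, ψ) = ∑_{n ≤ x} υ₂₀(n) ψ(n) n^{-s₀}`. -/
def X2 (D : ℕ) (χ : DirichletCharacter ℂ D) {p : ℕ} (ψ : DirichletCharacter ℂ p) (x : ℝ) : ℂ :=
  ∑ n ∈ Finset.Icc 1 ⌊x⌋₊, ups20 D χ n * ψ (n : ZMod p) * (n : ℂ) ^ (-s0 D)

/-- `X₃(x, ψ) = ∑_{D⁴ < n ≤ x} ν(n) ψ(n) n^{-s₀}`. -/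
def X3 (D : ℕ) (χ : DirichletCharacter ℂ D) {p : ℕ} (ψ : DirichletCharacter ℂ p) (x : ℝ) : ℂ :=
  ∑ n ∈ Finset.Ioc (D ^ 4) ⌊x⌋₊, nuF D χ n * ψ (n : ZMod p) * (n : ℂ) ^ (-s0 D)

/-- `X₄(x, ψ) = ∑_{D⁴ < n ≤ x} ς(n) ψ(n) n^{-s₀}`. -/
def X4 (D : ℕ) (χ : DirichletCharacter ℂ D) {p : ℕ} (ψ : DirichletCharacter ℂ p) (x : ℝ) : ℂ :=
  ∑ n ∈ Finset.Ioc (D ^ 4) ⌊x⌋₊, sigF D χ n * ψ (n : ZMod p) * (n : ℂ) ^ (-s0 D)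

/-- Inequality (3.4). -/
def Ineq1 (D : ℕ) (χ : DirichletCharacter ℂ D) {p : ℕ} (ψ : DirichletCharacter ℂ p) : Prop :=
  ‖X1 D χ ψ ((D : ℝ) ^ 80)‖ + ‖X2 D χ ψ ((D : ℝ) ^ 80)‖ +
      (∫ x in (1 : ℝ)..((D : ℝ) ^ 80), (‖X1 D χ ψ x‖ + ‖X2 D χ ψ x‖) / x) <
    bigL D ^ 1171

/-- Inequality (3.5). -/
def Ineq2 (D : ℕ) (χ : DirichletCharacter ℂ D) {p : ℕ} (ψ : DirichletCharacter ℂ p) : Prop :=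
  ‖X3 D χ ψ (bigP D ^ 2)‖ + (∫ x in ((D : ℝ) ^ 4)..(bigP D ^ 2), ‖X3 D χ ψ x‖ / x) <
    bigL D ^ (-585 : ℤ)

/-- Inequality (3.6). -/
def Ineq3 (D : ℕ) (χ : DirichletCharacter ℂ D) {p : ℕ} (ψ : DirichletCharacter ℂ p) : Prop :=
  ‖X4 D χ ψ ((D : ℝ) ^ 8)‖ + (∫ x in ((D : ℝ) ^ 4)..((D : ℝ) ^ 8), ‖X4 D χ ψ x‖ / x) <
    bigL D ^ (-633 : ℤ)

/-- Membership in `Ψ₁`: `ψ` is a primitive character mod `p` with `p ~ P` satisfying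
(3.4), (3.5) and (3.6). -/
def MemPsi1 (D : ℕ) (χ : DirichletCharacter ℂ D) {p : ℕ} (ψ : DirichletCharacter ℂ p) : Prop :=
  SimP D p ∧ ψ.IsPrimitive ∧ Ineq1 D χ ψ ∧ Ineq2 D χ ψ ∧ Ineq3 D χ ψ

/-- `F(s, ψ) = ∑_{n ≤ D⁴} ν(n) ψ(n) n^{-s}`. -/
def Ffun (D : ℕ) (χ : DirichletCharacter ℂ D) {p : ℕ} (ψ : DirichletCharacter ℂ p) (s : ℂ) : ℂ :=
  ∑ n ∈ Finset.Icc 1 (D ^ 4), nuF D χ n * ψ (n : ZMod p) * (n : ℂ) ^ (-s)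

/-- `G(s, ψ) = ∑_{n ≤ D⁴} υ(n) ψ(n) n^{-s}`. -/
def Gfun (D : ℕ) (χ : DirichletCharacter ℂ D) {p : ℕ} (ψ : DirichletCharacter ℂ p) (s : ℂ) : ℂ :=
  ∑ n ∈ Finset.Icc 1 (D ^ 4), upsF D χ n * ψ (n : ZMod p) * (n : ℂ) ^ (-s)

/-- `F'(s, ψ) = -∑_{n ≤ D⁴} ν(n) ψ(n) (log n) n^{-s}`, the derivative of `F` in `s`. -/
def Ffun' (D : ℕ) (χ : DirichletCharacter ℂ D) {p : ℕ} (ψ : DirichletCharacter ℂ p) (s : ℂ) : ℂ :=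
  -∑ n ∈ Finset.Icc 1 (D ^ 4),
    nuF D χ n * ψ (n : ZMod p) * ((Real.log n : ℝ) : ℂ) * (n : ℂ) ^ (-s)

/-- `F(1 - s, ψ̄) = ∑_{n ≤ D⁴} ν(n) conj(ψ(n)) n^{s - 1}`, as a function of `s`. -/
def FfunBar (D : ℕ) (χ : DirichletCharacter ℂ D) {p : ℕ} (ψ : DirichletCharacter ℂ p)
    (s : ℂ) : ℂ :=
  ∑ n ∈ Finset.Icc 1 (D ^ 4),
    nuF D χ n * (starRingEnd ℂ) (ψ (n : ZMod p)) * (n : ℂ) ^ (s - 1)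

/-- The region `Ω`. -/
def InOmega (D : ℕ) (s : ℂ) : Prop :=
  |(s - s0 D).re| < 1 / 2 ∧ |(s - s0 D).im| < bigL1 D + 2

/-- The region `Ω₁`. -/
def InOmega1 (D : ℕ) (s : ℂ) : Prop :=
  1 / 2 - Real.log (bigL D) / (100 * bigL D) < s.re ∧
    s.re < 1 + Real.log (bigL D) / (100 * bigL D) ∧
    |s.im - 2 * Real.pi * t0 D| < bigL1 D + 5

/-- The region `Ω₂`. -/
def InOmega2 (D : ℕ) (s : ℂ) : Prop :=
  1 / 2 - (bigL D)⁻¹ < s.re ∧ s.re < 1 + (bigL D)⁻¹ ∧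
    |s.im - 2 * Real.pi * t0 D| < bigL1 D + 4

/-- `α = π / log P`. -/
def alphaD (D : ℕ) : ℝ := Real.pi / Real.log (bigP D)

/-- The region `Ω₃`. -/
def InOmega3 (D : ℕ) (s : ℂ) : Prop :=
  1 / 2 - alphaD D < s.re ∧ s.re < 1 + alphaD D ∧
    |s.im - 2 * Real.pi * t0 D| < bigL1 D + 3

/-- The Gauss sum `τ(θ) = ∑_{a mod k} θ(a) e(a/k)`. -/
def tauSum {k : ℕ} (θ : DirichletCharacter ℂ k) : ℂ :=
  ∑ a ∈ Finset.range k,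
    θ (a : ZMod k) * Complex.exp (2 * (Real.pi : ℂ) * Complex.I * (a : ℂ) / (k : ℂ))

/-- The factor `Z(s, θ)` from the functional equation. -/
def Zfun {k : ℕ} (θ : DirichletCharacter ℂ k) (s : ℂ) : ℂ :=
  if θ (-1) = 1 then
    tauSum θ * (Real.pi : ℂ) ^ (s - 1 / 2) * (k : ℂ) ^ (-s) *
      Complex.Gamma ((1 - s) / 2) / Complex.Gamma (s / 2)
  else
    -Complex.I * tauSum θ * (Real.pi : ℂ) ^ (s - 1 / 2) * (k : ℂ) ^ (-s) *
      Complex.Gamma ((2 - s) / 2) / Complex.Gamma ((1 + s) / 2)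

/-- The product character `χψ` modulo `D * p`, i.e. `n ↦ χ(n) ψ(n)`. -/
def chiPsi (D : ℕ) (χ : DirichletCharacter ℂ D) {p : ℕ} (ψ : DirichletCharacter ℂ p) :
    DirichletCharacter ℂ (D * p) :=
  DirichletCharacter.changeLevel (dvd_mul_right D p) χ *
    DirichletCharacter.changeLevel (dvd_mul_left p D) ψ

/-- `Z̃(s, ψ) = Z(s, ψ) Z(s, χψ)`. -/
def Ztilde (D : ℕ) (χ : DirichletCharacter ℂ D) {p : ℕ} (ψ : DirichletCharacter ℂ p)
    (s : ℂ) : ℂ :=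
  Zfun ψ s * Zfun (chiPsi D χ ψ) s

/-- `T = exp (𝓛 ^ 1.1)`. -/
def bigT (D : ℕ) : ℝ := Real.exp (bigL D ^ (1.1 : ℝ))

/-- `P₄ = P T⁻² t₀`. -/
def P4 (D : ℕ) : ℝ := bigP D * bigT D ^ (-2 : ℤ) * t0 D

/-- The smooth weight `g(x) = π^{-1/2} ∫_{-∞}^{𝓛^{15} log x} e^{-u²} du`. -/
def gfun (D : ℕ) (x : ℝ) : ℝ :=
  Real.pi ^ (-(1 : ℝ) / 2) * ∫ u in Set.Iio (bigL D ^ 15 * Real.log x), Real.exp (-u ^ 2)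

/-- `g*(y) = g(y)` for `y > 1/2`, and `0` otherwise. -/
def gstar (D : ℕ) (y : ℝ) : ℝ := if 1 / 2 < y then gfun D y else 0

/-- `K(s, ψ) = ∑_n ψ(n) n^{-s} g*(P₄ / n)`. -/
def Kfun (D : ℕ) {p : ℕ} (ψ : DirichletCharacter ℂ p) (s : ℂ) : ℂ :=
  ∑' n : ℕ, ψ (n : ZMod p) * (n : ℂ) ^ (-s) * ((gstar D (P4 D / n) : ℝ) : ℂ)

/-- `N(1 - s, ψ̄) = ∑_n conj(ψ(n)) n^{s-1} g*(T² / n)`, as a function of `s`. -/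
def Nfun (D : ℕ) {p : ℕ} (ψ : DirichletCharacter ℂ p) (s : ℂ) : ℂ :=
  ∑' n : ℕ,
    (starRingEnd ℂ) (ψ (n : ZMod p)) * (n : ℂ) ^ (s - 1) * ((gstar D (bigT D ^ 2 / n) : ℝ) : ℂ)

/-- `𝔞 = (6/π²) L'(1,χ)² ∏_{q ∣ D} q/(q+1)`. -/
def fraka (D : ℕ) (χ : DirichletCharacter ℂ D) : ℂ :=
  6 / (Real.pi : ℂ) ^ 2 * deriv (Lfun χ) 1 ^ 2 * ∏ q ∈ D.primeFactors, (q : ℂ) / ((q : ℂ) + 1)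

/-! ### Part A: ratio bounds for the Gamma function -/

/-- `log (|u + iy| / u)`. -/
def gGam (y u : ℝ) : ℝ := Real.log (u ^ 2 + y ^ 2) / 2 - Real.log u

lemma gGam_convex (y : ℝ) : ConvexOn ℝ (Set.Ioi 0) (gGam y) := by
  have hd : ∀ u ∈ Set.Ioi (0 : ℝ), HasDerivAt (gGam y) (u / (u ^ 2 + y ^ 2) - u⁻¹) u := by
    intro u hu
    have hu' : (0 : ℝ) < u := hu
    have h1 : u ^ 2 + y ^ 2 ≠ 0 := by positivity
    have := (((hasDerivAt_pow 2 u).add_const (y ^ 2)).log h1).div_const 2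
    have := this.sub (Real.hasDerivAt_log hu'.ne')
    refine this.congr_deriv ?_
    simp
    field_simp
  apply MonotoneOn.convexOn_of_deriv (convex_Ioi 0)
  · exact fun u hu => (hd u hu).continuousAt.continuousWithinAt
  · rw [interior_Ioi]
    exact fun u hu => (hd u hu).differentiableAt.differentiableWithinAt
  · rw [interior_Ioi]
    intro u hu v hv huv
    rw [(hd u hu).deriv, (hd v hv).deriv]
    have hu' : (0 : ℝ) < u := hu
    have hv' : (0 : ℝ) < v := hv
    have e : ∀ u : ℝ, 0 < u → u / (u ^ 2 + y ^ 2) - u⁻¹ = -(y ^ 2 / (u * (u ^ 2 + y ^ 2))) := by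
      intro u hu
      field_simp
      ring
    rw [e u hu', e v hv']
    apply neg_le_neg
    gcongr

lemma gGam_slope (y u θ : ℝ) (hu : 1 < u) (hθ : 0 ≤ θ) :
    gGam y u - gGam y (u + θ) ≤ θ * (gGam y (u - 1) - gGam y u) := by
  rcases hθ.eq_or_lt with rfl | h
  · simp
  have := (gGam_convex y).slope_mono_adjacent (x := u - 1) (y := u) (z := u + θ)
    (by simp; linarith) (by simp; linarith) (by linarith) (by linarith)
  rw [div_le_div_iff₀ (by linarith) (by linarith)] at this
  nlinarith

lemma gGam_nonneg (y u : ℝ) (hu : 0 < u) : 0 ≤ gGam y u := by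
  have : Real.log (u ^ 2) ≤ Real.log (u ^ 2 + y ^ 2) :=
    Real.log_le_log (by positivity) (by nlinarith [sq_nonneg y])
  rw [Real.log_pow] at this
  unfold gGam
  push_cast at this
  linarith

lemma gGam_sum (y b θ : ℝ) (hb : 0 < b) (hθ : 0 ≤ θ) (n : ℕ) :
    ∑ j ∈ Finset.range (n + 1), (gGam y (b + j) - gGam y (b + θ + j)) ≤
      gGam y b - gGam y (b + θ) + θ * (gGam y b - gGam y (b + n)) := by
  induction n with
  | zero => simp
  | succ n ih =>
    rw [Finset.sum_range_succ]
    have := gGam_slope y (b + (n + 1 : ℕ)) θ (by push_cast; linarith [Nat.cast_nonneg (α := ℝ) n]) hθ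
    have e1 : b + ((n + 1 : ℕ) : ℝ) - 1 = b + n := by push_cast; ring
    have e2 : b + ((n + 1 : ℕ) : ℝ) + θ = b + θ + ((n + 1 : ℕ) : ℝ) := by ring
    rw [e1, e2] at this
    nlinarith

lemma exp_gGam (y u : ℝ) (hu : 0 < u) : ‖(u : ℂ) + y * Complex.I‖ = u * Real.exp (gGam y u) := by
  unfold gGam
  rw [Real.exp_sub, Real.exp_log hu, mul_div_cancel₀ _ hu.ne', Complex.norm_add_mul_I,
    Real.sqrt_eq_rpow, Real.rpow_def_of_pos (by positivity)]
  congr 1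
  ring

lemma norm_GammaSeq (y a : ℝ) (ha : 0 < a) (n : ℕ) (hn : n ≠ 0) :
    ‖Complex.GammaSeq (a + y * Complex.I) n‖ =
      Real.GammaSeq a n * Real.exp (-∑ j ∈ Finset.range (n + 1), gGam y (a + j)) := by
  unfold Complex.GammaSeq Real.GammaSeq
  rw [norm_div, norm_mul, Complex.norm_natCast_cpow_of_pos (Nat.pos_of_ne_zero hn), norm_prod,
    Real.exp_neg, Real.exp_sum]
  have : ∀ j ∈ Finset.range (n + 1), ‖(a : ℂ) + y * Complex.I + j‖ =
      (a + j) * Real.exp (gGam y (a + j)) := by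
    intro j _
    rw [← exp_gGam y (a + j) (by positivity)]
    congr 1
    push_cast
    ring
  rw [Finset.prod_congr rfl this, Finset.prod_mul_distrib]
  simp
  field_simp

lemma GammaSeq_pos (a : ℝ) (ha : 0 < a) (n : ℕ) (hn : n ≠ 0) : 0 < Real.GammaSeq a n := by
  unfold Real.GammaSeq
  have : 0 < n := Nat.pos_of_ne_zero hn
  have : 0 < ∏ j ∈ Finset.range (n + 1), (a + (j : ℝ)) :=
    Finset.prod_pos fun j _ => by positivity
  positivity

lemma gamma_ratio (y a b : ℝ) (hb : 0 < b) (hab : b ≤ a) :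
    ‖Complex.Gamma (a + y * Complex.I)‖ * Real.Gamma b ≤
      Real.Gamma a * ‖Complex.Gamma (b + y * Complex.I)‖ *
        Real.exp (gGam y b - gGam y a + (a - b) * gGam y b) := by
  have ha : 0 < a := hb.trans_le hab
  have t1 := ((Complex.GammaSeq_tendsto_Gamma (a + y * Complex.I)).norm).mul
    (Real.GammaSeq_tendsto_Gamma b)
  have t2 := (((Real.GammaSeq_tendsto_Gamma a).mul
    ((Complex.GammaSeq_tendsto_Gamma (b + y * Complex.I)).norm))).mul_const
      (Real.exp (gGam y b - gGam y a + (a - b) * gGam y b))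
  refine le_of_tendsto_of_tendsto t1 t2 ?_
  filter_upwards [Filter.eventually_ne_atTop 0] with n hn
  rw [norm_GammaSeq y a ha n hn, norm_GammaSeq y b hb n hn]
  have h := gGam_sum y b (a - b) hb (by linarith) n
  rw [add_sub_cancel, Finset.sum_sub_distrib] at h
  have h2 := gGam_nonneg y (b + n) (by positivity)
  have h3 := GammaSeq_pos a ha n hn
  have h4 := GammaSeq_pos b hb n hn
  have : Real.exp (-∑ j ∈ Finset.range (n + 1), gGam y (a + j)) ≤
    Real.exp (-∑ j ∈ Finset.range (n + 1), gGam y (b + j)) *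
      Real.exp (gGam y b - gGam y a + (a - b) * gGam y b) := by
    rw [← Real.exp_add]
    apply Real.exp_le_exp.mpr
    nlinarith
  calc _ = (Real.GammaSeq a n * Real.GammaSeq b n) *
        Real.exp (-∑ j ∈ Finset.range (n + 1), gGam y (a + j)) := by ring
    _ ≤ _ := mul_le_mul_of_nonneg_left this (by positivity)
    _ = _ := by ring

/-- Elementary Stirling-type ratio bound. -/
lemma gamma_ratio_bound : ∃ C : ℝ, 0 < C ∧ ∀ y a b : ℝ, 1 / 8 ≤ b → b ≤ a → a ≤ 4 →
    ‖Complex.Gamma (a + y * Complex.I)‖ ≤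
      C * (1 + |y|) ^ (a - b) * ‖Complex.Gamma (b + y * Complex.I)‖ := by
  have hc : ContinuousOn Real.Gamma (Set.Icc (1 / 8) 4) := fun x hx =>
    (Real.differentiableAt_Gamma (fun m => by
      have := hx.1
      have : (0 : ℝ) ≤ m := m.cast_nonneg
      linarith)).continuousAt.continuousWithinAt
  obtain ⟨x1, hx1, h1⟩ := isCompact_Icc.exists_isMaxOn (Set.nonempty_Icc.mpr (by norm_num)) hc
  obtain ⟨x2, hx2, h2⟩ := isCompact_Icc.exists_isMinOn (Set.nonempty_Icc.mpr (by norm_num)) hc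
  have p1 : 0 < Real.Gamma x1 := Real.Gamma_pos_of_pos (by linarith [hx1.1])
  have p2 : 0 < Real.Gamma x2 := Real.Gamma_pos_of_pos (by linarith [hx2.1])
  refine ⟨Real.Gamma x1 / Real.Gamma x2 * (32 * 32 ^ (4 : ℝ)), by positivity, ?_⟩
  intro y a b hb hab ha
  have hb0 : 0 < b := by linarith
  have ha0 : 0 < a := by linarith
  have h := gamma_ratio y a b hb0 hab
  have q1 : Real.Gamma a ≤ Real.Gamma x1 := h1 ⟨by linarith, ha⟩
  have q2 : Real.Gamma x2 ≤ Real.Gamma b := h2 ⟨hb, by linarith⟩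
  have e1 : Real.exp (gGam y b) ≤ 32 * (1 + |y|) := by
    have h5 := exp_gGam y b hb0
    have h6 : ‖(b : ℂ) + y * Complex.I‖ ≤ b + |y| := by
      refine (norm_add_le _ _).trans ?_
      simp [abs_of_pos hb0]
    have h7 : Real.exp (gGam y b) = ‖(b : ℂ) + y * Complex.I‖ / b := by
      rw [h5]; field_simp
    rw [h7, div_le_iff₀ hb0]
    nlinarith [abs_nonneg y]
  have e2 : Real.exp (gGam y b - gGam y a) ≤ 32 := by
    have h5 := exp_gGam y b hb0
    have h6 := exp_gGam y a ha0
    have h7 : ‖(b : ℂ) + y * Complex.I‖ ≤ ‖(a : ℂ) + y * Complex.I‖ := by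
      rw [Complex.norm_add_mul_I, Complex.norm_add_mul_I]
      apply Real.sqrt_le_sqrt
      nlinarith
    rw [h5, h6] at h7
    rw [Real.exp_sub, div_le_iff₀ (Real.exp_pos _)]
    have := Real.exp_pos (gGam y a)
    have := Real.exp_pos (gGam y b)
    have : 1/8 * Real.exp (gGam y b) ≤ 4 * Real.exp (gGam y a) := by nlinarith
    linarith
  have e3 : Real.exp (gGam y b - gGam y a + (a - b) * gGam y b) ≤
      32 * 32 ^ (4 : ℝ) * (1 + |y|) ^ (a - b) := by
    rw [Real.exp_add, mul_comm (a - b), Real.exp_mul, mul_assoc]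
    gcongr
    calc Real.exp (gGam y b) ^ (a - b) ≤ (32 * (1 + |y|)) ^ (a - b) :=
          Real.rpow_le_rpow (Real.exp_pos _).le e1 (by linarith)
      _ = 32 ^ (a - b) * (1 + |y|) ^ (a - b) := by
          rw [Real.mul_rpow (by norm_num) (by positivity)]
      _ ≤ _ := by
          gcongr
          · norm_num
          · linarith
  have e4 : ‖Complex.Gamma (a + y * Complex.I)‖ * Real.Gamma x2 ≤
      Real.Gamma x1 * ‖Complex.Gamma (b + y * Complex.I)‖ *
      (32 * 32 ^ (4 : ℝ) * (1 + |y|) ^ (a - b)) := by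
    calc _ ≤ ‖Complex.Gamma (a + y * Complex.I)‖ * Real.Gamma b := by gcongr
      _ ≤ _ := h
      _ ≤ _ := by gcongr
  rw [← le_div_iff₀ p2] at e4
  refine e4.trans (le_of_eq ?_)
  ring

lemma norm_Gamma_neg_im (a y : ℝ) :
    ‖Complex.Gamma (a - y * Complex.I)‖ = ‖Complex.Gamma (a + y * Complex.I)‖ := by
  have h : (a : ℂ) - y * Complex.I = (starRingEnd ℂ) ((a : ℂ) + y * Complex.I) := by
    simp [sub_eq_add_neg]
  rw [h, Complex.Gamma_conj, RCLike.norm_conj]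

lemma gammaZ1 : ∃ C : ℝ, 0 < C ∧ ∀ y β c : ℝ, 0 ≤ β → β ≤ 1 / 8 → 1 / 4 ≤ c → c ≤ 1 →
    ‖Complex.Gamma ((c + β / 2 : ℝ) - y * Complex.I) / Complex.Gamma ((c - β / 2 : ℝ) + y * Complex.I)‖
      ≤ C * (1 + |y|) ^ β := by
  obtain ⟨C, hC, h⟩ := gamma_ratio_bound
  refine ⟨C, hC, fun y β c h0 h1 h2 h3 => ?_⟩
  rw [norm_div, norm_Gamma_neg_im]
  have := h y (c + β / 2) (c - β / 2) (by linarith) (by linarith) (by linarith)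
  rw [show c + β / 2 - (c - β / 2) = β by ring] at this
  exact div_le_of_le_mul₀ (norm_nonneg _) (by positivity) this

lemma gammaZ2 : ∃ C : ℝ, 0 < C ∧ ∀ y a b : ℝ, -1 / 8 ≤ a → a ≤ 5 / 4 → -1 / 4 ≤ b → b ≤ 9 / 8 →
    a - b ≤ 1 → b ≤ a + 3 / 4 → (1 / 16 ≤ a ∨ 1 / 2 ≤ |y|) →
    ‖Complex.Gamma ((a : ℝ) - y * Complex.I) / Complex.Gamma ((b : ℝ) + y * Complex.I)‖
      ≤ C * (1 + |y|) ^ (3 : ℝ) := by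
  obtain ⟨C, hC, h⟩ := gamma_ratio_bound
  refine ⟨C * 64, by positivity, fun y a b h0 h1 h2 h3 h4 h5 h6 => ?_⟩
  rw [div_eq_mul_inv, norm_mul, norm_Gamma_neg_im]
  have hy : 0 ≤ |y| := abs_nonneg y
  have nre : ∀ c : ℝ, |c| ≤ ‖(c : ℂ) + y * Complex.I‖ := fun c => by
    simpa using Complex.abs_re_le_norm ((c : ℂ) + y * Complex.I)
  have nim : ∀ c : ℝ, |y| ≤ ‖(c : ℂ) + y * Complex.I‖ := fun c => by
    simpa using Complex.abs_im_le_norm ((c : ℂ) + y * Complex.I)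
  have na : 1 / 16 ≤ ‖(a : ℂ) + y * Complex.I‖ := by
    rcases h6 with h6 | h6
    · exact (h6.trans (le_abs_self a)).trans (nre a)
    · linarith [nim a]
  have na1 : 7 / 8 ≤ ‖((a + 1 : ℝ) : ℂ) + y * Complex.I‖ := by
    have := nre (a + 1)
    linarith [le_abs_self (a + 1)]
  have nb : ‖(b : ℂ) + y * Complex.I‖ ≤ 2 * (1 + |y|) := by
    refine (norm_add_le _ _).trans ?_
    rw [norm_mul, Complex.norm_I, Complex.norm_real, Complex.norm_real, Real.norm_eq_abs, Real.norm_eq_abs]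
    have : |b| ≤ 2 := by rw [abs_le]; constructor <;> linarith
    linarith
  have za : (a : ℂ) + y * Complex.I ≠ 0 := by
    intro h; rw [h, norm_zero] at na; linarith
  have za1 : ((a + 1 : ℝ) : ℂ) + y * Complex.I ≠ 0 := by
    intro h; rw [h, norm_zero] at na1; linarith
  have e1 := Complex.Gamma_add_one _ za
  have e2 := Complex.Gamma_add_one _ za1
  rw [show (a : ℂ) + y * Complex.I + 1 = ((a + 1 : ℝ) : ℂ) + y * Complex.I by push_cast; ring] at e1
  rw [show ((a + 1 : ℝ) : ℂ) + y * Complex.I + 1 = ((a + 2 : ℝ) : ℂ) + y * Complex.I by push_cast; ring, e1] at e2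
  have e3 := Complex.one_div_Gamma_eq_self_mul_one_div_Gamma_add_one ((b : ℂ) + y * Complex.I)
  rw [show (b : ℂ) + y * Complex.I + 1 = ((b + 1 : ℝ) : ℂ) + y * Complex.I by push_cast; ring] at e3
  have h7 := h y (a + 2) (b + 1) (by linarith) (by linarith) (by linarith)
  rw [e3, norm_mul]
  have g1 : 0 < ‖Complex.Gamma (((b + 1 : ℝ) : ℂ) + y * Complex.I)‖ := by
    rw [norm_pos_iff]
    apply Complex.Gamma_ne_zero_of_re_pos
    simp; linarith
  have h8 : (1 + |y|) ^ (a + 2 - (b + 1)) ≤ (1 + |y|) ^ (2 : ℝ) :=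
    Real.rpow_le_rpow_of_exponent_le (by linarith) (by linarith)
  have e2n := congrArg norm e2
  rw [norm_mul, norm_mul] at e2n
  set G := ‖Complex.Gamma ((a : ℂ) + y * Complex.I)‖
  have hG : 0 ≤ G := norm_nonneg _
  have h9 : G * (7 / 128) ≤ C * (1 + |y|) ^ (2 : ℝ) * ‖Complex.Gamma (((b + 1 : ℝ) : ℂ) + y * Complex.I)‖ := by
    calc G * (7 / 128) = (7 / 8) * ((1 / 16) * G) := by ring
      _ ≤ ‖((a + 1 : ℝ) : ℂ) + y * Complex.I‖ * (‖(a : ℂ) + y * Complex.I‖ * G) := by gcongr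
      _ = _ := e2n.symm
      _ ≤ _ := h7
      _ ≤ _ := by gcongr
  rw [norm_inv]
  have h10 : (1 + |y|) ^ (3 : ℝ) = (1 + |y|) ^ (2 : ℝ) * (1 + |y|) := by
    rw [show (3 : ℝ) = 2 + 1 by norm_num, Real.rpow_add (by linarith), Real.rpow_one]
  rw [h10]
  set g := ‖Complex.Gamma (((b + 1 : ℝ) : ℂ) + y * Complex.I)‖
  have h11 : G * g⁻¹ ≤ 32 * (C * (1 + |y|) ^ (2 : ℝ)) := by
    rw [← div_eq_mul_inv, div_le_iff₀ g1]
    have : 0 ≤ C * (1 + |y|) ^ (2 : ℝ) * g := by positivity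
    nlinarith
  calc G * (‖(b : ℂ) + y * Complex.I‖ * g⁻¹) = (G * g⁻¹) * ‖(b : ℂ) + y * Complex.I‖ := by ring
    _ ≤ (32 * (C * (1 + |y|) ^ (2 : ℝ))) * (2 * (1 + |y|)) := by gcongr
    _ = _ := by ring

lemma tauSum_eq_gaussSum {k : ℕ} [NeZero k] (θ : DirichletCharacter ℂ k) :
    tauSum θ = gaussSum θ ZMod.stdAddChar := by
  unfold tauSum gaussSum
  refine Finset.sum_bij' (fun a _ => (a : ZMod k)) (fun a _ => a.val) (fun a _ => Finset.mem_univ _)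
    (fun a _ => Finset.mem_range.mpr (ZMod.val_lt a)) ?_ ?_ ?_
  · intro a ha
    exact ZMod.val_cast_of_lt (Finset.mem_range.mp ha)
  · intro a _
    simp
  · intro a _
    congr 1
    have := ZMod.stdAddChar_coe (N := k) (a : ℤ)
    simp only [Int.cast_natCast] at this
    rw [this]

lemma norm_tauSum {k : ℕ} (hk : k ≠ 0) (θ : DirichletCharacter ℂ k) (hθ : θ.IsPrimitive) :
    ‖tauSum θ‖ = (k : ℝ) ^ (1 / 2 : ℝ) := by
  haveI : NeZero k := ⟨hk⟩
  rw [tauSum_eq_gaussSum]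
  set g := gaussSum θ ZMod.stdAddChar with hg
  have h1 : (ZMod.dft (θ : ZMod k → ℂ)) = g • (fun j => (θ⁻¹ : DirichletCharacter ℂ k) (-j)) := by
    ext j
    rw [hθ.fourierTransform_eq_inv_mul_gaussSum]
    simp [hg, mul_comm]
  have h2 := congrFun (ZMod.dft_dft (θ : ZMod k → ℂ)) (-1)
  rw [h1, map_smul, ZMod.dft_comp_neg] at h2
  simp only [Pi.smul_apply, neg_neg, map_one, smul_eq_mul, mul_one] at h2
  rw [DirichletCharacter.fourierTransform_eq_gaussSum_mulShift] at h2
  have h3 : gaussSum θ⁻¹ (ZMod.stdAddChar.mulShift (-1 : ZMod k)) = star g := by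
    rw [hg, star_gaussSum_eq]
    congr 1
    ext x
    simp [AddChar.mulShift_apply]
  rw [h3] at h2
  have h4 := congrArg norm h2
  rw [norm_mul, norm_star, Complex.norm_natCast] at h4
  rw [← Real.sqrt_eq_rpow, eq_comm, Real.sqrt_eq_iff_mul_self_eq (by positivity) (by positivity)]
  exact h4.symm

lemma Zfun_norm {k : ℕ} (hk : k ≠ 0) (θ : DirichletCharacter ℂ k) (hθ : θ.IsPrimitive) (σ τ : ℝ) :
    ∃ c : ℝ, (c = 1 / 4 ∨ c = 3 / 4) ∧ ‖Zfun θ (σ + τ * Complex.I)‖ =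
      (k : ℝ) ^ (1 / 2 - σ) * Real.pi ^ (σ - 1 / 2) *
        ‖Complex.Gamma ((c + (1 / 2 - σ) / 2 : ℝ) - (τ / 2 : ℝ) * Complex.I) /
          Complex.Gamma ((c - (1 / 2 - σ) / 2 : ℝ) + (τ / 2 : ℝ) * Complex.I)‖ := by
  have hk0 : (0 : ℝ) < k := by positivity
  have e1 : ‖(k : ℂ) ^ (-((σ : ℂ) + τ * Complex.I))‖ = (k : ℝ) ^ (-σ) := by
    rw [← Complex.ofReal_natCast, Complex.norm_cpow_eq_rpow_re_of_pos hk0]; simp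
  have e2 : ‖(Real.pi : ℂ) ^ ((σ : ℂ) + τ * Complex.I - 1 / 2)‖ = Real.pi ^ (σ - 1 / 2) := by
    rw [Complex.norm_cpow_eq_rpow_re_of_pos Real.pi_pos]; simp
  have e3 : (k : ℝ) ^ (1 / 2 - σ) = (k : ℝ) ^ (1 / 2 : ℝ) * (k : ℝ) ^ (-σ) := by
    rw [← Real.rpow_add hk0]; rfl
  by_cases h : θ (-1) = 1
  · refine ⟨1 / 4, Or.inl rfl, ?_⟩
    rw [Zfun, if_pos h, mul_div_assoc, norm_mul, norm_mul, norm_mul, norm_tauSum hk θ hθ, e1, e2, e3]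
    rw [show (1 - ((σ : ℂ) + τ * Complex.I)) / 2 = (1 / 4 + (1 / 2 - σ) / 2 : ℝ) - (τ / 2 : ℝ) * Complex.I by
      push_cast; ring, show ((σ : ℂ) + τ * Complex.I) / 2 = (1 / 4 - (1 / 2 - σ) / 2 : ℝ) + (τ / 2 : ℝ) * Complex.I by
      push_cast; ring]
    ring
  · refine ⟨3 / 4, Or.inr rfl, ?_⟩
    rw [Zfun, if_neg h, mul_div_assoc, norm_mul, norm_mul, norm_mul, norm_mul, norm_tauSum hk θ hθ, e1, e2, e3]
    rw [show (2 - ((σ : ℂ) + τ * Complex.I)) / 2 = (3 / 4 + (1 / 2 - σ) / 2 : ℝ) - (τ / 2 : ℝ) * Complex.I by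
      push_cast; ring, show (1 + ((σ : ℂ) + τ * Complex.I)) / 2 = (3 / 4 - (1 / 2 - σ) / 2 : ℝ) + (τ / 2 : ℝ) * Complex.I by
      push_cast; ring]
    rw [norm_neg, Complex.norm_I]
    ring

lemma Zb1 : ∃ C : ℝ, 1 ≤ C ∧ ∀ (k : ℕ) (θ : DirichletCharacter ℂ k), k ≠ 0 → θ.IsPrimitive →
    ∀ β τ : ℝ, 0 ≤ β → β ≤ 1 / 8 →
    ‖Zfun θ ((1 / 2 - β : ℝ) + τ * Complex.I)‖ ≤ C * ((k : ℝ) * (1 + |τ|)) ^ β := by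
  obtain ⟨C, hC, h⟩ := gammaZ1
  refine ⟨max C 1, le_max_right _ _, fun k θ hk hθ β τ h0 h1 => ?_⟩
  obtain ⟨c, hc, e⟩ := Zfun_norm hk θ hθ (1 / 2 - β) τ
  rw [e, show (1 / 2 : ℝ) - (1 / 2 - β) = β by ring]
  have h2 := h (τ / 2) β c h0 h1 (by rcases hc with hc | hc <;> rw [hc] <;> norm_num) (by rcases hc with hc | hc <;> rw [hc] <;> norm_num)
  have h3 : Real.pi ^ (1 / 2 - β - 1 / 2) ≤ 1 :=
    Real.rpow_le_one_of_one_le_of_nonpos (by linarith [Real.pi_gt_three]) (by linarith)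
  have h4 : (1 + |τ / 2|) ^ β ≤ (1 + |τ|) ^ β := by
    apply Real.rpow_le_rpow (by positivity) _ h0
    rw [abs_div, abs_two]; linarith [abs_nonneg τ]
  rw [Real.mul_rpow (by positivity) (by positivity)]
  calc _ ≤ (k : ℝ) ^ β * 1 * (C * (1 + |τ / 2|) ^ β) := by gcongr
    _ ≤ (k : ℝ) ^ β * 1 * (max C 1 * (1 + |τ|) ^ β) := by gcongr; exact le_max_left _ _
    _ = _ := by ring

lemma Zb2 : ∃ C : ℝ, 1 ≤ C ∧ ∀ (k : ℕ) (θ : DirichletCharacter ℂ k), k ≠ 0 → θ.IsPrimitive →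
    ∀ σ τ : ℝ, -1 / 2 ≤ σ → σ ≤ 5 / 4 → (σ ≤ 7 / 8 ∨ 1 ≤ |τ|) →
    ‖Zfun θ (σ + τ * Complex.I)‖ ≤ C * (k : ℝ) ^ (1 / 2 - σ) * (1 + |τ|) ^ 3 := by
  obtain ⟨C, hC, h⟩ := gammaZ2
  refine ⟨max (4 * C) 1, le_max_right _ _, fun k θ hk hθ σ τ h0 h1 h2 => ?_⟩
  obtain ⟨c, hc, e⟩ := Zfun_norm hk θ hθ σ τ
  rw [e]
  have hab : |τ / 2| = |τ| / 2 := by rw [abs_div, abs_two]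
  have hc1 : 1 / 4 ≤ c := by rcases hc with hc | hc <;> rw [hc] <;> norm_num
  have hc2 : c ≤ 3 / 4 := by rcases hc with hc | hc <;> rw [hc] <;> norm_num
  have h3 := h (τ / 2) (c + (1 / 2 - σ) / 2) (c - (1 / 2 - σ) / 2) (by linarith) (by linarith) (by linarith) (by linarith)
    (by linarith) (by linarith) (by
      rcases h2 with h2 | h2
      · left; linarith
      · right; rw [hab]; linarith)
  have h4 : Real.pi ^ (σ - 1 / 2) ≤ 4 := by
    calc Real.pi ^ (σ - 1 / 2) ≤ Real.pi ^ (1 : ℝ) :=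
          Real.rpow_le_rpow_of_exponent_le (by linarith [Real.pi_gt_three]) (by linarith)
      _ ≤ 4 := by rw [Real.rpow_one]; exact Real.pi_le_four
  have h5 : (1 + |τ / 2|) ^ (3 : ℝ) ≤ (1 + |τ|) ^ 3 := by
    rw [hab, show (3 : ℝ) = ((3 : ℕ) : ℝ) by norm_num, Real.rpow_natCast]
    have := abs_nonneg τ
    gcongr
    linarith
  calc _ ≤ (k : ℝ) ^ (1 / 2 - σ) * 4 * (C * (1 + |τ / 2|) ^ (3 : ℝ)) := by gcongr
    _ ≤ (k : ℝ) ^ (1 / 2 - σ) * 4 * (C * (1 + |τ|) ^ 3) := by gcongr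
    _ = (4 * C) * (k : ℝ) ^ (1 / 2 - σ) * (1 + |τ|) ^ 3 := by ring
    _ ≤ _ := by gcongr; exact le_max_left _ _

lemma Zfun_differentiableAt {k : ℕ} (hk : k ≠ 0) (θ : DirichletCharacter ℂ k) (s : ℂ) (hs : s.re < 1) :
    DifferentiableAt ℂ (Zfun θ) s := by
  have hk0 : (k : ℂ) ≠ 0 := by exact_mod_cast hk
  have hpi : (Real.pi : ℂ) ≠ 0 := by exact_mod_cast Real.pi_ne_zero
  have g : ∀ a : ℂ, 1 ≤ a.re → DifferentiableAt ℂ (fun s : ℂ => Complex.Gamma ((a - s) / 2)) s := by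
    intro a ha
    have : DifferentiableAt ℂ Complex.Gamma ((a - s) / 2) := by
      apply Complex.differentiableAt_Gamma
      intro m hm
      have := congrArg Complex.re hm
      simp at this
      have h2 : (0 : ℝ) ≤ m := by positivity
      linarith
    exact this.comp s (f := fun s : ℂ => (a - s) / 2) (by fun_prop)
  have g2 : ∀ a : ℂ, DifferentiableAt ℂ (fun s : ℂ => (Complex.Gamma ((a + s) / 2))⁻¹) s := by
    intro a
    exact (Complex.differentiable_one_div_Gamma _).comp s (f := fun s : ℂ => (a + s) / 2) (by fun_prop)
  have p1 : DifferentiableAt ℂ (fun s : ℂ => (Real.pi : ℂ) ^ (s - 1 / 2)) s := by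
    apply DifferentiableAt.const_cpow (by fun_prop) (Or.inl hpi)
  have p2 : DifferentiableAt ℂ (fun s : ℂ => (k : ℂ) ^ (-s)) s := by
    apply DifferentiableAt.const_cpow (by fun_prop) (Or.inl hk0)
  by_cases h : θ (-1) = 1
  · have e : Zfun θ = fun s => tauSum θ * (Real.pi : ℂ) ^ (s - 1 / 2) * (k : ℂ) ^ (-s) *
      Complex.Gamma ((1 - s) / 2) * (Complex.Gamma ((0 + s) / 2))⁻¹ := by
      ext s; rw [Zfun, if_pos h, div_eq_mul_inv, zero_add]
    rw [e]
    exact ((((differentiableAt_const _).mul p1).mul p2).mul (g 1 (by simp))).mul (g2 0)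
  · have e : Zfun θ = fun s => -Complex.I * tauSum θ * (Real.pi : ℂ) ^ (s - 1 / 2) * (k : ℂ) ^ (-s) *
      Complex.Gamma ((2 - s) / 2) * (Complex.Gamma ((1 + s) / 2))⁻¹ := by
      ext s; rw [Zfun, if_neg h, div_eq_mul_inv]
    rw [e]
    exact ((((differentiableAt_const _).mul p1).mul p2).mul (g 2 (by simp))).mul (g2 1)

lemma Lfun_eq {N : ℕ} [NeZero N] (χ : DirichletCharacter ℂ N) (s : ℂ) :
    Lfun χ s = DirichletCharacter.LFunction χ s := by
  rw [Lfun, dif_neg (NeZero.ne N)]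

/-- Functional equation, for `Re s < 0`. -/
lemma Lfun_FE {k : ℕ} (hk : 1 < k) (θ : DirichletCharacter ℂ k) (hθ : θ.IsPrimitive) (s : ℂ) (hs : s.re < 1) :
    Lfun θ s = Zfun θ s * Lfun θ⁻¹ (1 - s) := by
  haveI : NeZero k := ⟨by omega⟩
  have hk0 : (k : ℂ) ≠ 0 := by exact_mod_cast (by omega : k ≠ 0)
  have hpi : (Real.pi : ℂ) ≠ 0 := by exact_mod_cast Real.pi_ne_zero
  rw [Lfun_eq, Lfun_eq, θ.LFunction_eq_completed_div_gammaFactor s (Or.inr (by omega)),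
    θ⁻¹.LFunction_eq_completed_div_gammaFactor (1 - s) (Or.inr (by omega))]
  have h := hθ.completedLFunction_one_sub (1 - s)
  rw [sub_sub_cancel] at h
  rw [h, DirichletCharacter.rootNumber, ← tauSum_eq_gaussSum]
  have hp : (k : ℂ) ^ (1 - s - 1 / 2) / (k : ℂ) ^ (1 / 2 : ℂ) = (k : ℂ) ^ (-s) := by
    rw [← Complex.cpow_sub _ _ hk0]; congr 1; ring
  by_cases he : θ.Even
  · have he2 : θ⁻¹.Even := by
      show θ⁻¹ (-1) = 1
      have h1 : θ (-1) = 1 := he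
      rw [MulChar.inv_apply_eq_inv', h1, inv_one]
    have hz : Zfun θ s = tauSum θ * (Real.pi : ℂ) ^ (s - 1 / 2) * (k : ℂ) ^ (-s) *
      Complex.Gamma ((1 - s) / 2) / Complex.Gamma (s / 2) := by
      exact if_pos he
    rw [he.gammaFactor_def, he2.gammaFactor_def, hz, if_pos he, Complex.Gammaℝ_def, Complex.Gammaℝ_def]
    have hG : Complex.Gamma ((1 - s) / 2) ≠ 0 := by
      apply Complex.Gamma_ne_zero_of_re_pos
      simp; linarith
    have e2 : (Real.pi : ℂ) ^ (s - 1 / 2) = (Real.pi : ℂ) ^ (-(1 - s) / 2) / (Real.pi : ℂ) ^ (-s / 2) := by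
      rw [← Complex.cpow_sub _ _ hpi]; congr 1; ring
    rw [← hp, e2]
    have n1 : (Real.pi : ℂ) ^ (-(1 - s) / 2) ≠ 0 := by simp [Complex.cpow_eq_zero_iff, hpi]
    have n2 : (Real.pi : ℂ) ^ (-s / 2) ≠ 0 := by simp [Complex.cpow_eq_zero_iff, hpi]
    rw [div_eq_mul_inv _ (Complex.Gamma (s / 2)), div_eq_mul_inv _ (_ * Complex.Gamma (s / 2)), mul_inv]
    generalize (Complex.Gamma (s / 2))⁻¹ = G
    field_simp
  · have he1 : θ.Odd := θ.even_or_odd.resolve_left he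
    have he2 : θ⁻¹.Odd := by
      show θ⁻¹ (-1) = -1
      have h1 : θ (-1) = -1 := he1
      rw [MulChar.inv_apply_eq_inv', h1]; norm_num
    have hz : Zfun θ s = -Complex.I * tauSum θ * (Real.pi : ℂ) ^ (s - 1 / 2) * (k : ℂ) ^ (-s) *
      Complex.Gamma ((2 - s) / 2) / Complex.Gamma ((1 + s) / 2) := by
      exact if_neg he
    rw [he1.gammaFactor_def, he2.gammaFactor_def, hz, if_neg he, Complex.Gammaℝ_def, Complex.Gammaℝ_def]
    rw [show (1 - s + 1) / 2 = (2 - s) / 2 by ring, show (s + 1) / 2 = (1 + s) / 2 by ring]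
    have hG : Complex.Gamma ((2 - s) / 2) ≠ 0 := by
      apply Complex.Gamma_ne_zero_of_re_pos
      simp; linarith
    have e2 : (Real.pi : ℂ) ^ (s - 1 / 2) = (Real.pi : ℂ) ^ (-(1 - s + 1) / 2) / (Real.pi : ℂ) ^ (-(s + 1) / 2) := by
      rw [← Complex.cpow_sub _ _ hpi]; congr 1; ring
    rw [← hp, e2]
    have n1 : (Real.pi : ℂ) ^ (-(1 - s + 1) / 2) ≠ 0 := by simp [Complex.cpow_eq_zero_iff, hpi]
    have n2 : (Real.pi : ℂ) ^ (-(s + 1) / 2) ≠ 0 := by simp [Complex.cpow_eq_zero_iff, hpi]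
    rw [div_eq_mul_inv _ (Complex.Gamma ((1 + s) / 2)), div_eq_mul_inv _ (_ * Complex.Gamma ((1 + s) / 2)), mul_inv]
    generalize (Complex.Gamma ((1 + s) / 2))⁻¹ = G
    rw [pow_one, Complex.div_I]
    field_simp
    try ring

lemma chiPsi_apply (D : ℕ) (χ : DirichletCharacter ℂ D) {p : ℕ} (ψ : DirichletCharacter ℂ p) (n : ℕ) :
    chiPsi D χ ψ (n : ZMod (D * p)) = χ (n : ZMod D) * ψ (n : ZMod p) := by
  by_cases h : Nat.Coprime n (D * p)
  · have h1 : IsCoprime (n : ℤ) ((D * p : ℕ) : ℤ) := Nat.isCoprime_iff_coprime.mpr h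
    have e1 := DirichletCharacter.changeLevel_eq_cast_of_dvd' χ (dvd_mul_right D p) h1
    have e2 := DirichletCharacter.changeLevel_eq_cast_of_dvd' ψ (dvd_mul_left p D) h1
    simp only [Int.cast_natCast] at e1 e2
    rw [chiPsi, MulChar.mul_apply, e1, e2]
  · have z : ∀ {m : ℕ} (θ : DirichletCharacter ℂ m), ¬ Nat.Coprime n m → θ (n : ZMod m) = 0 := by
      intro m θ hm
      apply MulChar.map_nonunit
      rwa [ZMod.isUnit_iff_coprime]
    rw [z _ h]
    rw [Nat.coprime_mul_iff_right, not_and_or] at h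
    rcases h with h | h
    · rw [z χ h, zero_mul]
    · rw [z ψ h, mul_zero]

lemma chiPsi_isPrimitive (D : ℕ) (χ : DirichletCharacter ℂ D) {p : ℕ} (ψ : DirichletCharacter ℂ p)
    (hD : D ≠ 0) (hp : p ≠ 0) (hc : Nat.Coprime D p) (hχ : χ.IsPrimitive) (hψ : ψ.IsPrimitive) :
    (chiPsi D χ ψ).IsPrimitive := by
  have : NeZero (D * p) := ⟨mul_ne_zero hD hp⟩
  set θ := chiPsi D χ ψ with hθ
  have e1 : DirichletCharacter.changeLevel (dvd_mul_right D p) χ =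
    θ * (DirichletCharacter.changeLevel (dvd_mul_left p D) ψ)⁻¹ := by
    rw [hθ, chiPsi, mul_inv_cancel_right]
  have e2 : DirichletCharacter.changeLevel (dvd_mul_left p D) ψ =
    θ * (DirichletCharacter.changeLevel (dvd_mul_right D p) χ)⁻¹ := by
    rw [hθ, chiPsi, eq_mul_inv_iff_mul_eq, mul_comm (DirichletCharacter.changeLevel (dvd_mul_left p D) ψ)]
  have c1 := DirichletCharacter.conductor_changeLevel χ (dvd_mul_right D p)
  have c2 := DirichletCharacter.conductor_changeLevel ψ (dvd_mul_left p D)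
  rw [(DirichletCharacter.isPrimitive_def _).mp hχ] at c1
  rw [(DirichletCharacter.isPrimitive_def _).mp hψ] at c2
  have d1 := DirichletCharacter.conductor_mul_dvd_lcm_conductor θ (DirichletCharacter.changeLevel (dvd_mul_left p D) ψ)⁻¹
  have d2 := DirichletCharacter.conductor_mul_dvd_lcm_conductor θ (DirichletCharacter.changeLevel (dvd_mul_right D p) χ)⁻¹
  rw [← e1, c1, DirichletCharacter.conductor_inv, c2] at d1
  rw [← e2, c2, DirichletCharacter.conductor_inv, c1] at d2
  have f1 : D ∣ θ.conductor := hc.dvd_of_dvd_mul_right (d1.trans (Nat.lcm_dvd_mul _ _))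
  have f2 : p ∣ θ.conductor := hc.symm.dvd_of_dvd_mul_right (d2.trans (Nat.lcm_dvd_mul _ _))
  rw [DirichletCharacter.isPrimitive_def]
  exact Nat.dvd_antisymm θ.conductor_dvd_level (hc.mul_dvd_of_dvd_of_dvd f1 f2)

lemma inv_isPrimitive {p : ℕ} (ψ : DirichletCharacter ℂ p) (hψ : ψ.IsPrimitive) : ψ⁻¹.IsPrimitive := by
  rw [DirichletCharacter.isPrimitive_def, DirichletCharacter.conductor_inv]
  exact hψ

lemma realChar_inv {D : ℕ} (χ : DirichletCharacter ℂ D) (h : IsRealChar χ) : χ⁻¹ = χ := by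
  ext a
  rw [← MulChar.star_apply']
  exact Complex.conj_eq_iff_im.mpr (h _)

lemma chiPsi_inv (D : ℕ) (χ : DirichletCharacter ℂ D) {p : ℕ} (ψ : DirichletCharacter ℂ p)
    (h : IsRealChar χ) : (chiPsi D χ ψ)⁻¹ = chiPsi D χ ψ⁻¹ := by
  rw [chiPsi, mul_inv, ← map_inv, ← map_inv, realChar_inv χ h, chiPsi]

lemma nuF_conj (D : ℕ) (χ : DirichletCharacter ℂ D) (h : IsRealChar χ) (n : ℕ) :
    (starRingEnd ℂ) (nuF D χ n) = nuF D χ n := by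
  rw [nuF, map_sum]
  refine Finset.sum_congr rfl fun d _ => ?_
  exact Complex.conj_eq_iff_im.mpr (h _)

lemma nuF_norm (D : ℕ) (χ : DirichletCharacter ℂ D) (n : ℕ) : ‖nuF D χ n‖ ≤ (n.divisors.card : ℝ) := by
  rw [nuF]
  refine (norm_sum_le _ _).trans ?_
  refine (Finset.sum_le_sum (fun d _ => DirichletCharacter.norm_le_one χ _)).trans ?_
  simp

/-- The product of L-functions. -/
def Aprod (D : ℕ) (χ : DirichletCharacter ℂ D) {p : ℕ} (ψ : DirichletCharacter ℂ p) (s : ℂ) : ℂ :=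
  Lfun ψ s * Lfun (chiPsi D χ ψ) s

lemma term_eq (f : ℕ → ℂ) (hf : f 0 = 0) (s : ℂ) (n : ℕ) : LSeries.term f s n = f n * (n : ℂ) ^ (-s) := by
  rcases eq_or_ne n 0 with rfl | hn
  · simp [hf]
  · rw [LSeries.term_of_ne_zero hn, Complex.cpow_neg, div_eq_mul_inv]

lemma Aprod_hasSum (D : ℕ) (χ : DirichletCharacter ℂ D) {p : ℕ} (ψ : DirichletCharacter ℂ p)
    (hD : D ≠ 0) (hp : p ≠ 0) (s : ℂ) (hs : 1 < s.re) :
    HasSum (fun n : ℕ => nuF D χ n * ψ (n : ZMod p) * (n : ℂ) ^ (-s)) (Aprod D χ ψ s) := by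
  have : NeZero p := ⟨hp⟩
  have : NeZero (D * p) := ⟨mul_ne_zero hD hp⟩
  have h1 := (DirichletCharacter.LSeriesSummable_of_one_lt_re ψ hs).LSeriesHasSum
  have h2 := (DirichletCharacter.LSeriesSummable_of_one_lt_re (chiPsi D χ ψ) hs).LSeriesHasSum
  rw [← DirichletCharacter.LFunction_eq_LSeries _ hs] at h1 h2
  have h3 := h1.convolution h2
  rw [Aprod, Lfun_eq, Lfun_eq]
  unfold LSeriesHasSum at h3
  convert! h3 using 2 with n
  rw [term_eq _ (LSeries.convolution_map_zero _ _), LSeries.convolution_def]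
  congr 1
  rw [nuF, Finset.sum_mul]
  show _ = ∑ q ∈ n.divisorsAntidiagonal, _
  rw [← Nat.map_div_left_divisors, Finset.sum_map]
  refine Finset.sum_congr rfl fun d hd => ?_
  have hdn := Nat.dvd_of_mem_divisors hd
  show χ (d : ZMod D) * ψ (n : ZMod p) = ψ ((n / d : ℕ) : ZMod p) * chiPsi D χ ψ ((d : ℕ) : ZMod (D * p))
  rw [chiPsi_apply]
  have : (n : ZMod p) = ((n / d : ℕ) : ZMod p) * ((d : ℕ) : ZMod p) := by
    rw [← Nat.cast_mul, Nat.div_mul_cancel hdn]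
  rw [this, map_mul]
  ring

lemma div_summable (x : ℝ) (hx : 1 < x) :
    Summable (fun n : ℕ => (n.divisors.card : ℝ) * (n : ℝ) ^ (-x)) := by
  have h1 := (LSeriesSummable_one_iff (s := (x : ℂ))).mpr (by simpa using hx)
  have h2 := (h1.convolution h1)
  unfold LSeriesSummable at h2
  refine (h2.norm).congr fun n => ?_
  rw [term_eq _ (LSeries.convolution_map_zero _ _), LSeries.convolution_def]
  rcases eq_or_ne n 0 with rfl | hn
  · simp
  · rw [norm_mul, ← Complex.ofReal_natCast, Complex.norm_cpow_eq_rpow_re_of_pos (by positivity)]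
    have hcard : n.divisorsAntidiagonal.card = n.divisors.card := by
      rw [← Nat.map_div_left_divisors, Finset.card_map]
    simp only [hcard, Pi.one_apply, mul_one, Finset.sum_const, nsmul_eq_mul, Complex.norm_natCast]
    simp

/-- Middle part of the Dirichlet series. -/
def Mfun (D : ℕ) (χ : DirichletCharacter ℂ D) {p : ℕ} (ψ : DirichletCharacter ℂ p) (s : ℂ) : ℂ :=
  ∑ n ∈ Finset.Ioc (D ^ 4) ⌊bigP D ^ 2⌋₊, nuF D χ n * ψ (n : ZMod p) * (n : ℂ) ^ (-s)

/-- Tail of the Dirichlet series. -/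
def Tfun (D : ℕ) (χ : DirichletCharacter ℂ D) {p : ℕ} (ψ : DirichletCharacter ℂ p) (s : ℂ) : ℂ :=
  Aprod D χ ψ s - Ffun D χ ψ s - Mfun D χ ψ s

/-- The constant for the tail. -/
def Stail : ℝ := ∑' n : ℕ, (n.divisors.card : ℝ) * (n : ℝ) ^ (-(11 / 8) : ℝ)

lemma Stail_nonneg : 0 ≤ Stail := tsum_nonneg fun n => by positivity

lemma coef_norm (D : ℕ) (χ : DirichletCharacter ℂ D) {p : ℕ} (ψ : DirichletCharacter ℂ p) (n : ℕ) :
    ‖nuF D χ n * ψ (n : ZMod p)‖ ≤ (n.divisors.card : ℝ) := by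
  rw [norm_mul]
  calc _ ≤ (n.divisors.card : ℝ) * 1 := by
        gcongr
        · exact nuF_norm D χ n
        · exact DirichletCharacter.norm_le_one ψ _
    _ = _ := mul_one _

lemma norm_npow (n : ℕ) (hn : n ≠ 0) (s : ℂ) : ‖(n : ℂ) ^ (-s)‖ = (n : ℝ) ^ (-s.re) := by
  rw [← Complex.ofReal_natCast, Complex.norm_cpow_eq_rpow_re_of_pos (by positivity)]; simp

lemma Tfun_bound (D : ℕ) (χ : DirichletCharacter ℂ D) {p : ℕ} (ψ : DirichletCharacter ℂ p)
    (hD : D ≠ 0) (hp : p ≠ 0) (hDP : D ^ 4 ≤ ⌊bigP D ^ 2⌋₊) (s : ℂ) (hs : 11 / 8 ≤ s.re) :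
    ‖Tfun D χ ψ s‖ ≤ Stail * (bigP D ^ 2) ^ (-(s.re - 11 / 8)) := by
  set N := ⌊bigP D ^ 2⌋₊ with hN
  have hP : 0 < bigP D := Real.exp_pos _
  set f : ℕ → ℂ := fun n : ℕ => nuF D χ n * ψ (n : ZMod p) * (n : ℂ) ^ (-s) with hf
  have h1 : HasSum f (Aprod D χ ψ s) := Aprod_hasSum D χ ψ hD hp s (by linarith)
  set g : ℕ → ℂ := fun n => if n ∈ Finset.Icc 1 N then f n else 0 with hg
  have h2 : HasSum g (∑ n ∈ Finset.Icc 1 N, g n) :=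
    hasSum_sum_of_ne_finset_zero fun n hn => if_neg hn
  have h3 : ∑ n ∈ Finset.Icc 1 N, g n = Ffun D χ ψ s + Mfun D χ ψ s := by
    rw [Ffun, Mfun, ← Finset.sum_union]
    · have : Finset.Icc 1 (D ^ 4) ∪ Finset.Ioc (D ^ 4) N = Finset.Icc 1 N := by
        ext n
        simp only [Finset.mem_union, Finset.mem_Icc, Finset.mem_Ioc]
        omega
      rw [this]
      exact Finset.sum_congr rfl fun n hn => if_pos hn
    · rw [Finset.disjoint_left]
      intro n hn
      simp only [Finset.mem_Icc, Finset.mem_Ioc] at *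
      omega
  have h4 := h1.sub h2
  rw [h3, ← sub_sub] at h4
  have h5 : HasSum (fun n : ℕ => (n.divisors.card : ℝ) * (n : ℝ) ^ (-(11 / 8) : ℝ) * (bigP D ^ 2) ^ (-(s.re - 11 / 8)))
    (Stail * (bigP D ^ 2) ^ (-(s.re - 11 / 8))) := ((div_summable (11 / 8) (by norm_num)).hasSum).mul_right _
  rw [Tfun, ← h4.tsum_eq]
  refine tsum_of_norm_bounded h5 fun n => ?_
  by_cases hn : n ∈ Finset.Icc 1 N
  · rw [hg]; simp only [if_pos hn, sub_self, norm_zero]; positivity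
  · rw [hg]; simp only [if_neg hn, sub_zero]
    rcases eq_or_ne n 0 with rfl | h0
    · simp [hf, nuF]
    · have h6 : N < n := by
        simp only [Finset.mem_Icc, not_and, not_le] at hn
        exact hn (by omega)
      have h7 : bigP D ^ 2 < n := (Nat.floor_lt (by positivity)).mp h6
      rw [hf]; simp only
      rw [norm_mul, norm_npow n h0, mul_assoc]
      gcongr
      · exact coef_norm D χ ψ n
      · have hn0 : (0 : ℝ) < n := by positivity
        rw [show -s.re = -(11 / 8) + -(s.re - 11 / 8) by ring, Real.rpow_add hn0]
        gcongr ?_ * ?_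
        exact Real.rpow_le_rpow_of_nonpos (by positivity) h7.le (by linarith)

lemma fin_bound (D : ℕ) (χ : DirichletCharacter ℂ D) {p : ℕ} (ψ : DirichletCharacter ℂ p) (N : ℕ)
    (S : Finset ℕ) (hS : S ⊆ Finset.Icc 1 N) (s : ℂ) (hs : -1 ≤ s.re) :
    ‖∑ n ∈ S, nuF D χ n * ψ (n : ZMod p) * (n : ℂ) ^ (-s)‖ ≤ (N : ℝ) ^ 3 := by
  refine (norm_sum_le _ _).trans ?_
  have : ∀ n ∈ S, ‖nuF D χ n * ψ (n : ZMod p) * (n : ℂ) ^ (-s)‖ ≤ (N : ℝ) ^ 2 := by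
    intro n hn
    have h1 := Finset.mem_Icc.mp (hS hn)
    have hnN : (n : ℝ) ≤ N := by exact_mod_cast h1.2
    have hn1 : (1 : ℝ) ≤ n := by exact_mod_cast h1.1
    rw [norm_mul, norm_npow n (by omega)]
    have h2 : (n : ℝ) ^ (-s.re) ≤ n := by
      calc (n : ℝ) ^ (-s.re) ≤ (n : ℝ) ^ (1 : ℝ) := Real.rpow_le_rpow_of_exponent_le hn1 (by linarith)
        _ = n := Real.rpow_one _
    have h3 : (n.divisors.card : ℝ) ≤ n := by exact_mod_cast Nat.card_divisors_le_self n
    calc _ ≤ (n : ℝ) * n := by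
          gcongr
          exact (coef_norm D χ ψ n).trans h3
      _ ≤ (N : ℝ) ^ 2 := by rw [sq]; gcongr
  refine (Finset.sum_le_sum this).trans ?_
  rw [Finset.sum_const, nsmul_eq_mul, show (N : ℝ) ^ 3 = N * N ^ 2 by ring]
  gcongr
  exact_mod_cast (Finset.card_le_card hS).trans (by simp)

lemma Ffun_bound (D : ℕ) (χ : DirichletCharacter ℂ D) {p : ℕ} (ψ : DirichletCharacter ℂ p) (s : ℂ)
    (hs : -1 ≤ s.re) : ‖Ffun D χ ψ s‖ ≤ (D : ℝ) ^ 12 := by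
  refine (fin_bound D χ ψ (D ^ 4) _ subset_rfl s hs).trans ?_
  push_cast
  rw [← pow_mul]

lemma Mfun_bound0 (D : ℕ) (χ : DirichletCharacter ℂ D) {p : ℕ} (ψ : DirichletCharacter ℂ p) (s : ℂ)
    (hs : -1 ≤ s.re) : ‖Mfun D χ ψ s‖ ≤ (⌊bigP D ^ 2⌋₊ : ℝ) ^ 3 := by
  refine fin_bound D χ ψ _ _ ?_ s hs
  intro n hn
  simp only [Finset.mem_Icc, Finset.mem_Ioc] at *
  omega

lemma fin_differentiable (f : ℕ → ℂ) (S : Finset ℕ) (hS : ∀ n ∈ S, n ≠ 0) :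
    Differentiable ℂ fun s : ℂ => ∑ n ∈ S, f n * (n : ℂ) ^ (-s) := by
  intro s
  apply DifferentiableAt.fun_sum
  intro n hn
  apply (differentiableAt_const _).mul
  apply DifferentiableAt.const_cpow (by fun_prop)
  left
  exact_mod_cast hS n hn

lemma Ffun_differentiable (D : ℕ) (χ : DirichletCharacter ℂ D) {p : ℕ} (ψ : DirichletCharacter ℂ p) :
    Differentiable ℂ (Ffun D χ ψ) :=
  fin_differentiable (fun n => nuF D χ n * ψ (n : ZMod p)) (Finset.Icc 1 (D ^ 4)) (by
    intro n hn; rw [Finset.mem_Icc] at hn; omega)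

lemma Mfun_differentiable (D : ℕ) (χ : DirichletCharacter ℂ D) {p : ℕ} (ψ : DirichletCharacter ℂ p) :
    Differentiable ℂ (Mfun D χ ψ) :=
  fin_differentiable (fun n => nuF D χ n * ψ (n : ZMod p)) (Finset.Ioc (D ^ 4) ⌊bigP D ^ 2⌋₊) (by
    intro n hn; rw [Finset.mem_Ioc] at hn; omega)

lemma primitive_ne_one {k : ℕ} (hk : 1 < k) (θ : DirichletCharacter ℂ k) (hθ : θ.IsPrimitive) : θ ≠ 1 := by
  have : NeZero k := ⟨by omega⟩
  rintro rfl
  rw [DirichletCharacter.isPrimitive_def, DirichletCharacter.conductor_one] at hθ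
  omega

lemma Lfun_differentiable {k : ℕ} (hk : 1 < k) (θ : DirichletCharacter ℂ k) (hθ : θ.IsPrimitive) :
    Differentiable ℂ (Lfun θ) := by
  have : NeZero k := ⟨by omega⟩
  have e : Lfun θ = DirichletCharacter.LFunction θ := by ext s; exact Lfun_eq θ s
  rw [e]
  exact DirichletCharacter.differentiable_LFunction (primitive_ne_one hk θ hθ)

lemma Aprod_FE (D : ℕ) (χ : DirichletCharacter ℂ D) {p : ℕ} (ψ : DirichletCharacter ℂ p)
    (hD : 1 < D) (hp : 1 < p) (hc : Nat.Coprime D p) (hχ : χ.IsPrimitive) (hψ : ψ.IsPrimitive)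
    (hr : IsRealChar χ) (s : ℂ) (hs : s.re < 1) :
    Aprod D χ ψ s = Ztilde D χ ψ s * Aprod D χ ψ⁻¹ (1 - s) := by
  have h1 := Lfun_FE hp ψ hψ s hs
  have h2 := Lfun_FE (Nat.lt_of_lt_of_le hp (Nat.le_mul_of_pos_left p (by omega))) (chiPsi D χ ψ)
    (chiPsi_isPrimitive D χ ψ (by omega) (by omega) hc hχ hψ) s hs
  rw [chiPsi_inv D χ ψ hr] at h2
  rw [Aprod, Aprod, Ztilde, h1, h2]
  ring

lemma FfunBar_eq (D : ℕ) (χ : DirichletCharacter ℂ D) {p : ℕ} (ψ : DirichletCharacter ℂ p) (s : ℂ) :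
    FfunBar D χ ψ s = Ffun D χ ψ⁻¹ (1 - s) := by
  rw [FfunBar, Ffun]
  refine Finset.sum_congr rfl fun n _ => ?_
  rw [neg_sub, ← MulChar.star_apply']
  rfl

lemma Mfun_conj (D : ℕ) (χ : DirichletCharacter ℂ D) {p : ℕ} (ψ : DirichletCharacter ℂ p) (hr : IsRealChar χ) (s : ℂ) :
    Mfun D χ ψ⁻¹ s = (starRingEnd ℂ) (Mfun D χ ψ ((starRingEnd ℂ) s)) := by
  rw [Mfun, Mfun, map_sum]
  refine Finset.sum_congr rfl fun n _ => ?_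
  rw [map_mul, map_mul, nuF_conj D χ hr, ← MulChar.star_apply']
  congr 1
  have := Complex.cpow_conj (n : ℂ) (-s) (by rw [Complex.natCast_arg]; exact Real.pi_ne_zero.symm)
  rw [Complex.conj_natCast, map_neg] at this
  rw [this, Complex.conj_conj]

open MeasureTheory Filter Topology Complex in
lemma strip_shift (h : ℂ → ℂ) (a b M : ℝ) (hab : a ≤ b)
    (hd : DifferentiableOn ℂ h {w | a ≤ w.re ∧ w.re ≤ b})
    (hb : ∀ w : ℂ, a ≤ w.re → w.re ≤ b → ‖h w‖ ≤ M * Real.exp (-(1 / 2) * w.im ^ 2)) :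
    Integrable (fun v : ℝ => h (a + v * I)) ∧ Integrable (fun v : ℝ => h (b + v * I)) ∧
    ∫ v : ℝ, h (a + v * I) = ∫ v : ℝ, h (b + v * I) := by
  have hG : Integrable (fun v : ℝ => M * Real.exp (-(1 / 2) * v ^ 2)) :=
    (integrable_exp_neg_mul_sq (by norm_num : (0 : ℝ) < 1 / 2)).const_mul M
  have hline : ∀ c : ℝ, a ≤ c → c ≤ b → Integrable (fun v : ℝ => h (c + v * I)) := by
    intro c h1 h2
    refine hG.mono' ?_ ?_
    · apply Continuous.aestronglyMeasurable
      have : Continuous (fun v : ℝ => (c : ℂ) + v * I) := by fun_prop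
      refine hd.continuousOn.comp_continuous this fun v => ?_
      simp [h1, h2]
    · refine Eventually.of_forall fun v => ?_
      have := hb (c + v * I) (by simpa using h1) (by simpa using h2)
      simpa using this
  have ia := hline a le_rfl hab
  have ib := hline b hab le_rfl
  refine ⟨ia, ib, ?_⟩
  have rect : ∀ T : ℝ, (∫ x : ℝ in a..b, h (x + (-T : ℝ) * I)) - (∫ x : ℝ in a..b, h (x + (T : ℝ) * I)) +
      I • (∫ y : ℝ in (-T)..T, h (b + y * I)) - I • (∫ y : ℝ in (-T)..T, h (a + y * I)) = 0 := by
    intro T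
    have := integral_boundary_rect_eq_zero_of_differentiableOn h (a + (-T : ℝ) * I) (b + T * I) (hd.mono ?_)
    · simpa using this
    · rintro w ⟨hw1, -⟩
      simp only [add_re, ofReal_re, mul_re, I_re, mul_zero, ofReal_im, I_im, mul_one, sub_self, add_zero, Set.mem_preimage] at hw1
      rw [Set.uIcc_of_le hab] at hw1
      exact hw1
  have horiz : ∀ e : ℝ, (e = 1 ∨ e = -1) → Tendsto (fun T : ℝ => ∫ x : ℝ in a..b, h (x + (e * T : ℝ) * I)) atTop (𝓝 0) := by
    intro e he
    have he2 : e ^ 2 = 1 := by rcases he with he | he <;> rw [he] <;> norm_num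
    have lim : Tendsto (fun T : ℝ => M * Real.exp (-(1 / 2) * T ^ 2) * |b - a|) atTop (𝓝 0) := by
      have : Tendsto (fun T : ℝ => Real.exp (-(1 / 2) * T ^ 2)) atTop (𝓝 0) := by
        apply Real.tendsto_exp_atBot.comp
        apply Tendsto.const_mul_atTop_of_neg (by norm_num)
        exact tendsto_pow_atTop (by norm_num)
      simpa using (this.const_mul M).mul_const (|b - a|)
    refine squeeze_zero_norm (fun T => ?_) lim
    refine intervalIntegral.norm_integral_le_of_norm_le_const fun x hx => ?_
    rw [Set.uIoc_of_le hab] at hx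
    have := hb (x + (e * T : ℝ) * I) (by simpa using hx.1.le) (by simpa using hx.2)
    simp only [add_im, ofReal_im, mul_im, ofReal_re, I_im, mul_one, I_re, mul_zero, add_zero, zero_add] at this
    rwa [mul_pow, he2, one_mul] at this
  have va := intervalIntegral_tendsto_integral ia tendsto_neg_atTop_atBot tendsto_id
  have vb := intervalIntegral_tendsto_integral ib tendsto_neg_atTop_atBot tendsto_id
  have h1 := horiz 1 (Or.inl rfl)
  have h2 := horiz (-1) (Or.inr rfl)
  have lim := ((h2.sub h1).add (vb.const_smul I)).sub (va.const_smul I)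
  have hz : ∀ T : ℝ, (∫ x : ℝ in a..b, h (x + ((-1) * T : ℝ) * I)) - (∫ x : ℝ in a..b, h (x + (1 * T : ℝ) * I)) +
      I • (∫ y : ℝ in (-T)..(id T), h (b + y * I)) - I • (∫ y : ℝ in (-T)..(id T), h (a + y * I)) = 0 := by
    intro T
    have := rect T
    simpa using this
  have lim2 := lim.congr hz
  have := tendsto_nhds_unique lim2 tendsto_const_nhds
  simp only [sub_zero, zero_add, smul_eq_mul] at this
  rw [← mul_sub] at this
  have h3 := (mul_eq_zero.mp this).resolve_left I_ne_zero
  exact (sub_eq_zero.mp h3).symm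

/-- The smoothing kernel. -/
def kern (w : ℂ) : ℂ := Complex.exp (w ^ 2) / w

/-- Vertical line integrals. -/
def Jint (g : ℂ → ℂ) (c : ℝ) : ℂ := ∫ v : ℝ, g (c + v * Complex.I) * kern (c + v * Complex.I)

lemma norm_exp_sq (w : ℂ) : ‖Complex.exp (w ^ 2)‖ = Real.exp (w.re ^ 2) * Real.exp (-w.im ^ 2) := by
  rw [Complex.norm_exp, ← Real.exp_add, sq w]
  congr 1
  simp; ring

lemma exp_absorb (k v : ℝ) : Real.exp (k * |v|) * Real.exp (-v ^ 2) ≤ Real.exp (k ^ 2 / 2) * Real.exp (-(1 / 2) * v ^ 2) := by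
  rw [← Real.exp_add, ← Real.exp_add]
  apply Real.exp_le_exp.mpr
  have : |v| ^ 2 = v ^ 2 := sq_abs v
  nlinarith [sq_nonneg (k - |v|)]

lemma norm_g_exp (g : ℂ → ℂ) (a b M k : ℝ) (hM : 0 ≤ M)
    (hb : ∀ w : ℂ, a ≤ w.re → w.re ≤ b → ‖g w‖ ≤ M * Real.exp (k * |w.im|)) :
    ∀ w : ℂ, a ≤ w.re → w.re ≤ b → ‖g w * Complex.exp (w ^ 2)‖ ≤
      (M * Real.exp (a ^ 2 + b ^ 2) * Real.exp (k ^ 2 / 2)) * Real.exp (-(1 / 2) * w.im ^ 2) := by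
  intro w h1 h2
  rw [norm_mul, norm_exp_sq]
  have h3 : Real.exp (w.re ^ 2) ≤ Real.exp (a ^ 2 + b ^ 2) := by
    apply Real.exp_le_exp.mpr
    rcases le_total 0 w.re with h | h
    · nlinarith [sq_nonneg a]
    · nlinarith [sq_nonneg b]
  calc _ ≤ (M * Real.exp (k * |w.im|)) * (Real.exp (a ^ 2 + b ^ 2) * Real.exp (-w.im ^ 2)) := by
        gcongr; exact hb w h1 h2
    _ = M * Real.exp (a ^ 2 + b ^ 2) * (Real.exp (k * |w.im|) * Real.exp (-w.im ^ 2)) := by ring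
    _ ≤ M * Real.exp (a ^ 2 + b ^ 2) * (Real.exp (k ^ 2 / 2) * Real.exp (-(1 / 2) * w.im ^ 2)) := by
        exact mul_le_mul_of_nonneg_left (exp_absorb _ _) (by positivity)
    _ = _ := by ring

open MeasureTheory in
lemma J_shift0 (g : ℂ → ℂ) (a b M k : ℝ) (hab : a ≤ b) (h0 : 0 < a ∨ b < 0)
    (hd : DifferentiableOn ℂ g {w | a ≤ w.re ∧ w.re ≤ b})
    (hb : ∀ w : ℂ, a ≤ w.re → w.re ≤ b → ‖g w‖ ≤ M * Real.exp (k * |w.im|)) :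
    Integrable (fun v : ℝ => g (a + v * Complex.I) * kern (a + v * Complex.I)) ∧
    Integrable (fun v : ℝ => g (b + v * Complex.I) * kern (b + v * Complex.I)) ∧ Jint g a = Jint g b := by
  have hM : 0 ≤ M := by
    have h1 := hb a (by simp) (by simpa using hab)
    simp at h1
    exact (norm_nonneg _).trans h1
  obtain ⟨r, hr, hr2⟩ : ∃ r : ℝ, 0 < r ∧ ∀ w : ℂ, a ≤ w.re → w.re ≤ b → r ≤ ‖w‖ := by
    rcases h0 with h0 | h0
    · exact ⟨a, h0, fun w h1 _ => (h1.trans (le_abs_self _)).trans (Complex.abs_re_le_norm w)⟩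
    · exact ⟨-b, by linarith, fun w _ h2 => ((neg_le_neg h2).trans (neg_le_abs _)).trans (Complex.abs_re_le_norm w)⟩
  refine strip_shift (fun w => g w * kern w) a b ((M * Real.exp (a ^ 2 + b ^ 2) * Real.exp (k ^ 2 / 2)) / r) hab ?_ ?_
  · apply hd.mul
    unfold kern
    apply DifferentiableOn.div (by fun_prop) (by fun_prop)
    rintro w ⟨h1, h2⟩ rfl
    have := hr2 0 h1 h2
    simp at this
    linarith
  · intro w h1 h2
    have h3 := norm_g_exp g a b M k hM hb w h1 h2
    rw [kern, ← mul_div_assoc, norm_div, div_mul_eq_mul_div]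
    gcongr
    exact hr2 w h1 h2

open MeasureTheory Filter Topology in
lemma Jint_one (c : ℝ) (hc : 0 < c) : Jint (fun _ => 1) c = Real.pi := by
  have key : ∀ c' : ℝ, 0 < c' → Jint (fun _ => 1) c' = Jint (fun _ => 1) c := by
    intro c' hc'
    have : ∀ a b : ℝ, 0 < a → a ≤ b → Jint (fun _ => 1) a = Jint (fun _ => 1) b := fun a b ha hab =>
      (J_shift0 (fun _ => 1) a b 1 0 hab (Or.inl ha) (by fun_prop) (by simp)).2.2
    rcases le_total c' c with h | h
    · exact this c' c hc' h
    · exact (this c c' hc h).symm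
  have int1 : ∀ c' : ℝ, 0 < c' → Integrable (fun v : ℝ => kern (c' + v * Complex.I)) := fun c' hc' => by
    simpa using (J_shift0 (fun _ => 1) c' c' 1 0 le_rfl (Or.inl hc') (by fun_prop) (by simp)).1
  set Φ : ℝ → ℝ → ℝ := fun c u => Real.exp (c ^ 2 * (1 - u ^ 2)) *
      (2 * Real.cos (2 * c ^ 2 * u) + 2 * u * Real.sin (2 * c ^ 2 * u)) * (1 + u ^ 2)⁻¹ with hΦ
  have hsum : ∀ c' : ℝ, 0 < c' → ∀ u : ℝ, (c' : ℂ) * (kern (c' + (c' * u : ℝ) * Complex.I) + kern (c' + (c' * -u : ℝ) * Complex.I)) = (Φ c' u : ℂ) := by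
    intro c' hc' u
    have hc0 : (c' : ℂ) ≠ 0 := by exact_mod_cast hc'.ne'
    have n1 : (1 : ℂ) + u * Complex.I ≠ 0 := by
      intro h; have := congrArg Complex.re h; simp at this
    have n2 : (1 : ℂ) - u * Complex.I ≠ 0 := by
      intro h; have := congrArg Complex.re h; simp at this
    have n3 : (1 : ℂ) + u ^ 2 ≠ 0 := by
      have : (0 : ℝ) < 1 + u ^ 2 := by positivity
      exact_mod_cast this.ne'
    have q : ((1 : ℂ) + u * Complex.I) * (1 - u * Complex.I) = 1 + u ^ 2 := by
      ring_nf; rw [Complex.I_sq]; ring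
    have e1 : kern (c' + (c' * u : ℝ) * Complex.I) = Complex.exp ((c' ^ 2 * (1 - u ^ 2) : ℝ)) * Complex.exp ((2 * c' ^ 2 * u : ℝ) * Complex.I) * (1 - u * Complex.I) / (c' * (1 + u ^ 2)) := by
      rw [kern, ← Complex.exp_add, ← q]
      rw [show (c' : ℂ) + (c' * u : ℝ) * Complex.I = c' * (1 + u * Complex.I) by push_cast; ring]
      rw [show ((c' ^ 2 * (1 - u ^ 2) : ℝ) : ℂ) + (2 * c' ^ 2 * u : ℝ) * Complex.I = (c' * (1 + u * Complex.I)) ^ 2 by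
        push_cast; ring_nf; rw [Complex.I_sq]; ring]
      field_simp
    have e2 : kern (c' + (c' * -u : ℝ) * Complex.I) = Complex.exp ((c' ^ 2 * (1 - u ^ 2) : ℝ)) * Complex.exp (-(2 * c' ^ 2 * u : ℝ) * Complex.I) * (1 + u * Complex.I) / (c' * (1 + u ^ 2)) := by
      rw [kern, ← Complex.exp_add, ← q]
      rw [show (c' : ℂ) + (c' * -u : ℝ) * Complex.I = c' * (1 - u * Complex.I) by push_cast; ring]
      rw [show ((c' ^ 2 * (1 - u ^ 2) : ℝ) : ℂ) + -(2 * c' ^ 2 * u : ℝ) * Complex.I = (c' * (1 - u * Complex.I)) ^ 2 by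
        push_cast; ring_nf; rw [Complex.I_sq]; ring]
      field_simp
    rw [e1, e2, hΦ, Complex.exp_mul_I, show -((2 * c' ^ 2 * u : ℝ) : ℂ) * Complex.I = (-(2 * c' ^ 2 * u : ℝ) : ℂ) * Complex.I by ring, Complex.exp_mul_I, Complex.cos_neg, Complex.sin_neg]
    push_cast
    field_simp
    ring_nf; rw [Complex.I_sq]; ring
  have J2 : ∀ c' : ℝ, 0 < c' → 2 * Jint (fun _ => 1) c' = ((∫ u, Φ c' u : ℝ) : ℂ) := by
    intro c' hc'
    rw [← integral_complex_ofReal]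
    simp_rw [← hsum c' hc']
    rw [integral_const_mul]
    have i1 : Integrable (fun u : ℝ => kern (c' + (c' * u : ℝ) * Complex.I)) := (int1 c' hc').comp_mul_left' hc'.ne'
    have i2 : Integrable (fun u : ℝ => kern (c' + (c' * -u : ℝ) * Complex.I)) := i1.comp_neg
    rw [integral_add i1 i2, integral_neg_eq_self (fun u : ℝ => kern (c' + (c' * u : ℝ) * Complex.I))]
    rw [Measure.integral_comp_mul_left (fun v : ℝ => kern (c' + v * Complex.I)) c']
    rw [abs_of_pos (inv_pos.mpr hc'), Jint]
    simp only [one_mul, Complex.real_smul]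
    have hc0 : (c' : ℂ) ≠ 0 := by exact_mod_cast hc'.ne'
    push_cast
    generalize (∫ v : ℝ, kern ((c' : ℂ) + v * Complex.I)) = Q
    field_simp
    ring
  have lim : Tendsto (fun n : ℕ => ∫ u, Φ (1 / ((n : ℝ) + 1)) u) atTop (𝓝 (∫ u : ℝ, 2 * (1 + u ^ 2)⁻¹)) := by
    have hcl : Tendsto (fun n : ℕ => (1 / ((n : ℝ) + 1))) atTop (𝓝 0) := tendsto_one_div_add_atTop_nhds_zero_nat
    refine tendsto_integral_of_dominated_convergence (fun u => 6 * Real.exp 1 * (1 + u ^ 2)⁻¹) ?_ ?_ ?_ ?_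
    · intro n
      apply Continuous.aestronglyMeasurable
      have : ∀ u : ℝ, 1 + u ^ 2 ≠ 0 := fun u => by positivity
      rw [hΦ]
      fun_prop (disch := assumption)
    · exact integrable_inv_one_add_sq.const_mul _
    · intro n
      refine Eventually.of_forall fun u => ?_
      set e := 1 / ((n : ℝ) + 1) with he
      have he0 : 0 < e := by positivity
      have he1 : e ≤ 1 := by rw [he, div_le_one (by positivity)]; linarith [(Nat.cast_nonneg n : (0 : ℝ) ≤ n)]
      rw [hΦ]; simp only
      rw [norm_mul, norm_mul, Real.norm_of_nonneg (Real.exp_pos _).le, Real.norm_of_nonneg (by positivity : 0 ≤ (1 + u ^ 2)⁻¹)]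
      gcongr ?_ * _
      have h1 : ‖2 * Real.cos (2 * e ^ 2 * u) + 2 * u * Real.sin (2 * e ^ 2 * u)‖ ≤ 2 + 4 * (e ^ 2 * u ^ 2) := by
        refine (norm_add_le _ _).trans ?_
        rw [norm_mul, norm_mul, norm_mul]
        simp only [Real.norm_eq_abs, abs_two]
        have a1 := Real.abs_cos_le_one (2 * e ^ 2 * u)
        have a2 : |Real.sin (2 * e ^ 2 * u)| ≤ |2 * e ^ 2 * u| := Real.abs_sin_le_abs
        rw [abs_mul, abs_of_nonneg (by positivity : 0 ≤ 2 * e ^ 2)] at a2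
        have a3 : |u| * |u| = u ^ 2 := by rw [← sq, sq_abs]
        have : 2 * |u| * |Real.sin (2 * e ^ 2 * u)| ≤ 2 * |u| * (2 * e ^ 2 * |u|) := by gcongr
        nlinarith
      have h2 : Real.exp (e ^ 2 * (1 - u ^ 2)) = Real.exp (e ^ 2) * Real.exp (-(e ^ 2 * u ^ 2)) := by
        rw [← Real.exp_add]; congr 1; ring
      have h3 : Real.exp (e ^ 2) ≤ Real.exp 1 := Real.exp_le_exp.mpr (by nlinarith)
      have h4 : Real.exp (-(e ^ 2 * u ^ 2)) * (2 + 4 * (e ^ 2 * u ^ 2)) ≤ 6 := by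
        set x := e ^ 2 * u ^ 2
        have hx : 0 ≤ x := by positivity
        rw [Real.exp_neg, inv_mul_le_iff₀ (Real.exp_pos _)]
        linarith [Real.add_one_le_exp x]
      calc _ ≤ Real.exp (e ^ 2 * (1 - u ^ 2)) * (2 + 4 * (e ^ 2 * u ^ 2)) := by gcongr
        _ = Real.exp (e ^ 2) * (Real.exp (-(e ^ 2 * u ^ 2)) * (2 + 4 * (e ^ 2 * u ^ 2))) := by rw [h2]; ring
        _ ≤ Real.exp 1 * 6 := by gcongr
        _ = _ := by ring
    · refine Eventually.of_forall fun u => ?_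
      have hcont : Continuous (fun c : ℝ => Φ c u) := by rw [hΦ]; fun_prop
      have := (hcont.tendsto 0).comp hcl
      simpa [hΦ, Function.comp_def] using this
  have hconst : ∀ n : ℕ, ((∫ u, Φ (1 / ((n : ℝ) + 1)) u : ℝ) : ℂ) = 2 * Jint (fun _ => 1) c := by
    intro n
    rw [← J2 _ (by positivity), key _ (by positivity)]
  have lim2 : Tendsto (fun n : ℕ => ((∫ u, Φ (1 / ((n : ℝ) + 1)) u : ℝ) : ℂ)) atTop (𝓝 ((∫ u : ℝ, 2 * (1 + u ^ 2)⁻¹ : ℝ) : ℂ)) :=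
    (Complex.continuous_ofReal.tendsto _).comp lim
  simp_rw [hconst] at lim2
  have := tendsto_nhds_unique tendsto_const_nhds lim2
  rw [integral_const_mul, integral_univ_inv_one_add_sq] at this
  push_cast at this
  linear_combination this / 2

lemma kern_neg (w : ℂ) : kern (-w) = -kern w := by
  rw [kern, kern, neg_sq, div_neg]

open MeasureTheory in
lemma Jint_one_neg (c : ℝ) (hc : c < 0) : Jint (fun _ => 1) c = -Real.pi := by
  rw [← Jint_one (-c) (by linarith), Jint, Jint, ← integral_neg_eq_self, ← integral_neg]
  congr 1
  ext v
  rw [one_mul, one_mul, ← kern_neg]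
  congr 1
  push_cast; ring

open MeasureTheory in
lemma J_integrable (g : ℂ → ℂ) (c M k : ℝ) (hc : c ≠ 0) (hd : Continuous (fun v : ℝ => g (c + v * Complex.I)))
    (hb : ∀ v : ℝ, ‖g (c + v * Complex.I)‖ ≤ M * Real.exp (k * |v|)) :
    Integrable (fun v : ℝ => g (c + v * Complex.I) * kern (c + v * Complex.I)) := by
  have hM : 0 ≤ M := by
    have h1 := hb 0
    simp at h1
    exact (norm_nonneg _).trans h1
  have hG : Integrable (fun v : ℝ => (M * Real.exp (c ^ 2) * Real.exp (k ^ 2 / 2) / |c|) * Real.exp (-(1 / 2) * v ^ 2)) :=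
    (integrable_exp_neg_mul_sq (by norm_num : (0 : ℝ) < 1 / 2)).const_mul _
  have hne : ∀ v : ℝ, (c : ℂ) + v * Complex.I ≠ 0 := by
    intro v h; have := congrArg Complex.re h; simp at this; exact hc this
  refine hG.mono' ?_ (Filter.Eventually.of_forall fun v => ?_)
  · apply Continuous.aestronglyMeasurable
    apply hd.mul
    unfold kern
    fun_prop (disch := assumption)
  · have hr : |c| ≤ ‖(c : ℂ) + v * Complex.I‖ := by simpa using Complex.abs_re_le_norm ((c : ℂ) + v * Complex.I)
    rw [kern, norm_mul, norm_div, norm_exp_sq]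
    simp only [Complex.add_re, Complex.ofReal_re, Complex.mul_re, Complex.I_re, mul_zero, Complex.ofReal_im,
      Complex.I_im, mul_one, sub_self, add_zero, Complex.add_im, Complex.mul_im, zero_add]
    have hcp : 0 < |c| := abs_pos.mpr hc
    calc _ ≤ (M * Real.exp (k * |v|)) * (Real.exp (c ^ 2) * Real.exp (-v ^ 2) / |c|) := by
          gcongr; exact hb v
      _ = (M * Real.exp (c ^ 2) / |c|) * (Real.exp (k * |v|) * Real.exp (-v ^ 2)) := by ring
      _ ≤ (M * Real.exp (c ^ 2) / |c|) * (Real.exp (k ^ 2 / 2) * Real.exp (-(1 / 2) * v ^ 2)) :=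
        mul_le_mul_of_nonneg_left (exp_absorb _ _) (by positivity)
      _ = _ := by ring

open MeasureTheory in
lemma J_shift1 (g : ℂ → ℂ) (a b M k : ℝ) (hk : 0 ≤ k) (ha : a < 0) (hb0 : 0 < b)
    (hd : DifferentiableOn ℂ g {w | a ≤ w.re ∧ w.re ≤ b})
    (hb : ∀ w : ℂ, a ≤ w.re → w.re ≤ b → ‖g w‖ ≤ M * Real.exp (k * |w.im|)) :
    Jint g b - Jint g a = 2 * Real.pi * g 0 := by
  set S : Set ℂ := {w | a ≤ w.re ∧ w.re ≤ b} with hS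
  have hM : 0 ≤ M := by
    have h1 := hb a (by simp) (by simp; linarith)
    simp at h1
    exact (norm_nonneg _).trans h1
  have hS0 : S ∈ nhds (0 : ℂ) := by
    have : {w : ℂ | a < w.re ∧ w.re < b} ∈ nhds (0 : ℂ) := by
      apply IsOpen.mem_nhds
      · exact (isOpen_lt continuous_const Complex.continuous_re).inter (isOpen_lt Complex.continuous_re continuous_const)
      · simp [ha, hb0]
    filter_upwards [this] with w hw
    exact ⟨hw.1.le, hw.2.le⟩
  set q := dslope g 0 with hq
  have hqd : DifferentiableOn ℂ q S := (Complex.differentiableOn_dslope hS0).mpr hd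
  have hq1 : ∀ w : ℂ, w ≠ 0 → q w = (g w - g 0) / w := by
    intro w hw
    rw [hq, dslope_of_ne _ hw, slope_def_field, sub_zero]
  -- bound for q
  obtain ⟨B, hB⟩ : ∃ B : ℝ, ∀ w ∈ (Set.Icc a b ×ℂ Set.Icc (-1 : ℝ) 1), ‖q w‖ ≤ B := by
    apply IsCompact.exists_bound_of_continuousOn
    · exact isCompact_Icc.reProdIm isCompact_Icc
    · exact hqd.continuousOn.mono fun w hw => hw.1
  have hg0 : ‖g 0‖ ≤ M := by simpa using hb 0 (by simpa using ha.le) (by simpa using hb0.le)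
  have hqb : ∀ w : ℂ, a ≤ w.re → w.re ≤ b → ‖q w‖ ≤ (|B| + 2 * M) * Real.exp (k * |w.im|) := by
    intro w h1 h2
    have he : 1 ≤ Real.exp (k * |w.im|) := Real.one_le_exp (by positivity)
    rcases le_total |w.im| 1 with h | h
    · have := hB w ⟨⟨h1, h2⟩, abs_le.mp h⟩
      calc ‖q w‖ ≤ |B| * 1 := by rw [mul_one]; exact this.trans (le_abs_self _)
        _ ≤ _ := by gcongr; linarith
    · have hw : w ≠ 0 := by rintro rfl; simp at h; linarith
      have hwn : 1 ≤ ‖w‖ := h.trans (Complex.abs_im_le_norm w)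
      rw [hq1 w hw, norm_div]
      calc _ ≤ ‖g w - g 0‖ := div_le_self (norm_nonneg _) hwn
        _ ≤ ‖g w‖ + ‖g 0‖ := norm_sub_le _ _
        _ ≤ M * Real.exp (k * |w.im|) + M * 1 := by rw [mul_one]; exact add_le_add (hb w h1 h2) hg0
        _ ≤ M * Real.exp (k * |w.im|) + M * Real.exp (k * |w.im|) := by gcongr
        _ ≤ _ := by nlinarith [mul_nonneg (abs_nonneg B) (Real.exp_pos (k * |w.im|)).le]
  have hshift := strip_shift (fun w => q w * Complex.exp (w ^ 2)) a b _ (by linarith) (hqd.mul (by fun_prop))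
    (norm_g_exp q a b (|B| + 2 * M) k (by positivity) hqb)
  obtain ⟨i1, i2, heq⟩ := hshift
  have line : ∀ c : ℝ, c ≠ 0 → Integrable (fun v : ℝ => q (c + v * Complex.I) * Complex.exp ((c + v * Complex.I) ^ 2)) →
      Jint g c = (∫ v : ℝ, q (c + v * Complex.I) * Complex.exp ((c + v * Complex.I) ^ 2)) + g 0 * Jint (fun _ => 1) c := by
    intro c hc hi
    have hne : ∀ v : ℝ, (c : ℂ) + v * Complex.I ≠ 0 := by
      intro v h; have := congrArg Complex.re h; simp at this; exact hc this
    have i3 : Integrable (fun v : ℝ => g 0 * (1 * kern (c + v * Complex.I))) :=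
      (J_integrable (fun _ => 1) c 1 0 hc (by fun_prop) (by simp)).const_mul _
    rw [Jint, Jint, ← integral_const_mul, ← integral_add hi i3]
    congr 1
    ext v
    rw [hq1 _ (hne v), kern]
    ring
  rw [line b hb0.ne' i2, line a ha.ne i1, ← heq, Jint_one b hb0, Jint_one_neg a ha]
  ring

open MeasureTheory in
lemma integrable_abs_rpow_exp (s : ℝ) (hs : -1 < s) :
    Integrable (fun v : ℝ => |v| ^ s * Real.exp (-(1 / 2) * v ^ 2)) := by
  have h := integrable_rpow_mul_exp_neg_mul_sq (by norm_num : (0 : ℝ) < 1 / 2) hs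
  refine (h.norm.add h.comp_neg.norm).mono' ?_ (Filter.Eventually.of_forall fun v => ?_)
  · apply Measurable.aestronglyMeasurable
    fun_prop
  · simp only [Pi.add_apply]
    rw [Real.norm_of_nonneg (by positivity)]
    rcases le_total 0 v with hv | hv
    · rw [abs_of_nonneg hv]
      exact (Real.le_norm_self _).trans (le_add_of_nonneg_right (norm_nonneg _))
    · rw [abs_of_nonpos hv]
      refine le_trans ?_ (le_add_of_nonneg_left (norm_nonneg _))
      refine le_trans ?_ (Real.le_norm_self _)
      rw [neg_sq]

open MeasureTheory in
lemma J_bound : ∃ K : ℝ, 0 < K ∧ ∀ (g : ℂ → ℂ) (c B : ℝ), c ≠ 0 →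
    (∀ v : ℝ, ‖g (c + v * Complex.I)‖ ≤ B * (1 + |v|) ^ 8) →
    ‖Jint g c‖ ≤ K * B * Real.exp (c ^ 2) * |c| ^ (-(1 / 5) : ℝ) := by
  have hI := integrable_abs_rpow_exp (-(4 / 5)) (by norm_num)
  set K0 := ∫ v : ℝ, |v| ^ (-(4 / 5) : ℝ) * Real.exp (-(1 / 2) * v ^ 2) with hK0
  have hK0n : 0 ≤ K0 := integral_nonneg fun v => by positivity
  refine ⟨Real.exp 32 * (K0 + 1), by positivity, fun g c B hc hb => ?_⟩
  have hB : 0 ≤ B := by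
    have h1 := hb 0
    simp at h1
    exact (norm_nonneg _).trans h1
  have hcp : 0 < |c| := abs_pos.mpr hc
  have hle : ‖Jint g c‖ ≤ ∫ v : ℝ, (Real.exp 32 * B * Real.exp (c ^ 2) * |c| ^ (-(1 / 5) : ℝ)) * (|v| ^ (-(4 / 5) : ℝ) * Real.exp (-(1 / 2) * v ^ 2)) := by
    refine norm_integral_le_of_norm_le (hI.const_mul _) ?_
    have hae : ∀ᵐ v : ℝ, v ≠ 0 := by
      rw [ae_iff]; simp
    filter_upwards [hae] with v hv
    set w : ℂ := c + v * Complex.I with hw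
    have hvp : 0 < |v| := abs_pos.mpr hv
    have hr : |c| ≤ ‖w‖ := by simpa [hw] using Complex.abs_re_le_norm w
    have hi : |v| ≤ ‖w‖ := by simpa [hw] using Complex.abs_im_le_norm w
    have hwp : 0 < ‖w‖ := hcp.trans_le hr
    have h1 : ‖w‖⁻¹ ≤ |c| ^ (-(1 / 5) : ℝ) * |v| ^ (-(4 / 5) : ℝ) := by
      rw [← Real.rpow_neg_one, show (-1 : ℝ) = -(1 / 5) + -(4 / 5) by norm_num, Real.rpow_add hwp]
      exact mul_le_mul (Real.rpow_le_rpow_of_nonpos hcp hr (by norm_num))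
        (Real.rpow_le_rpow_of_nonpos hvp hi (by norm_num)) (by positivity) (by positivity)
    have h2 : (1 + |v|) ^ 8 * Real.exp (-v ^ 2) ≤ Real.exp 32 * Real.exp (-(1 / 2) * v ^ 2) := by
      have := exp_absorb 8 v
      norm_num at this
      refine le_trans ?_ (this.trans (le_of_eq (by norm_num)))
      gcongr
      rw [show 8 * |v| = (8 : ℕ) * |v| by norm_num, Real.exp_nat_mul]
      gcongr
      linarith [Real.add_one_le_exp |v|]
    rw [kern, norm_mul, norm_div, norm_exp_sq, show w.re = c by simp [hw], show w.im = v by simp [hw], div_eq_mul_inv]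
    calc _ ≤ (B * (1 + |v|) ^ 8) * (Real.exp (c ^ 2) * Real.exp (-v ^ 2) * (|c| ^ (-(1 / 5) : ℝ) * |v| ^ (-(4 / 5) : ℝ))) := by
          gcongr; exact hb v
      _ = (B * Real.exp (c ^ 2) * |c| ^ (-(1 / 5) : ℝ) * |v| ^ (-(4 / 5) : ℝ)) * ((1 + |v|) ^ 8 * Real.exp (-v ^ 2)) := by ring
      _ ≤ (B * Real.exp (c ^ 2) * |c| ^ (-(1 / 5) : ℝ) * |v| ^ (-(4 / 5) : ℝ)) * (Real.exp 32 * Real.exp (-(1 / 2) * v ^ 2)) := by gcongr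
      _ = _ := by ring
  rw [integral_const_mul, ← hK0] at hle
  refine hle.trans ?_
  calc _ = (Real.exp 32 * B * Real.exp (c ^ 2) * |c| ^ (-(1 / 5) : ℝ)) * K0 := rfl
    _ ≤ (Real.exp 32 * B * Real.exp (c ^ 2) * |c| ^ (-(1 / 5) : ℝ)) * (K0 + 1) := by gcongr; linarith
    _ = _ := by ring

lemma char_period_sum {k : ℕ} (hk : k ≠ 0) (θ : DirichletCharacter ℂ k) (h1 : θ ≠ 1) :
    ∑ n ∈ Finset.range k, θ (n : ZMod k) = 0 := by
  haveI : NeZero k := ⟨hk⟩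
  rw [← MulChar.sum_eq_zero_of_ne_one h1]
  refine Finset.sum_nbij' (fun n => (n : ZMod k)) (fun a => a.val) ?_ ?_ ?_ ?_ ?_
  · intro a _; simp
  · intro a _; simpa using ZMod.val_lt a
  · intro a ha; exact ZMod.val_cast_of_lt (by simpa using ha)
  · intro a _; simp
  · intro a _; rfl

lemma char_psum_bound {k : ℕ} (hk : k ≠ 0) (θ : DirichletCharacter ℂ k) (h1 : θ ≠ 1) (m : ℕ) :
    ‖∑ n ∈ Finset.range m, θ (n : ZMod k)‖ ≤ k := by
  induction m using Nat.strong_induction_on with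
  | _ m ih =>
    by_cases h : m < k
    · refine (norm_sum_le _ _).trans ?_
      refine (Finset.sum_le_sum (g := fun _ => (1:ℝ)) fun n _ => DirichletCharacter.norm_le_one θ _).trans ?_
      simp; omega
    · obtain ⟨j, rfl⟩ := Nat.exists_eq_add_of_le (not_lt.mp h)
      rw [Finset.sum_range_add, char_period_sum hk θ h1, zero_add]
      simpa using ih j (by omega)

def Spart {k : ℕ} (θ : DirichletCharacter ℂ k) (x : ℝ) : ℂ := ∑ n ∈ Finset.Icc 1 ⌊x⌋₊, θ (n : ZMod k)

lemma Spart_bound' {k : ℕ} (hk : k ≠ 0) (θ : DirichletCharacter ℂ k) (h1 : θ ≠ 1) (m : ℕ) :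
    ‖∑ n ∈ Finset.Icc 1 m, θ (n : ZMod k)‖ ≤ k + 1 := by
  have e : ∑ n ∈ Finset.range (m+1), θ (n : ZMod k) = ∑ n ∈ Finset.Icc 1 m, θ (n : ZMod k) + θ ((0:ℕ) : ZMod k) := by
    rw [Finset.sum_range_succ', Finset.range_eq_Ico, Finset.sum_Ico_add' (fun n : ℕ => θ (n : ZMod k)) 0 m 1]
    rfl
  rw [eq_sub_of_add_eq e.symm]
  refine (norm_sub_le _ _).trans ?_
  exact add_le_add (char_psum_bound hk θ h1 _) (DirichletCharacter.norm_le_one θ _)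

lemma Spart_measurable {k : ℕ} (θ : DirichletCharacter ℂ k) : Measurable (Spart θ) := by
  exact (measurable_from_nat (f := fun m : ℕ => ∑ n ∈ Finset.Icc 1 m, θ (n : ZMod k))).comp Nat.measurable_floor

lemma Lfun_integral {k : ℕ} (hk : 1 < k) (θ : DirichletCharacter ℂ k) (hθ : θ.IsPrimitive) (s : ℂ) (hs : 0 < s.re) :
    Lfun θ s = s * ∫ t in Set.Ioi (1 : ℝ), Spart θ t * (t : ℂ) ^ (-(s + 1)) := by
  haveI : NeZero k := ⟨by omega⟩
  have hk0 : k ≠ 0 := by omega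
  have h1 := primitive_ne_one hk θ hθ
  let f : ℝ → ℂ := (Set.Ioi (1:ℝ)).indicator (Spart θ)
  have hfb : ∀ x, ‖f x‖ ≤ k + 1 := by
    intro x
    exact (norm_indicator_le_norm_self _ _).trans (Spart_bound' hk0 θ h1 _)
  have hfm : Measurable f := (Spart_measurable θ).indicator measurableSet_Ioi
  have hmel : ∀ z : ℂ, mellin f (-z) = ∫ t in Set.Ioi (1 : ℝ), Spart θ t * (t : ℂ) ^ (-(z + 1)) := by
    intro z
    rw [mellin]
    have : ∀ t : ℝ, (t:ℂ)^(-z - 1) • f t = (Set.Ioi (1:ℝ)).indicator (fun t : ℝ => Spart θ t * (t : ℂ) ^ (-(z + 1))) t := by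
      intro t
      by_cases ht : t ∈ Set.Ioi (1:ℝ)
      · simp only [f, Set.indicator_of_mem ht, smul_eq_mul]
        rw [mul_comm]; congr 2; ring
      · simp only [f, Set.indicator_of_notMem ht, smul_zero]
    simp_rw [this]
    rw [MeasureTheory.setIntegral_indicator measurableSet_Ioi, Set.Ioi_inter_Ioi]
    simp
  have hdm : ∀ z : ℂ, 0 < z.re → DifferentiableAt ℂ (fun z => z * mellin f (-z)) z := by
    intro z hz
    refine differentiableAt_id.mul ?_
    have : DifferentiableAt ℂ (mellin f) (-z) := by
      refine mellin_differentiableAt_of_isBigO_rpow (a := 0) (b := -z.re - 1) ?_ ?_ ?_ ?_ ?_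
      · refine MeasureTheory.LocallyIntegrable.locallyIntegrableOn ?_ _
        intro x
        refine ⟨Set.Icc (x-1) (x+1), Icc_mem_nhds (by linarith) (by linarith), ?_⟩
        refine MeasureTheory.Measure.integrableOn_of_bounded (M := k+1) (by simp) hfm.aestronglyMeasurable ?_
        exact Filter.Eventually.of_forall fun x => hfb x
      · simp only [neg_zero, Real.rpow_zero]
        exact Asymptotics.isBigO_of_le' (c := k+1) _ (fun x => by simpa using hfb x)
      · simpa using hz
      · refine Asymptotics.IsBigO.of_bound 0 ?_
        filter_upwards [Ioo_mem_nhdsGT (zero_lt_one' ℝ)] with x hx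
        have : x ∉ Set.Ioi (1:ℝ) := by simpa using hx.2.le
        simp [f, this]
      · simp
    exact DifferentiableAt.comp (f := fun z : ℂ => -z) z this differentiableAt_id.neg
  rw [← hmel]
  have hU : IsOpen {z : ℂ | 0 < z.re} := isOpen_lt continuous_const Complex.continuous_re
  have hpc : IsPreconnected {z : ℂ | 0 < z.re} := (convex_halfSpace_re_gt 0).isPreconnected
  have key : Set.EqOn (Lfun θ) (fun z => z * mellin f (-z)) {z : ℂ | 0 < z.re} := by
    refine AnalyticOnNhd.eqOn_of_preconnected_of_eventuallyEq (𝕜 := ℂ) (z₀ := 2) ?_ ?_ hpc (by simp) ?_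
    · exact (Lfun_differentiable hk θ hθ).differentiableOn.analyticOnNhd hU
    · exact DifferentiableOn.analyticOnNhd (fun z hz => (hdm z hz).differentiableWithinAt) hU
    · have : {z : ℂ | 1 < z.re} ∈ nhds (2:ℂ) := (isOpen_lt continuous_const Complex.continuous_re).mem_nhds (by simp)
      filter_upwards [this] with z hz
      rw [hmel, Lfun_eq, DirichletCharacter.LFunction_eq_LSeries θ hz]
      refine LSeries_eq_mul_integral _ le_rfl (lt_trans zero_lt_one hz) (ZMod.LSeriesSummable_of_one_lt_re _ hz) ?_
      refine Asymptotics.isBigO_of_le' (c := k+1) _ (fun x => by simpa using Spart_bound' hk0 θ h1 x)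
  exact key hs

lemma Lfun_growth_right {k : ℕ} (hk : 1 < k) (θ : DirichletCharacter ℂ k) (hθ : θ.IsPrimitive) (s : ℂ)
    (hs : 1/2 ≤ s.re) : ‖Lfun θ s‖ ≤ 2 * (k + 1) * ‖s‖ := by
  rw [Lfun_integral hk θ hθ s (by linarith), norm_mul, mul_comm]
  refine mul_le_mul_of_nonneg_right ?_ (norm_nonneg _)
  have h1 := primitive_ne_one hk θ hθ
  have hi : MeasureTheory.IntegrableOn (fun t : ℝ => (k+1 : ℝ) * t ^ (-(3/2) : ℝ)) (Set.Ioi 1) :=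
    (integrableOn_Ioi_rpow_of_lt (by norm_num) zero_lt_one).const_mul _
  refine (MeasureTheory.norm_integral_le_of_norm_le hi ?_).trans ?_
  · refine (MeasureTheory.ae_restrict_iff' measurableSet_Ioi).mpr (Filter.Eventually.of_forall fun t ht => ?_)
    have ht1 : (1:ℝ) < t := ht
    rw [norm_mul, Complex.norm_cpow_eq_rpow_re_of_pos (by linarith)]
    refine mul_le_mul (Spart_bound' (by omega) θ h1 _) ?_ (by positivity) (by positivity)
    refine Real.rpow_le_rpow_of_exponent_le ht1.le ?_
    simp; linarith
  · rw [MeasureTheory.integral_const_mul, integral_Ioi_rpow_of_lt (by norm_num) zero_lt_one]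
    norm_num
    linarith

lemma Lfun_growth {k : ℕ} (hk : 1 < k) (θ : DirichletCharacter ℂ k) (hθ : θ.IsPrimitive) :
    ∃ M, 0 ≤ M ∧ ∀ s : ℂ, -1/2 ≤ s.re → s.re ≤ 3/2 → ‖Lfun θ s‖ ≤ M * (1 + |s.im|)^4 := by
  obtain ⟨C, hC, hZ⟩ := Zb2
  have hns : ∀ s : ℂ, -1/2 ≤ s.re → s.re ≤ 3/2 → ‖s‖ ≤ 2 * (1 + |s.im|) := by
    intro s h1 h2
    refine (Complex.norm_le_abs_re_add_abs_im s).trans ?_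
    have : |s.re| ≤ 2 := abs_le.mpr ⟨by linarith, by linarith⟩
    linarith [abs_nonneg s.im]
  have hkr : (1:ℝ) ≤ k := by exact_mod_cast hk.le
  have hp4 : ∀ x : ℝ, (1 + |x|) ≤ (1+|x|)^4 := fun x => le_self_pow₀ (by linarith [abs_nonneg x]) (by norm_num)
  refine ⟨4 * (k+1) * (C * k + 1), by positivity, fun s h1 h2 => ?_⟩
  by_cases h : 1/2 ≤ s.re
  · refine (Lfun_growth_right hk θ hθ s h).trans ?_
    have a := hns s h1 h2
    have b := hp4 s.im
    have : 2 * ((k:ℝ)+1) * ‖s‖ ≤ 4 * (k+1) * 1 * (1+|s.im|)^4 := by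
      nlinarith [mul_le_mul_of_nonneg_left (a.trans (mul_le_mul_of_nonneg_left b (by norm_num : (0:ℝ) ≤ 2))) (by positivity : (0:ℝ) ≤ 2*(k+1))]
    refine this.trans ?_
    gcongr
    have : 0 ≤ C * k := by positivity
    linarith
  · push Not at h
    have hs1 : (1 - s).re = 1 - s.re := by simp
    have hs2 : (1 - s).im = - s.im := by simp
    rw [Lfun_FE hk θ hθ s (by linarith), norm_mul]
    have z := hZ k θ (by omega) hθ s.re s.im h1 (by linarith) (Or.inl (by linarith))
    rw [Complex.re_add_im] at z
    have l := Lfun_growth_right hk θ⁻¹ (inv_isPrimitive θ hθ) (1 - s) (by rw [hs1]; linarith)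
    have n := hns (1 - s) (by rw [hs1]; linarith) (by rw [hs1]; linarith)
    rw [hs2, abs_neg] at n
    have hkk : (k:ℝ) ^ (1/2 - s.re) ≤ k := by
      conv_rhs => rw [← Real.rpow_one (k:ℝ)]
      exact Real.rpow_le_rpow_of_exponent_le hkr (by linarith)
    have z' : ‖Zfun θ s‖ ≤ C * k * (1 + |s.im|)^3 := by
      refine z.trans ?_; gcongr
    have l' : ‖Lfun θ⁻¹ (1-s)‖ ≤ 4 * (k+1) * (1 + |s.im|) := by
      refine l.trans ?_
      nlinarith
    refine (mul_le_mul z' l' (norm_nonneg _) (by positivity)).trans ?_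
    have : C * k * (1 + |s.im|)^3 * (4 * (k+1) * (1 + |s.im|)) = 4*(k+1)*(C*k) * (1+|s.im|)^4 := by ring
    rw [this]
    gcongr
    linarith

lemma Aprod_growth (D : ℕ) (χ : DirichletCharacter ℂ D) {p : ℕ} (ψ : DirichletCharacter ℂ p)
    (hD : 1 < D) (hp : 1 < p) (hc : Nat.Coprime D p) (hχ : χ.IsPrimitive) (hψ : ψ.IsPrimitive) :
    ∃ M, 0 ≤ M ∧ ∀ s : ℂ, -1/2 ≤ s.re → s.re ≤ 3/2 → ‖Aprod D χ ψ s‖ ≤ M * (1 + |s.im|)^8 := by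
  obtain ⟨M1, h1, b1⟩ := Lfun_growth hp ψ hψ
  obtain ⟨M2, h2, b2⟩ := Lfun_growth (Nat.one_lt_mul_iff.mpr ⟨by omega, by omega, Or.inl hD⟩) _ (chiPsi_isPrimitive D χ ψ (by omega) (by omega) hc hχ hψ)
  refine ⟨M1 * M2, by positivity, fun s a b => ?_⟩
  rw [Aprod, norm_mul]
  refine (mul_le_mul (b1 s a b) (b2 s a b) (norm_nonneg _) (by positivity)).trans (le_of_eq (by ring))

lemma Aprod_differentiable (D : ℕ) (χ : DirichletCharacter ℂ D) {p : ℕ} (ψ : DirichletCharacter ℂ p)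
    (hD : 1 < D) (hp : 1 < p) (hc : Nat.Coprime D p) (hχ : χ.IsPrimitive) (hψ : ψ.IsPrimitive) :
    Differentiable ℂ (Aprod D χ ψ) :=
  (Lfun_differentiable hp ψ hψ).mul (Lfun_differentiable (Nat.one_lt_mul_iff.mpr ⟨by omega, by omega, Or.inl hD⟩) _ (chiPsi_isPrimitive D χ ψ (by omega) (by omega) hc hχ hψ))

lemma X3_measurable (D : ℕ) (χ : DirichletCharacter ℂ D) {p : ℕ} (ψ : DirichletCharacter ℂ p) :
    Measurable (X3 D χ ψ) :=
  (measurable_from_nat (f := fun m : ℕ => ∑ n ∈ Finset.Ioc (D ^ 4) m, nuF D χ n * ψ (n : ZMod p) * (n : ℂ) ^ (-s0 D))).comp Nat.measurable_floor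

lemma X3_bdd (D : ℕ) (χ : DirichletCharacter ℂ D) {p : ℕ} (ψ : DirichletCharacter ℂ p) (b : ℝ) :
    ∃ K, ∀ x ≤ b, ‖X3 D χ ψ x‖ ≤ K := by
  refine ⟨∑ n ∈ Finset.Ioc (D ^ 4) ⌊b⌋₊, ‖nuF D χ n * ψ (n : ZMod p) * (n : ℂ) ^ (-s0 D)‖, fun x hx => ?_⟩
  refine (norm_sum_le _ _).trans ?_
  refine Finset.sum_le_sum_of_subset_of_nonneg ?_ (fun _ _ _ => norm_nonneg _)
  exact Finset.Ioc_subset_Ioc_right (Nat.floor_mono hx)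

lemma Mfun_bound (D : ℕ) (χ : DirichletCharacter ℂ D) {p : ℕ} (ψ : DirichletCharacter ℂ p)
    (hD : 1 < D) (hDP : (D : ℝ)^4 ≤ bigP D ^ 2) (h2 : Ineq2 D χ ψ) (z : ℂ) (B : ℝ)
    (hB : ∀ t : ℝ, (D:ℝ)^4 ≤ t → t ≤ bigP D ^ 2 → t ^ (-(z.re - 1/2)) ≤ B) :
    ‖Mfun D χ ψ z‖ ≤ B * (1 + ‖z - s0 D‖) * bigL D ^ (-585 : ℤ) := by
  set u := z - s0 D with hu
  have hD0 : (1:ℝ) < D := by exact_mod_cast hD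
  have hD4 : (1:ℝ) ≤ (D:ℝ)^4 := one_le_pow₀ hD0.le
  have hre : u.re = z.re - 1/2 := by simp [hu, s0]
  have hB0 : 0 ≤ B := le_trans (Real.rpow_nonneg (by positivity) _) (hB _ le_rfl hDP)
  by_cases hu0 : u = 0
  · have hz : z = s0 D := sub_eq_zero.mp hu0
    have hM : Mfun D χ ψ z = X3 D χ ψ (bigP D ^ 2) := by rw [hz]; rfl
    have hB1 : 1 ≤ B := by
      have := hB _ le_rfl hDP
      rw [← hre, hu0] at this
      simpa using this
    rw [hM, hu0, norm_zero, add_zero, mul_one]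
    have i0 : 0 ≤ ∫ x in ((D : ℝ) ^ 4)..(bigP D ^ 2), ‖X3 D χ ψ x‖ / x :=
      intervalIntegral.integral_nonneg hDP fun x hx => div_nonneg (norm_nonneg _) (by linarith [hx.1])
    unfold Ineq2 at h2
    have : 0 ≤ bigL D ^ (-585 : ℤ) := by linarith [norm_nonneg (X3 D χ ψ (bigP D ^ 2))]
    nlinarith
  let c : ℕ → ℂ := fun n => if D^4 < n then nuF D χ n * ψ (n : ZMod p) * (n : ℂ) ^ (-s0 D) else 0
  have hc : ∀ m : ℕ, ∑ k ∈ Finset.Icc 0 m, c k = ∑ n ∈ Finset.Ioc (D ^ 4) m, nuF D χ n * ψ (n : ZMod p) * (n : ℂ) ^ (-s0 D) := by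
    intro m
    simp only [c]
    rw [← Finset.sum_filter]
    refine Finset.sum_congr ?_ (fun _ _ => rfl)
    ext n; simp; tauto
  let f : ℝ → ℂ := fun t => (t:ℂ) ^ (-u)
  have hder : ∀ t : ℝ, 0 < t → HasDerivAt f (-u * (t:ℂ)^(-u-1)) t := by
    intro t ht
    exact hasDerivAt_ofReal_cpow_const (x := t) (r := -u) ht.ne' (neg_ne_zero.mpr hu0)
  have hpos : ∀ t ∈ Set.Icc ((D:ℝ)^4) (bigP D ^ 2), 0 < t := fun t ht => by linarith [ht.1]
  have hderc : ContinuousOn (deriv f) (Set.Icc ((D:ℝ)^4) (bigP D ^ 2)) := by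
    have : ContinuousOn (fun t : ℝ => -u * (t:ℂ)^(-u-1)) (Set.Icc ((D:ℝ)^4) (bigP D ^ 2)) := by
      refine continuousOn_const.mul ?_
      intro t ht
      exact (Complex.continuousAt_ofReal_cpow_const _ _ (Or.inr (hpos t ht).ne')).continuousWithinAt
    exact this.congr fun t ht => (hder t (hpos t ht)).deriv
  have key := sum_mul_eq_sub_sub_integral_mul c (f := f) (a := (D:ℝ)^4) (b := bigP D ^ 2) (by positivity) hDP
    (fun t ht => (hder t (hpos t ht)).differentiableAt) hderc.integrableOn_Icc
  have hfl : ⌊(D:ℝ)^4⌋₊ = D^4 := by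
    rw [← Nat.cast_pow, Nat.floor_natCast]
  rw [hfl] at key
  simp only [hc] at key
  rw [Finset.Ioc_self, Finset.sum_empty, mul_zero, sub_zero] at key
  have hM : Mfun D χ ψ z = ∑ k ∈ Finset.Ioc (D ^ 4) ⌊bigP D ^ 2⌋₊, f k * c k := by
    unfold Mfun
    refine Finset.sum_congr rfl fun n hn => ?_
    have hn1 : D^4 < n := (Finset.mem_Ioc.mp hn).1
    have hn0 : (n:ℂ) ≠ 0 := by exact_mod_cast (by omega : n ≠ 0)
    simp only [f, c, if_pos hn1]
    have : (n:ℂ)^(-z) = ((n:ℝ):ℂ)^(-u) * (n:ℂ)^(-s0 D) := by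
      rw [Complex.ofReal_natCast, ← Complex.cpow_add _ _ hn0]; congr 1; rw [hu]; ring
    rw [this]; ring
  rw [hM, key]
  have hnf : ∀ t : ℝ, 0 < t → ‖f t‖ = t ^ (-(z.re - 1/2)) := by
    intro t ht
    simp only [f]
    rw [Complex.norm_cpow_eq_rpow_re_of_pos ht, Complex.neg_re, hre]
  obtain ⟨K, hK⟩ := X3_bdd D χ ψ (bigP D ^ 2)
  have hint : MeasureTheory.IntegrableOn (fun x => ‖X3 D χ ψ x‖ / x) (Set.Ioc ((D:ℝ)^4) (bigP D ^ 2)) := by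
    refine MeasureTheory.Measure.integrableOn_of_bounded (M := K) (by simp) ((X3_measurable D χ ψ).norm.div measurable_id).aestronglyMeasurable ?_
    refine (MeasureTheory.ae_restrict_iff' measurableSet_Ioc).mpr (Filter.Eventually.of_forall fun t ht => ?_)
    have h1 : 1 ≤ t := hD4.trans ht.1.le
    rw [Real.norm_eq_abs, abs_of_nonneg (by positivity)]
    exact (div_le_self (norm_nonneg _) h1).trans (hK t ht.2)
  have hI : ‖∫ t in Set.Ioc ((D:ℝ)^4) (bigP D ^ 2), deriv f t * X3 D χ ψ t‖ ≤ B * ‖u‖ * ∫ x in ((D : ℝ) ^ 4)..(bigP D ^ 2), ‖X3 D χ ψ x‖ / x := by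
    rw [intervalIntegral.integral_of_le hDP, ← MeasureTheory.integral_const_mul]
    refine MeasureTheory.norm_integral_le_of_norm_le (hint.const_mul _) ?_
    refine (MeasureTheory.ae_restrict_iff' measurableSet_Ioc).mpr (Filter.Eventually.of_forall fun t ht => ?_)
    have ht0 : 0 < t := by linarith [ht.1]
    rw [(hder t ht0).deriv, norm_mul, norm_mul, norm_neg, Complex.norm_cpow_eq_rpow_re_of_pos ht0]
    have e : (-u-1).re = -(z.re - 1/2) - 1 := by simp [hre]
    rw [e, Real.rpow_sub_one ht0.ne']
    have := hB t ht.1.le ht.2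
    calc ‖u‖ * (t ^ (-(z.re - 1/2)) / t) * ‖X3 D χ ψ t‖ = t ^ (-(z.re - 1/2)) * (‖u‖ * (‖X3 D χ ψ t‖ / t)) := by ring
      _ ≤ B * (‖u‖ * (‖X3 D χ ψ t‖ / t)) := by gcongr
      _ = _ := by ring
  have hF : ‖f (bigP D ^ 2) * X3 D χ ψ (bigP D ^ 2)‖ ≤ B * ‖X3 D χ ψ (bigP D ^ 2)‖ := by
    rw [norm_mul, hnf _ (by linarith)]
    gcongr
    exact hB _ hDP le_rfl
  have i0 : 0 ≤ ∫ x in ((D : ℝ) ^ 4)..(bigP D ^ 2), ‖X3 D χ ψ x‖ / x :=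
    intervalIntegral.integral_nonneg hDP fun x hx => div_nonneg (norm_nonneg _) (by linarith [hx.1])
  unfold Ineq2 at h2
  refine (norm_sub_le _ _).trans ((add_le_add hF hI).trans ?_)
  set a := ‖X3 D χ ψ (bigP D ^ 2)‖
  set I := ∫ x in ((D : ℝ) ^ 4)..(bigP D ^ 2), ‖X3 D χ ψ x‖ / x
  have ha : 0 ≤ a := norm_nonneg _
  have hun := norm_nonneg u
  calc B * a + B * ‖u‖ * I ≤ B * (1 + ‖u‖) * (a + I) := by
        have : 0 ≤ B * I := by positivity
        have : 0 ≤ B * ‖u‖ * a := by positivity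
        nlinarith
    _ ≤ _ := by gcongr

/-- The shifted integrand. -/
def Gsh (H : ℂ → ℂ) (s : ℂ) (Λ : ℝ) (w : ℂ) : ℂ := H (s + w) * Complex.exp (Λ * w)

/-- Vertical line integral along `Re z = c`. -/
def JJ (H : ℂ → ℂ) (s : ℂ) (Λ c : ℝ) : ℂ := Jint (Gsh H s Λ) (c - s.re)

/-- Integrability along the line `Re z = c`. -/
def JInt (H : ℂ → ℂ) (s : ℂ) (Λ c : ℝ) : Prop :=
  MeasureTheory.Integrable (fun v : ℝ => Gsh H s Λ ((c - s.re : ℝ) + v * Complex.I) * kern ((c - s.re : ℝ) + v * Complex.I))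

lemma one_add_abs_mul (t v : ℝ) : 1 + |t + v| ≤ (1 + |t|) * (1 + |v|) := by
  have := abs_add_le t v
  nlinarith [abs_nonneg t, abs_nonneg v, mul_nonneg (abs_nonneg t) (abs_nonneg v)]

lemma norm_Eexp (Λ : ℝ) (w : ℂ) : ‖Complex.exp (Λ * w)‖ = Real.exp (Λ * w.re) := by
  rw [Complex.norm_exp]; simp

lemma Gsh_bound (H : ℂ → ℂ) (s : ℂ) (Λ a b M : ℝ) (hM : 0 ≤ M)
    (hb : ∀ z : ℂ, a ≤ z.re → z.re ≤ b → ‖H z‖ ≤ M * (1 + |z.im|) ^ 8) (w : ℂ) (h1 : a - s.re ≤ w.re) (h2 : w.re ≤ b - s.re) :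
    ‖Gsh H s Λ w‖ ≤ (M * (1 + |s.im|)^8 * Real.exp (|Λ| * (|a - s.re| + |b - s.re|))) * Real.exp (8 * |w.im|) := by
  rw [Gsh, norm_mul, norm_Eexp]
  have hz := hb (s + w) (by simp; linarith) (by simp; linarith)
  have h3 : (1 + |(s+w).im|)^8 ≤ (1 + |s.im|)^8 * Real.exp (8 * |w.im|) := by
    have e : Real.exp (8 * |w.im|) = Real.exp |w.im| ^ 8 := by rw [← Real.exp_nat_mul]; norm_num
    rw [e, ← mul_pow, Complex.add_im]
    refine pow_le_pow_left₀ (by positivity) ((one_add_abs_mul _ _).trans ?_) 8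
    gcongr
    linarith [Real.add_one_le_exp |w.im|]
  have h4 : Λ * w.re ≤ |Λ| * (|a - s.re| + |b - s.re|) := by
    refine (le_abs_self _).trans ?_
    rw [abs_mul]
    gcongr
    refine abs_le.mpr ⟨?_, ?_⟩
    · linarith [neg_abs_le (a - s.re), abs_nonneg (b - s.re)]
    · linarith [le_abs_self (b - s.re), abs_nonneg (a - s.re)]
  calc ‖H (s+w)‖ * Real.exp (Λ * w.re) ≤ (M * ((1 + |s.im|)^8 * Real.exp (8 * |w.im|))) * Real.exp (|Λ| * (|a - s.re| + |b - s.re|)) := by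
        refine mul_le_mul (hz.trans (by gcongr)) (Real.exp_le_exp.mpr h4) (by positivity) (by positivity)
    _ = _ := by ring

lemma Gsh_diff (H : ℂ → ℂ) (s : ℂ) (Λ a b : ℝ) (hd : DifferentiableOn ℂ H {z | a ≤ z.re ∧ z.re ≤ b}) :
    DifferentiableOn ℂ (Gsh H s Λ) {w | a - s.re ≤ w.re ∧ w.re ≤ b - s.re} := by
  refine DifferentiableOn.mul ?_ (by fun_prop)
  refine hd.comp (by fun_prop) ?_
  intro w hw
  simp only [Set.mem_setOf_eq, Complex.add_re] at hw ⊢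
  exact ⟨by linarith, by linarith⟩

lemma JJ_shift0 (H : ℂ → ℂ) (s : ℂ) (Λ a b M : ℝ) (hM : 0 ≤ M) (hab : a ≤ b) (h0 : s.re < a ∨ b < s.re)
    (hd : DifferentiableOn ℂ H {z | a ≤ z.re ∧ z.re ≤ b})
    (hb : ∀ z : ℂ, a ≤ z.re → z.re ≤ b → ‖H z‖ ≤ M * (1 + |z.im|) ^ 8) :
    JInt H s Λ a ∧ JInt H s Λ b ∧ JJ H s Λ a = JJ H s Λ b :=
  J_shift0 (Gsh H s Λ) (a - s.re) (b - s.re) _ 8 (by linarith)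
    (by rcases h0 with h | h; · left; linarith
        · right; linarith)
    (Gsh_diff H s Λ a b hd) (Gsh_bound H s Λ a b M hM hb)

lemma JJ_shift1 (H : ℂ → ℂ) (s : ℂ) (Λ a b M : ℝ) (hM : 0 ≤ M) (ha : a < s.re) (hb0 : s.re < b)
    (hd : DifferentiableOn ℂ H {z | a ≤ z.re ∧ z.re ≤ b})
    (hb : ∀ z : ℂ, a ≤ z.re → z.re ≤ b → ‖H z‖ ≤ M * (1 + |z.im|) ^ 8) :
    JJ H s Λ b - JJ H s Λ a = 2 * Real.pi * H s := by
  have := J_shift1 (Gsh H s Λ) (a - s.re) (b - s.re) _ 8 (by norm_num) (by linarith) (by linarith)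
    (Gsh_diff H s Λ a b hd) (Gsh_bound H s Λ a b M hM hb)
  rw [JJ, JJ, this]
  simp [Gsh]

lemma JJ_congr (H H' : ℂ → ℂ) (s : ℂ) (Λ c : ℝ) (h : ∀ z : ℂ, z.re = c → H z = H' z) : JJ H s Λ c = JJ H' s Λ c := by
  unfold JJ Jint
  congr 1; ext v
  rw [Gsh, Gsh, h _ (by simp)]

lemma JJ_add (H H' : ℂ → ℂ) (s : ℂ) (Λ c : ℝ) (h : JInt H s Λ c) (h' : JInt H' s Λ c) :
    JJ (fun z => H z + H' z) s Λ c = JJ H s Λ c + JJ H' s Λ c ∧ JInt (fun z => H z + H' z) s Λ c := by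
  unfold JJ Jint
  have e : ∀ v : ℝ, Gsh (fun z => H z + H' z) s Λ ((c - s.re : ℝ) + v * Complex.I) * kern ((c - s.re : ℝ) + v * Complex.I)
    = Gsh H s Λ ((c - s.re : ℝ) + v * Complex.I) * kern ((c - s.re : ℝ) + v * Complex.I)
      + Gsh H' s Λ ((c - s.re : ℝ) + v * Complex.I) * kern ((c - s.re : ℝ) + v * Complex.I) := by
    intro v; simp only [Gsh]; ring
  constructor
  · simp_rw [e]; exact MeasureTheory.integral_add h h'
  · unfold JInt; simp_rw [e]; exact h.add h'

lemma JJ_bound : ∃ K : ℝ, 0 < K ∧ ∀ (H : ℂ → ℂ) (s : ℂ) (Λ c B : ℝ), c ≠ s.re →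
    (∀ v : ℝ, ‖H (c + (s.im + v : ℝ) * Complex.I)‖ ≤ B * (1 + |v|) ^ 8) →
    ‖JJ H s Λ c‖ ≤ K * (B * Real.exp (Λ * (c - s.re))) * Real.exp ((c - s.re) ^ 2) * |c - s.re| ^ (-(1 / 5) : ℝ) := by
  obtain ⟨K, hK, hJ⟩ := J_bound
  refine ⟨K, hK, fun H s Λ c B hc hb => hJ _ _ _ (sub_ne_zero.mpr hc) fun v => ?_⟩
  rw [Gsh, norm_mul, norm_Eexp]
  have e : s + ((c - s.re : ℝ) + v * Complex.I) = c + (s.im + v : ℝ) * Complex.I := by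
    apply Complex.ext <;> simp
  rw [e]
  have e2 : (((c - s.re : ℝ) : ℂ) + v * Complex.I).re = c - s.re := by simp
  rw [e2, mul_right_comm]
  exact mul_le_mul_of_nonneg_right (hb v) (Real.exp_pos _).le

def ZH (D : ℕ) (χ : DirichletCharacter ℂ D) {p : ℕ} (ψ : DirichletCharacter ℂ p) (H : ℂ → ℂ) (z : ℂ) : ℂ :=
  Ztilde D χ ψ z * H (1 - z)

lemma Ztilde_growth (D : ℕ) (χ : DirichletCharacter ℂ D) {p : ℕ} (ψ : DirichletCharacter ℂ p)
    (hD : 1 < D) (hp : 1 < p) (hc : Nat.Coprime D p) (hχ : χ.IsPrimitive) (hψ : ψ.IsPrimitive) :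
    ∃ M, 0 ≤ M ∧ ∀ s : ℂ, -1/2 ≤ s.re → s.re ≤ 7/8 → ‖Ztilde D χ ψ s‖ ≤ M * (1 + |s.im|)^8 := by
  obtain ⟨C, hC, hZ⟩ := Zb2
  have hpr : (1:ℝ) ≤ p := by exact_mod_cast hp.le
  have hDp : 1 ≤ D * p := Nat.one_le_iff_ne_zero.mpr (mul_ne_zero (by omega) (by omega))
  have hDpr : (1:ℝ) ≤ (D * p : ℕ) := by exact_mod_cast hDp
  refine ⟨(C * p) * (C * (D * p : ℕ)), by positivity, fun s h1 h2 => ?_⟩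
  have a := hZ p ψ (by omega) hψ s.re s.im h1 (by linarith) (Or.inl h2)
  have b := hZ (D * p) (chiPsi D χ ψ) (by omega) (chiPsi_isPrimitive D χ ψ (by omega) (by omega) hc hχ hψ) s.re s.im h1 (by linarith) (Or.inl h2)
  rw [Complex.re_add_im] at a b
  have hk : ∀ k : ℝ, 1 ≤ k → k ^ (1/2 - s.re) ≤ k := by
    intro k hk
    conv_rhs => rw [← Real.rpow_one k]
    exact Real.rpow_le_rpow_of_exponent_le hk (by linarith)
  have a' : ‖Zfun ψ s‖ ≤ C * p * (1 + |s.im|)^3 := a.trans (by gcongr; exact hk _ hpr)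
  have b' : ‖Zfun (chiPsi D χ ψ) s‖ ≤ C * (D * p : ℕ) * (1 + |s.im|)^3 := b.trans (by gcongr; exact hk _ hDpr)
  rw [Ztilde, norm_mul]
  refine (mul_le_mul a' b' (norm_nonneg _) (by positivity)).trans ?_
  have : (1 + |s.im|)^6 ≤ (1 + |s.im|)^8 := pow_le_pow_right₀ (by linarith [abs_nonneg s.im]) (by norm_num)
  calc _ = (C * p) * (C * (D * p : ℕ)) * (1 + |s.im|)^6 := by ring
    _ ≤ _ := by gcongr

lemma Ztilde_differentiableAt (D : ℕ) (χ : DirichletCharacter ℂ D) {p : ℕ} (ψ : DirichletCharacter ℂ p)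
    (hD : 1 < D) (hp : 1 < p) (s : ℂ) (hs : s.re < 1) : DifferentiableAt ℂ (Ztilde D χ ψ) s :=
  (Zfun_differentiableAt (by omega) ψ s hs).mul (Zfun_differentiableAt (mul_ne_zero (by omega) (by omega)) _ s hs)

lemma ZH_growth (D : ℕ) (χ : DirichletCharacter ℂ D) {p : ℕ} (ψ : DirichletCharacter ℂ p)
    (hD : 1 < D) (hp : 1 < p) (hc : Nat.Coprime D p) (hχ : χ.IsPrimitive) (hψ : ψ.IsPrimitive) (H : ℂ → ℂ) (b M0 : ℝ)
    (hb : b ≤ 7/8) (hM0 : 0 ≤ M0)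
    (hH : ∀ z : ℂ, 1 - b ≤ z.re → z.re ≤ 3/2 → ‖H z‖ ≤ M0) (hHd : Differentiable ℂ H) :
    ∃ M, 0 ≤ M ∧ (∀ z : ℂ, -1/2 ≤ z.re → z.re ≤ b → ‖ZH D χ ψ H z‖ ≤ M * (1 + |z.im|)^8) ∧
      DifferentiableOn ℂ (ZH D χ ψ H) {z | -1/2 ≤ z.re ∧ z.re ≤ b} := by
  obtain ⟨M, hM, h⟩ := Ztilde_growth D χ ψ hD hp hc hχ hψ
  refine ⟨M * M0, by positivity, fun z h1 h2 => ?_, fun z hz => ?_⟩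
  · rw [ZH, norm_mul]
    refine (mul_le_mul (h z h1 (by linarith)) (hH (1 - z) (by simp; linarith) (by simp; linarith)) (norm_nonneg _) (by positivity)).trans (le_of_eq (by ring))
  · have hz2 : z.re ≤ b := hz.2
    have := (Ztilde_differentiableAt D χ ψ hD hp z (by linarith)).mul
      ((hHd (1 - z)).comp z (f := fun z : ℂ => 1 - z) (by fun_prop))
    exact this.differentiableWithinAt

lemma one_le_bigP (D : ℕ) : 1 ≤ bigP D := Real.one_le_exp (pow_nonneg (Real.log_natCast_nonneg D) 9)

lemma Tfun_bound' (D : ℕ) (χ : DirichletCharacter ℂ D) {p : ℕ} (ψ : DirichletCharacter ℂ p)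
    (hD : D ≠ 0) (hp : p ≠ 0) (hDP : D^4 ≤ ⌊bigP D^2⌋₊) (s : ℂ) (hs : 3/2 ≤ s.re) : ‖Tfun D χ ψ s‖ ≤ Stail := by
  refine (Tfun_bound D χ ψ hD hp hDP s (by linarith)).trans ?_
  refine mul_le_of_le_one_right Stail_nonneg ?_
  exact Real.rpow_le_one_of_one_le_of_nonpos (one_le_pow₀ (one_le_bigP D)) (by linarith)

lemma Tfun_differentiable (D : ℕ) (χ : DirichletCharacter ℂ D) {p : ℕ} (ψ : DirichletCharacter ℂ p)
    (hD : 1 < D) (hp : 1 < p) (hc : Nat.Coprime D p) (hχ : χ.IsPrimitive) (hψ : ψ.IsPrimitive) :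
    Differentiable ℂ (Tfun D χ ψ) :=
  ((Aprod_differentiable D χ ψ hD hp hc hχ hψ).sub (Ffun_differentiable D χ ψ)).sub (Mfun_differentiable D χ ψ)

lemma const_le_pow8 (M t : ℝ) (hM : 0 ≤ M) : M ≤ M * (1 + |t|)^8 :=
  le_mul_of_one_le_right hM (one_le_pow₀ (by linarith [abs_nonneg t]))

lemma contour_id (D : ℕ) (χ : DirichletCharacter ℂ D) {p : ℕ} (ψ : DirichletCharacter ℂ p)
    (hD : 1 < D) (hp : 1 < p) (hc : Nat.Coprime D p) (hχ : χ.IsPrimitive) (hψ : ψ.IsPrimitive) (hr : IsRealChar χ)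
    (hDP : D^4 ≤ ⌊bigP D^2⌋₊) (s : ℂ) (Λ β R : ℝ) (hβ : 0 < β) (hβ1 : β ≤ 1/8) (hs1 : 1/2 - β < s.re) (hs2 : s.re < 5/4)
    (hR : 3/2 ≤ R) :
    2 * Real.pi * (Aprod D χ ψ s - Ffun D χ ψ s - Mfun D χ ψ s) =
      JJ (Ffun D χ ψ) s Λ (s.re - β) + JJ (Mfun D χ ψ) s Λ (s.re - β) + JJ (Tfun D χ ψ) s Λ R
       - (JJ (ZH D χ ψ (Ffun D χ ψ⁻¹)) s Λ (-1/2) + JJ (ZH D χ ψ (Mfun D χ ψ⁻¹)) s Λ (1/2 - β)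
        + JJ (ZH D χ ψ (Tfun D χ ψ⁻¹)) s Λ (-1/2)) := by
  have hψ' := inv_isPrimitive ψ hψ
  have hD0 : D ≠ 0 := by omega
  have hp0 : p ≠ 0 := by omega
  have hMn : (0:ℝ) ≤ (⌊bigP D ^ 2⌋₊ : ℝ) ^ 3 := by positivity
  have hFn : (0:ℝ) ≤ (D:ℝ)^12 := by positivity
  -- main residue
  obtain ⟨MA, hMA, hA⟩ := Aprod_growth D χ ψ hD hp hc hχ hψ
  have r0 := JJ_shift1 (Aprod D χ ψ) s Λ (-1/2) (3/2) MA hMA (by linarith) (by linarith)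
    (Aprod_differentiable D χ ψ hD hp hc hχ hψ).differentiableOn hA
  -- right
  have rF := JJ_shift1 (Ffun D χ ψ) s Λ (s.re - β) (3/2) _ hFn (by linarith) (by linarith)
    (Ffun_differentiable D χ ψ).differentiableOn
    (fun z h1 h2 => (Ffun_bound D χ ψ z (by linarith)).trans (const_le_pow8 _ _ hFn))
  have rM := JJ_shift1 (Mfun D χ ψ) s Λ (s.re - β) (3/2) _ hMn (by linarith) (by linarith)
    (Mfun_differentiable D χ ψ).differentiableOn
    (fun z h1 h2 => (Mfun_bound0 D χ ψ z (by linarith)).trans (const_le_pow8 _ _ hMn))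
  have iF := (JJ_shift0 (Ffun D χ ψ) s Λ (3/2) (3/2) _ hFn le_rfl (Or.inl (by linarith))
    (Ffun_differentiable D χ ψ).differentiableOn
    (fun z h1 h2 => (Ffun_bound D χ ψ z (by linarith)).trans (const_le_pow8 _ _ hFn))).1
  have iM := (JJ_shift0 (Mfun D χ ψ) s Λ (3/2) (3/2) _ hMn le_rfl (Or.inl (by linarith))
    (Mfun_differentiable D χ ψ).differentiableOn
    (fun z h1 h2 => (Mfun_bound0 D χ ψ z (by linarith)).trans (const_le_pow8 _ _ hMn))).1
  obtain ⟨iT, _, rT⟩ := JJ_shift0 (Tfun D χ ψ) s Λ (3/2) R _ Stail_nonneg hR (Or.inl (by linarith))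
    (Tfun_differentiable D χ ψ hD hp hc hχ hψ).differentiableOn
    (fun z h1 h2 => (Tfun_bound' D χ ψ hD0 hp0 hDP z h1).trans (const_le_pow8 _ _ Stail_nonneg))
  have a1 := JJ_add _ _ _ _ _ iF iM
  have a2 := JJ_add _ _ _ _ _ a1.2 iT
  have e1 : JJ (Aprod D χ ψ) s Λ (3/2) = JJ (fun z => Ffun D χ ψ z + Mfun D χ ψ z + Tfun D χ ψ z) s Λ (3/2) :=
    JJ_congr _ _ _ _ _ fun z _ => by rw [Tfun]; ring
  rw [a2.1, a1.1] at e1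
  -- left
  obtain ⟨B1, hB1, g1, d1⟩ := ZH_growth D χ ψ hD hp hc hχ hψ (Ffun D χ ψ⁻¹) (-1/2) _ (by norm_num) hFn
    (fun z h1 h2 => Ffun_bound D χ ψ⁻¹ z (by linarith)) (Ffun_differentiable D χ ψ⁻¹)
  obtain ⟨B2, hB2, g2, d2⟩ := ZH_growth D χ ψ hD hp hc hχ hψ (Mfun D χ ψ⁻¹) (1/2 - β) _ (by linarith) hMn
    (fun z h1 h2 => Mfun_bound0 D χ ψ⁻¹ z (by linarith)) (Mfun_differentiable D χ ψ⁻¹)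
  obtain ⟨B3, hB3, g3, d3⟩ := ZH_growth D χ ψ hD hp hc hχ hψ (Tfun D χ ψ⁻¹) (-1/2) _ (by norm_num) Stail_nonneg
    (fun z h1 h2 => Tfun_bound' D χ ψ⁻¹ hD0 hp0 hDP z (by linarith)) (Tfun_differentiable D χ ψ⁻¹ hD hp hc hχ hψ')
  have jF := (JJ_shift0 _ s Λ (-1/2) (-1/2) _ hB1 le_rfl (Or.inr (by linarith)) d1 g1).1
  obtain ⟨jM, _, rM'⟩ := JJ_shift0 _ s Λ (-1/2) (1/2 - β) _ hB2 (by linarith) (Or.inr (by linarith)) d2 g2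
  have jT := (JJ_shift0 _ s Λ (-1/2) (-1/2) _ hB3 le_rfl (Or.inr (by linarith)) d3 g3).1
  have b1 := JJ_add _ _ _ _ _ jF jM
  have b2 := JJ_add _ _ _ _ _ b1.2 jT
  have e2 : JJ (Aprod D χ ψ) s Λ (-1/2) = JJ (fun z => ZH D χ ψ (Ffun D χ ψ⁻¹) z + ZH D χ ψ (Mfun D χ ψ⁻¹) z
      + ZH D χ ψ (Tfun D χ ψ⁻¹) z) s Λ (-1/2) :=
    JJ_congr _ _ _ _ _ fun z hz => by
      rw [Aprod_FE D χ ψ hD hp hc hχ hψ hr z (by linarith), ZH, ZH, ZH, Tfun]; ring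
  rw [b2.1, b1.1, rM'] at e2
  rw [e1, e2, rT] at r0
  linear_combination (-1) * r0 + rF + rM

lemma ZF_shift_low (D : ℕ) (χ : DirichletCharacter ℂ D) {p : ℕ} (ψ : DirichletCharacter ℂ p)
    (hD : 1 < D) (hp : 1 < p) (hc : Nat.Coprime D p) (hχ : χ.IsPrimitive) (hψ : ψ.IsPrimitive)
    (s : ℂ) (Λ : ℝ) (h1 : -1/2 < s.re) (h2 : s.re < 7/8) :
    JJ (ZH D χ ψ (Ffun D χ ψ⁻¹)) s Λ (-1/2) = JJ (ZH D χ ψ (Ffun D χ ψ⁻¹)) s Λ (7/8)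
      - 2 * Real.pi * (Ztilde D χ ψ s * FfunBar D χ ψ s) := by
  obtain ⟨B1, hB1, g1, d1⟩ := ZH_growth D χ ψ hD hp hc hχ hψ (Ffun D χ ψ⁻¹) (7/8) _ le_rfl (by positivity : (0:ℝ) ≤ (D:ℝ)^12)
    (fun z h1 h2 => Ffun_bound D χ ψ⁻¹ z (by linarith)) (Ffun_differentiable D χ ψ⁻¹)
  have := JJ_shift1 _ s Λ (-1/2) (7/8) _ hB1 h1 h2 d1 g1
  rw [ZH, ← FfunBar_eq] at this
  linear_combination -this

lemma ZF_shift_high (D : ℕ) (χ : DirichletCharacter ℂ D) {p : ℕ} (ψ : DirichletCharacter ℂ p)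
    (hD : 1 < D) (hp : 1 < p) (hc : Nat.Coprime D p) (hχ : χ.IsPrimitive) (hψ : ψ.IsPrimitive)
    (s : ℂ) (Λ : ℝ) (h1 : 5/8 < s.re) :
    JJ (ZH D χ ψ (Ffun D χ ψ⁻¹)) s Λ (-1/2) = JJ (ZH D χ ψ (Ffun D χ ψ⁻¹)) s Λ (5/8) := by
  obtain ⟨B1, hB1, g1, d1⟩ := ZH_growth D χ ψ hD hp hc hχ hψ (Ffun D χ ψ⁻¹) (5/8) _ (by norm_num) (by positivity : (0:ℝ) ≤ (D:ℝ)^12)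
    (fun z h1 h2 => Ffun_bound D χ ψ⁻¹ z (by linarith)) (Ffun_differentiable D χ ψ⁻¹)
  exact (JJ_shift0 _ s Λ (-1/2) (5/8) _ hB1 (by norm_num) (Or.inr h1) d1 g1).2.2

lemma poly_facts (L : ℝ) (hL : 20 ≤ L) : 160000 ≤ L^4 ∧ 8000 * L ≤ L^4 ∧ 160000 * L ≤ L^5 ∧ 160000 * L^5 ≤ L^9 ∧ 20 * L^9 ≤ L^10 := by
  have h0 : 0 < L := by linarith
  have h3 : (8000:ℝ) ≤ L^3 := by
    have := pow_le_pow_left₀ (by norm_num) hL 3; norm_num at this; exact this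
  have h4 : (160000:ℝ) ≤ L^4 := by
    have := pow_le_pow_left₀ (by norm_num) hL 4; norm_num at this; exact this
  refine ⟨h4, ?_, ?_, ?_, ?_⟩
  · calc 8000 * L ≤ L^3 * L := by gcongr
      _ = L^4 := by ring
  · calc 160000 * L ≤ L^4 * L := by gcongr
      _ = L^5 := by ring
  · calc 160000 * L^5 ≤ L^4 * L^5 := by gcongr
      _ = L^9 := by ring
  · calc 20 * L^9 ≤ L * L^9 := by gcongr
      _ = L^10 := by ring

lemma beta_facts (L : ℝ) (hL : 20 ≤ L) : Real.pi / L^9 ≤ (L^5)⁻¹ / 2 ∧ 0 < (L^5)⁻¹ ∧ (L^5)⁻¹ ≤ 1/8 ∧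
    L^5 * (L^5)⁻¹ = 1 ∧ L^9 * (L^5)⁻¹ = L^4 ∧ 0 < Real.pi / L^9 ∧ L^9 * (Real.pi / L^9) = Real.pi := by
  have h0 : 0 < L := by linarith
  obtain ⟨h4, h4', h5, h9, h10⟩ := poly_facts L hL
  refine ⟨?_, by positivity, ?_, by field_simp, by field_simp, by positivity, by field_simp⟩
  · have : L^9 = L^5 * L^4 := by ring
    rw [this, div_le_div_iff₀ (by positivity) (by norm_num)]
    have e : (L^5)⁻¹ * (L^5 * L^4) = L^4 := by field_simp
    rw [e]
    linarith [Real.pi_lt_four]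
  · rw [inv_le_comm₀ (by positivity) (by norm_num)]
    norm_num; linarith

lemma beta_rpow (L : ℝ) (hL : 20 ≤ L) : ((L^5)⁻¹ : ℝ) ^ (-(1/5) : ℝ) = L := by
  have h0 : 0 < L := by linarith
  rw [Real.rpow_neg (by positivity), Real.inv_rpow (by positivity), inv_inv, ← Real.rpow_natCast, ← Real.rpow_mul h0.le]
  norm_num

lemma rpow_fifth_anti (x y : ℝ) (hx : 0 < x) (h : x ≤ y) : y ^ (-(1/5) : ℝ) ≤ x ^ (-(1/5) : ℝ) :=
  Real.rpow_le_rpow_of_nonpos hx h (by norm_num)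

lemma eighth_rpow (x : ℝ) (h : 1/8 ≤ x) : x ^ (-(1/5) : ℝ) ≤ 8 := by
  refine (rpow_fifth_anti (1/8) x (by norm_num) h).trans ?_
  rw [one_div, Real.inv_rpow (by norm_num), ← Real.rpow_neg (by norm_num), neg_neg]
  calc (8:ℝ)^((1/5):ℝ) ≤ 8^(1:ℝ) := Real.rpow_le_rpow_of_exponent_le (by norm_num) (by norm_num)
    _ = 8 := Real.rpow_one _

lemma L_pow_le_exp (L : ℝ) (hL : 20 ≤ L) (n : ℕ) : L ^ n ≤ Real.exp (n * L) := by
  rw [Real.exp_nat_mul]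
  exact pow_le_pow_left₀ (by linarith) (by linarith [Real.add_one_le_exp L]) n

lemma exp_neg_le : ∃ C : ℝ, 0 < C ∧ ∀ L : ℝ, 20 ≤ L → Real.exp (-L) ≤ C * L ^ (-179 : ℤ) := by
  refine ⟨(Nat.factorial 179 : ℝ), by positivity, fun L hL => ?_⟩
  have h := Real.pow_div_factorial_le_exp L (by linarith) 179
  rw [Real.exp_neg, zpow_neg, ← div_eq_mul_inv, inv_le_comm₀ (Real.exp_pos _) (by positivity), inv_div]
  exact_mod_cast h

/-- All running assumptions. -/
structure Good (D : ℕ) (χ : DirichletCharacter ℂ D) {p : ℕ} (ψ : DirichletCharacter ℂ p) (s : ℂ) : Prop where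
  hD : 1 < D
  hp : 1 < p
  hc : Nat.Coprime D p
  hχ : χ.IsPrimitive
  hψ : ψ.IsPrimitive
  hr : IsRealChar χ
  hL : 20 ≤ bigL D
  hP1 : bigP D ≤ p
  hP2 : (p:ℝ) ≤ 2 * bigP D
  hDP : D ^ 4 ≤ ⌊bigP D ^ 2⌋₊
  h2 : Ineq2 D χ ψ
  hs1 : 1/2 - Real.pi / bigL D ^ 9 < s.re
  hs2 : s.re < 1 + Real.pi / bigL D ^ 9
  ht : |s.im - 2 * Real.pi * bigL D ^ 519| < bigL D ^ 405 + 3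

/-- The exponent `log X`. -/
def Lam (D : ℕ) : ℝ := 2 * bigL D ^ 9 - bigL D ^ 5

section
variable {D : ℕ} {χ : DirichletCharacter ℂ D} {p : ℕ} {ψ : DirichletCharacter ℂ p} {s : ℂ}

lemma D_eq (hD : 1 < D) : (D:ℝ) = Real.exp (bigL D) := by
  rw [bigL, Real.exp_log]; exact_mod_cast (by omega : 0 < D)

lemma bigP_sq (D : ℕ) : bigP D ^ 2 = Real.exp (2 * bigL D ^ 9) := by
  rw [bigP, ← Real.exp_nat_mul]; norm_num

lemma Good.im1 (g : Good D χ ψ s) : 1 + |s.im| ≤ bigL D ^ 520 ∧ 1 ≤ |s.im| := by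
  have hL := g.hL
  have ht := g.ht
  set L := bigL D
  have h405 : L^405 ≤ L^519 := pow_le_pow_right₀ (by linarith) (by norm_num)
  have h1 : 20 ≤ L^405 := hL.trans (le_self_pow₀ (by linarith) (by norm_num))
  have e : L^520 = L * L^519 := by ring
  have h520 : 20 * L^519 ≤ L^520 := by rw [e]; gcongr
  have p3 := Real.pi_gt_three
  have p4 := Real.pi_lt_d2
  have q1 : 2 * Real.pi * L^519 ≤ 6.3 * L^519 := by gcongr; linarith
  have q2 : 6 * L^519 ≤ 2 * Real.pi * L^519 := by gcongr; linarith
  obtain ⟨a, b⟩ := abs_lt.mp ht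
  have hpos : 0 < s.im := by linarith
  rw [abs_of_pos hpos]
  constructor <;> linarith

lemma Good.tau (g : Good D χ ψ s) (v : ℝ) : 1 + |s.im + v| ≤ bigL D ^ 520 * (1 + |v|) :=
  (one_add_abs_mul _ _).trans (mul_le_mul_of_nonneg_right g.im1.1 (by positivity))

/-- Distance to `s0`. -/
lemma Good.dist (g : Good D χ ψ s) (z : ℂ) (v : ℝ) (h1 : |z.re - 1/2| ≤ 1) (h2 : z.im = s.im + v) :
    1 + ‖z - s0 D‖ ≤ 2 * bigL D ^ 405 * (1 + |v|) := by
  have hL := g.hL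
  have ht := g.ht
  have h20 : 20 ≤ bigL D ^405 := hL.trans (le_self_pow₀ (by linarith) (by norm_num))
  have hre : (z - s0 D).re = z.re - 1/2 := by simp [s0]
  have him : (z - s0 D).im = s.im - 2 * Real.pi * bigL D ^ 519 + v := by
    have ht0 : t0 D = bigL D ^ 519 := rfl
    rw [← ht0]; simp [s0, h2]; ring
  have h := Complex.norm_le_abs_re_add_abs_im (z - s0 D)
  rw [hre, him] at h
  have h3 := abs_add_le (s.im - 2 * Real.pi * bigL D ^ 519) v
  generalize bigL D ^ 405 = Q at *
  have : 20 * |v| ≤ Q * |v| := mul_le_mul_of_nonneg_right h20 (abs_nonneg v)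
  have e : 2 * Q * (1 + |v|) = 2 * Q + 2 * (Q * |v|) := by ring
  rw [e]
  linarith [abs_nonneg v]

lemma Good.exp_half (g : Good D χ ψ s) : Lam D * (1/2 - s.re) ≤ 2 * Real.pi := by
  obtain ⟨h4, h4', h5, h9, h10⟩ := poly_facts _ g.hL
  obtain ⟨b1, b2, b3, b4, b5, b6, b7⟩ := beta_facts _ g.hL
  have hL := g.hL
  have hs := g.hs1
  have : 0 ≤ Lam D := by unfold Lam; linarith
  calc Lam D * (1/2 - s.re) ≤ Lam D * (Real.pi / bigL D ^ 9) := by gcongr; linarith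
    _ ≤ (2 * bigL D ^ 9) * (Real.pi / bigL D ^ 9) := by gcongr; unfold Lam; linarith
    _ = 2 * Real.pi := by rw [mul_assoc, b7]

lemma Good.hDP' (g : Good D χ ψ s) : (D:ℝ)^4 ≤ bigP D ^ 2 := by
  have h := g.hDP
  have : ((D^4 : ℕ):ℝ) ≤ (⌊bigP D ^ 2⌋₊ : ℝ) := by exact_mod_cast h
  rw [Nat.cast_pow] at this
  exact this.trans (Nat.floor_le (by positivity))

lemma Good.D4 (g : Good D χ ψ s) : (1:ℝ) ≤ (D:ℝ)^4 := by
  have : (1:ℝ) ≤ D := by exact_mod_cast g.hD.le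
  exact one_le_pow₀ this

/-- Bound for M on the line. -/
lemma Good.M_bound (g : Good D χ ψ s) (e : ℝ) (he : 0 ≤ e) (z : ℂ) (v : ℝ) (h1 : |z.re - 1/2| ≤ 1) (h2 : z.im = s.im + v)
    (h3 : 1/2 - z.re ≤ e) :
    ‖Mfun D χ ψ z‖ ≤ Real.exp (2 * bigL D ^ 9 * e) * (2 * (1 + |v|)) * bigL D ^ (-180 : ℤ) := by
  have hL := g.hL
  have hL0 : bigL D ≠ 0 := by linarith
  refine (Mfun_bound D χ ψ g.hD g.hDP' g.h2 z (Real.exp (2 * bigL D ^ 9 * e)) ?_).trans ?_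
  · intro t ht1 ht2
    have ht : 1 ≤ t := g.D4.trans ht1
    calc t ^ (-(z.re - 1/2)) ≤ t ^ e := Real.rpow_le_rpow_of_exponent_le ht (by linarith)
      _ ≤ (bigP D ^ 2) ^ e := Real.rpow_le_rpow (by linarith) ht2 he
      _ = _ := by rw [bigP_sq, ← Real.exp_mul]
  · have hd := g.dist z v h1 h2
    have e1 : bigL D ^ (-180 : ℤ) = bigL D ^ 405 * bigL D ^ (-585 : ℤ) := by
      rw [← zpow_natCast, ← zpow_add₀ hL0]; norm_num
    calc _ ≤ Real.exp (2 * bigL D ^ 9 * e) * (2 * bigL D ^ 405 * (1 + |v|)) * bigL D ^ (-585 : ℤ) := by gcongr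
      _ = _ := by rw [e1]; ring

end

lemma re_line (c τ : ℝ) : ((c:ℂ) + (τ:ℂ) * Complex.I).re = c := by simp
lemma im_line (c τ : ℝ) : ((c:ℂ) + (τ:ℂ) * Complex.I).im = τ := by simp

lemma term1 : ∃ C : ℝ, 0 < C ∧ ∀ (D : ℕ) (χ : DirichletCharacter ℂ D) (p : ℕ) (ψ : DirichletCharacter ℂ p) (s : ℂ),
    Good D χ ψ s → ‖JJ (Ffun D χ ψ) s (Lam D) (s.re - (bigL D ^ 5)⁻¹)‖ ≤ C * Real.exp (-bigL D) := by
  obtain ⟨K, hK, hJ⟩ := JJ_bound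
  refine ⟨K, by positivity, fun D χ p ψ s g => ?_⟩
  obtain ⟨h4, h4', h5, h9, h10⟩ := poly_facts _ g.hL
  obtain ⟨b1, b2, b3, b4, b5, b6, b7⟩ := beta_facts _ g.hL
  have hL := g.hL
  have hs := g.hs1
  set L := bigL D with hLd
  set β := (L^5)⁻¹ with hβ
  refine (hJ _ s (Lam D) (s.re - β) ((D:ℝ)^12) (by linarith) (fun v => ?_)).trans ?_
  · refine (Ffun_bound D χ ψ _ ?_).trans (const_le_pow8 _ v (by positivity))
    simp; linarith
  · have e1 : s.re - β - s.re = -β := by ring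
    have e2 : Lam D * -β = 1 - 2 * L^4 := by
      unfold Lam; rw [← hLd]; linear_combination (-2)*b5 + b4
    rw [e1, e2, abs_neg, abs_of_pos b2, beta_rpow L hL, D_eq g.hD, ← hLd, ← Real.exp_nat_mul]
    have hx : L ≤ Real.exp L := by linarith [Real.add_one_le_exp L]
    calc _ ≤ K * (Real.exp ((12:ℕ) * L) * Real.exp (1 - 2 * L^4)) * Real.exp 1 * Real.exp L := by
          gcongr
          nlinarith
      _ = K * Real.exp ((12:ℕ) * L + (1 - 2 * L^4) + 1 + L) := by
          rw [Real.exp_add, Real.exp_add, Real.exp_add]; ring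
      _ ≤ K * Real.exp (-L) := by
          gcongr
          push_cast
          linarith

lemma term2 : ∃ C : ℝ, 0 < C ∧ ∀ (D : ℕ) (χ : DirichletCharacter ℂ D) (p : ℕ) (ψ : DirichletCharacter ℂ p) (s : ℂ),
    Good D χ ψ s → ‖JJ (Mfun D χ ψ) s (Lam D) (s.re - (bigL D ^ 5)⁻¹)‖ ≤ C * bigL D ^ (-179 : ℤ) := by
  obtain ⟨K, hK, hJ⟩ := JJ_bound
  refine ⟨K * (2 * Real.exp (2 * Real.pi + 1)) * Real.exp 1, by positivity, fun D χ p ψ s g => ?_⟩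
  obtain ⟨h4, h4', h5, h9, h10⟩ := poly_facts _ g.hL
  obtain ⟨b1, b2, b3, b4, b5, b6, b7⟩ := beta_facts _ g.hL
  have hL := g.hL
  have hs := g.hs1
  have hs2 := g.hs2
  set L := bigL D with hLd
  set β := (L^5)⁻¹ with hβ
  set α := Real.pi / L^9 with hα
  have hL0 : L ≠ 0 := by linarith
  refine (hJ _ s (Lam D) (s.re - β) (Real.exp (2 * L^9 * (α + β)) * 2 * L^(-180 : ℤ)) (by linarith) (fun v => ?_)).trans ?_
  · refine (g.M_bound (α + β) (by linarith) _ v ?_ ?_ ?_).trans ?_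
    · simp [abs_le]; constructor <;> linarith
    · simp
    · simp; linarith
    · have : 1 + |v| ≤ (1 + |v|)^8 := le_self_pow₀ (by linarith [abs_nonneg v]) (by norm_num)
      calc _ = (Real.exp (2 * L^9 * (α + β)) * 2 * L^(-180 : ℤ)) * (1 + |v|) := by ring
        _ ≤ _ := by gcongr
  · have e1 : s.re - β - s.re = -β := by ring
    have e2 : Lam D * -β = 1 - 2 * L^4 := by
      unfold Lam; rw [← hLd]; linear_combination (-2)*b5 + b4
    have e3 : 2 * L^9 * (α + β) = 2 * Real.pi + 2 * L^4 := by linear_combination 2 * b7 + 2 * b5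
    rw [e1, e2, e3, abs_neg, abs_of_pos b2, beta_rpow L hL]
    have e4 : L^(-179 : ℤ) = L^(-180 : ℤ) * L := by
      rw [← zpow_add_one₀ hL0]; norm_num
    have e5 : Real.exp (2 * Real.pi + 2 * L^4) * Real.exp (1 - 2*L^4) = Real.exp (2 * Real.pi + 1) := by
      rw [← Real.exp_add]; congr 1; ring
    calc _ ≤ K * (Real.exp (2 * Real.pi + 2 * L^4) * 2 * L^(-180 : ℤ) * Real.exp (1 - 2*L^4)) * Real.exp 1 * L := by
          gcongr
          nlinarith
      _ = K * (2 * (Real.exp (2 * Real.pi + 2 * L^4) * Real.exp (1 - 2*L^4))) * Real.exp 1 * (L^(-180 : ℤ) * L) := by ring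
      _ = _ := by rw [e5, e4]

lemma term3 : ∃ C : ℝ, 0 < C ∧ ∀ (D : ℕ) (χ : DirichletCharacter ℂ D) (p : ℕ) (ψ : DirichletCharacter ℂ p) (s : ℂ),
    Good D χ ψ s → ‖Mfun D χ ψ s‖ ≤ C * bigL D ^ (-179 : ℤ) := by
  refine ⟨2 * Real.exp (2 * Real.pi), by positivity, fun D χ p ψ s g => ?_⟩
  obtain ⟨b1, b2, b3, b4, b5, b6, b7⟩ := beta_facts _ g.hL
  have hL := g.hL
  have hs := g.hs1
  have hs2 := g.hs2
  have h := g.M_bound (Real.pi / bigL D ^ 9) b6.le s 0 (by simp [abs_le]; constructor <;> linarith) (by simp) (by linarith)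
  have e : 2 * bigL D ^ 9 * (Real.pi / bigL D ^ 9) = 2 * Real.pi := by linear_combination 2 * b7
  rw [e] at h
  have h180 : bigL D ^ (-180 : ℤ) ≤ bigL D ^ (-179 : ℤ) := zpow_le_zpow_right₀ (by linarith) (by norm_num)
  simp only [abs_zero, add_zero, mul_one] at h
  calc _ ≤ _ := h
    _ ≤ Real.exp (2 * Real.pi) * 2 * bigL D ^ (-179 : ℤ) := by gcongr
    _ = _ := by ring

lemma term4 : ∃ C : ℝ, 0 < C ∧ ∀ (D : ℕ) (χ : DirichletCharacter ℂ D) (p : ℕ) (ψ : DirichletCharacter ℂ p) (s : ℂ),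
    Good D χ ψ s → ‖JJ (Tfun D χ ψ) s (Lam D) (s.re + bigL D ^ 5 / 2)‖ ≤ C * Real.exp (-bigL D) := by
  obtain ⟨K, hK, hJ⟩ := JJ_bound
  refine ⟨K * (Stail + 1) * 8, mul_pos (mul_pos hK (by linarith [Stail_nonneg])) (by norm_num), fun D χ p ψ s g => ?_⟩
  obtain ⟨h4, h4', h5, h9, h10⟩ := poly_facts _ g.hL
  obtain ⟨b1, b2, b3, b4, b5, b6, b7⟩ := beta_facts _ g.hL
  have hL := g.hL
  have hs := g.hs1
  set L := bigL D with hLd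
  have hSt := Stail_nonneg
  refine (hJ _ s (Lam D) _ (Stail * Real.exp (2 * L^9 - L^9 * L^5)) (by linarith) (fun v => ?_)).trans ?_
  · refine le_trans ?_ (const_le_pow8 _ v (by positivity))
    refine (Tfun_bound D χ ψ (by have := g.hD; omega) (by have := g.hp; omega) g.hDP _ ?_).trans ?_
    · rw [re_line]; linarith
    · gcongr
      rw [bigP_sq, ← Real.exp_mul, Real.exp_le_exp, ← hLd]
      rw [re_line]
      have : 0 ≤ L^9 := by linarith
      nlinarith
  · have e1 : s.re + L^5/2 - s.re = L^5/2 := by ring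
    rw [e1, abs_of_nonneg (by linarith)]
    have h8 := eighth_rpow (L^5/2) (by linarith)
    calc _ ≤ K * (Stail * Real.exp (2 * L^9 - L^9 * L^5) * Real.exp (Lam D * (L^5/2))) * Real.exp ((L^5/2)^2) * 8 := by
          gcongr
      _ = K * Stail * 8 * Real.exp ((2 * L^9 - L^9 * L^5) + Lam D * (L^5/2) + (L^5/2)^2) := by
          rw [Real.exp_add, Real.exp_add]; ring
      _ ≤ K * (Stail + 1) * 8 * Real.exp (-L) := by
          have : (2 * L^9 - L^9 * L^5) + Lam D * (L^5/2) + (L^5/2)^2 = 2 * L^9 - L^10 / 4 := by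
            unfold Lam; rw [← hLd]; ring
          rw [this]
          gcongr
          · linarith
          · linarith

lemma Good.p_le {D : ℕ} {χ : DirichletCharacter ℂ D} {p : ℕ} {ψ : DirichletCharacter ℂ p} {s : ℂ} (g : Good D χ ψ s) :
    (p:ℝ) ≤ Real.exp (1 + bigL D ^ 9) ∧ ((D * p : ℕ) : ℝ) ≤ Real.exp (bigL D + (1 + bigL D ^ 9)) := by
  have h1 : (p:ℝ) ≤ Real.exp (1 + bigL D ^ 9) := by
    refine g.hP2.trans ?_
    rw [Real.exp_add, bigP]
    gcongr
    linarith [Real.add_one_le_exp (1:ℝ)]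
  refine ⟨h1, ?_⟩
  rw [Real.exp_add, Nat.cast_mul, ← D_eq g.hD]
  gcongr

lemma Good.p_ge {D : ℕ} {χ : DirichletCharacter ℂ D} {p : ℕ} {ψ : DirichletCharacter ℂ p} {s : ℂ} (g : Good D χ ψ s) :
    Real.exp (bigL D ^ 9) ≤ (p:ℝ) ∧ Real.exp (bigL D ^ 9) ≤ ((D * p : ℕ) : ℝ) := by
  refine ⟨g.hP1, g.hP1.trans ?_⟩
  rw [Nat.cast_mul]
  have : (1:ℝ) ≤ D := by exact_mod_cast g.hD.le
  exact le_mul_of_one_le_left (by positivity) this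

lemma Good.tau' {D : ℕ} {χ : DirichletCharacter ℂ D} {p : ℕ} {ψ : DirichletCharacter ℂ p} {s : ℂ} (g : Good D χ ψ s) (v : ℝ) :
    1 + |s.im + v| ≤ Real.exp (520 * bigL D) * (1 + |v|) := by
  refine (g.tau v).trans ?_
  have := L_pow_le_exp _ g.hL 520
  push_cast at this
  gcongr

lemma Zt1 : ∃ C : ℝ, 0 < C ∧ ∀ (D : ℕ) (χ : DirichletCharacter ℂ D) (p : ℕ) (ψ : DirichletCharacter ℂ p) (s : ℂ),
    Good D χ ψ s → ∀ v : ℝ, ‖Ztilde D χ ψ ((1/2 - (bigL D ^ 5)⁻¹ : ℝ) + (s.im + v : ℝ) * Complex.I)‖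
      ≤ C * Real.exp (2 * bigL D ^ 4 + 1) * (1 + |v|)^2 := by
  obtain ⟨C, hC, hZ⟩ := Zb1
  refine ⟨C * C, by positivity, fun D χ p ψ s g v => ?_⟩
  obtain ⟨h4, h4', h5, h9, h10⟩ := poly_facts _ g.hL
  obtain ⟨b1, b2, b3, b4, b5, b6, b7⟩ := beta_facts _ g.hL
  obtain ⟨p1, p2⟩ := g.p_le
  have ht := g.tau' v
  have hL := g.hL
  have z1 := hZ p ψ (by have := g.hp; omega) g.hψ (bigL D ^ 5)⁻¹ (s.im + v) b2.le b3
  have z2 := hZ (D * p) (chiPsi D χ ψ) (mul_ne_zero (by have := g.hD; omega) (by have := g.hp; omega))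
    (chiPsi_isPrimitive D χ ψ (by have := g.hD; omega) (by have := g.hp; omega) g.hc g.hχ g.hψ) (bigL D ^ 5)⁻¹ (s.im + v) b2.le b3
  set L := bigL D with hLd
  set β := (L^5)⁻¹ with hβ
  have key : ∀ k : ℝ, 0 ≤ k → k ≤ Real.exp (L + (1 + L^9)) → (k * (1 + |s.im + v|)) ^ β ≤ Real.exp (L^4 + 1/2) * (1 + |v|) := by
    intro k hk0 hk
    have hv : 1 ≤ 1 + |v| := by linarith [abs_nonneg v]
    calc (k * (1 + |s.im + v|)) ^ β ≤ (Real.exp (L + (1 + L^9)) * (Real.exp (520 * L) * (1 + |v|))) ^ β := by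
          gcongr
      _ = Real.exp ((L + (1 + L^9) + 520 * L) * β) * (1 + |v|) ^ β := by
          rw [← mul_assoc, ← Real.exp_add, Real.mul_rpow (by positivity) (by positivity), ← Real.exp_mul]
      _ ≤ Real.exp (L^4 + 1/2) * (1 + |v|) := by
          have e2 : (1 + |v|) ^ β ≤ 1 + |v| := by
            conv_rhs => rw [← Real.rpow_one (1 + |v|)]
            exact Real.rpow_le_rpow_of_exponent_le hv (by linarith)
          have e3 : (L + (1 + L^9) + 520 * L) * β ≤ L^4 + 1/2 := by
            have : (521 * L + 1) * β ≤ (L^5/2) * β := by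
              gcongr; linarith
            linarith
          gcongr
  rw [Ztilde, norm_mul]
  have k1 := key p (by positivity) (p1.trans (Real.exp_le_exp.mpr (by linarith)))
  have k2 := key (D * p : ℕ) (by positivity) p2
  calc _ ≤ (C * (Real.exp (L^4 + 1/2) * (1 + |v|))) * (C * (Real.exp (L^4 + 1/2) * (1 + |v|))) := by
        refine mul_le_mul (z1.trans ?_) (z2.trans ?_) (norm_nonneg _) (by positivity)
        · exact mul_le_mul_of_nonneg_left k1 (by linarith)
        · exact mul_le_mul_of_nonneg_left k2 (by linarith)
    _ = C * C * (Real.exp (L^4 + 1/2) * Real.exp (L^4+1/2)) * (1 + |v|)^2 := by ring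
    _ = _ := by rw [← Real.exp_add]; congr 3; ring

lemma Zt2 : ∃ C : ℝ, 0 < C ∧ ∀ (D : ℕ) (χ : DirichletCharacter ℂ D) (p : ℕ) (ψ : DirichletCharacter ℂ p) (s : ℂ),
    Good D χ ψ s → ∀ c v Q : ℝ, -1/2 ≤ c → c ≤ 5/4 → (c ≤ 7/8 ∨ v = 0) →
      (p:ℝ) ^ (1/2 - c) ≤ Q → ((D * p : ℕ) : ℝ) ^ (1/2 - c) ≤ Q →
      ‖Ztilde D χ ψ ((c : ℝ) + (s.im + v : ℝ) * Complex.I)‖ ≤ C * Q^2 * Real.exp (3120 * bigL D) * (1 + |v|)^8 := by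
  obtain ⟨C, hC, hZ⟩ := Zb2
  refine ⟨C * C, by positivity, fun D χ p ψ s g c v Q hc1 hc2 hcv q1 q2 => ?_⟩
  have hor : c ≤ 7/8 ∨ 1 ≤ |s.im + v| := by
    rcases hcv with h | h
    · exact Or.inl h
    · right; rw [h, add_zero]; exact g.im1.2
  have ht := g.tau' v
  have hL := g.hL
  have hQ : 0 ≤ Q := le_trans (by positivity) q1
  have z1 := hZ p ψ (by have := g.hp; omega) g.hψ c (s.im + v) hc1 hc2 hor
  have z2 := hZ (D * p) (chiPsi D χ ψ) (mul_ne_zero (by have := g.hD; omega) (by have := g.hp; omega))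
    (chiPsi_isPrimitive D χ ψ (by have := g.hD; omega) (by have := g.hp; omega) g.hc g.hχ g.hψ) c (s.im + v) hc1 hc2 hor
  rw [Ztilde, norm_mul]
  have hv : 1 ≤ 1 + |v| := by linarith [abs_nonneg v]
  have e : Real.exp (3120 * bigL D) = Real.exp (520 * bigL D) ^ 6 := by
    rw [← Real.exp_nat_mul]; congr 1; push_cast; ring
  calc _ ≤ (C * Q * (Real.exp (520 * bigL D) * (1 + |v|))^3) * (C * Q * (Real.exp (520 * bigL D) * (1 + |v|))^3) := by
        refine mul_le_mul (z1.trans ?_) (z2.trans ?_) (norm_nonneg _) (by positivity)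
        · gcongr
        · gcongr
    _ = C * C * Q^2 * Real.exp (520 * bigL D)^6 * (1 + |v|)^6 := by ring
    _ ≤ C * C * Q^2 * Real.exp (520 * bigL D)^6 * (1 + |v|)^8 := by
        have : (1 + |v|)^6 ≤ (1 + |v|)^8 := pow_le_pow_right₀ hv (by norm_num)
        gcongr
    _ = _ := by rw [e]

lemma term5 : ∃ C : ℝ, 0 < C ∧ ∀ (D : ℕ) (χ : DirichletCharacter ℂ D) (p : ℕ) (ψ : DirichletCharacter ℂ p) (s : ℂ),
    Good D χ ψ s → ‖JJ (ZH D χ ψ (Mfun D χ ψ⁻¹)) s (Lam D) (1/2 - (bigL D ^ 5)⁻¹)‖ ≤ C * bigL D ^ (-179 : ℤ) := by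
  obtain ⟨K, hK, hJ⟩ := JJ_bound
  obtain ⟨C, hC, hZ⟩ := Zt1
  refine ⟨K * (C * 2 * Real.exp (2 * Real.pi + 2)) * Real.exp 1 * 2, by positivity, fun D χ p ψ s g => ?_⟩
  obtain ⟨h4, h4', h5, h9, h10⟩ := poly_facts _ g.hL
  obtain ⟨b1, b2, b3, b4, b5, b6, b7⟩ := beta_facts _ g.hL
  have hL := g.hL
  have hs := g.hs1
  have hs2 := g.hs2
  have hhalf := g.exp_half
  have hz := hZ D χ p ψ s g
  set L := bigL D with hLd
  set β := (L^5)⁻¹ with hβ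
  set α := Real.pi / L^9 with hα
  have hL0 : L ≠ 0 := by linarith
  refine (hJ _ s (Lam D) (1/2 - β) (C * Real.exp (2 * L^4 + 1) * (2 * L^(-180 : ℤ))) (by linarith) (fun v => ?_)).trans ?_
  · rw [ZH, norm_mul, Mfun_conj D χ ψ g.hr, RCLike.norm_conj]
    have hm := g.M_bound 0 le_rfl ((starRingEnd ℂ) (1 - (((1/2 - β : ℝ) : ℂ) + ((s.im + v : ℝ) : ℂ) * Complex.I))) v ?_ ?_ ?_
    rotate_left
    · rw [Complex.conj_re, Complex.sub_re, re_line, Complex.one_re, abs_le]; constructor <;> linarith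
    · rw [Complex.conj_im, Complex.sub_im, im_line, Complex.one_im]; ring
    · rw [Complex.conj_re, Complex.sub_re, re_line, Complex.one_re]; linarith
    rw [mul_zero, Real.exp_zero, one_mul] at hm
    have hv : 1 ≤ 1 + |v| := by linarith [abs_nonneg v]
    calc _ ≤ (C * Real.exp (2 * L^4 + 1) * (1 + |v|)^2) * (2 * (1 + |v|) * L^(-180 : ℤ)) :=
          mul_le_mul (hz v) hm (norm_nonneg _) (by positivity)
      _ = (C * Real.exp (2 * L^4 + 1) * (2 * L^(-180 : ℤ))) * (1 + |v|)^3 := by ring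
      _ ≤ _ := by
          have : (1 + |v|)^3 ≤ (1 + |v|)^8 := pow_le_pow_right₀ hv (by norm_num)
          gcongr
  · have e2 : Lam D * (1/2 - β - s.re) ≤ 2 * Real.pi + 1 - 2 * L^4 := by
      have : Lam D * β = 2 * L^4 - 1 := by
        unfold Lam; rw [← hLd]; linear_combination 2*b5 - b4
      linarith
    have e3 : |1/2 - β - s.re| ^ (-(1/5) : ℝ) ≤ 2 * L := by
      have a1 : (((2 * L)^5)⁻¹ : ℝ) ≤ |1/2 - β - s.re| := by
        rw [abs_of_neg (by linarith)]
        have : ((2*L)^5)⁻¹ = β / 32 := by rw [hβ, mul_pow, mul_inv]; norm_num; ring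
        rw [this]; linarith
      have := rpow_fifth_anti _ _ (by positivity) a1
      rwa [beta_rpow (2 * L) (by linarith)] at this
    have e4 : L^(-179 : ℤ) = L^(-180 : ℤ) * L := by
      rw [← zpow_add_one₀ hL0]; norm_num
    have e5 : Real.exp (2 * L^4 + 1) * Real.exp (2 * Real.pi + 1 - 2*L^4) = Real.exp (2 * Real.pi + 2) := by
      rw [← Real.exp_add]; congr 1; ring
    have e6 : (1/2 - β - s.re)^2 ≤ 1 := by
      rw [sq_le_one_iff_abs_le_one, abs_le]; constructor <;> linarith
    calc _ ≤ K * (C * Real.exp (2 * L^4 + 1) * (2 * L^(-180 : ℤ)) * Real.exp (2 * Real.pi + 1 - 2*L^4)) * Real.exp 1 * (2 * L) := by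
          gcongr
      _ = K * (C * 2 * (Real.exp (2 * L^4 + 1) * Real.exp (2 * Real.pi + 1 - 2*L^4))) * Real.exp 1 * 2 * (L^(-180 : ℤ) * L) := by ring
      _ = _ := by rw [e5, e4]

lemma rpow_neg_bd (k X e a : ℝ) (hX : 0 ≤ X) (hk : Real.exp X ≤ k) (ha : 0 ≤ a) (he : e ≤ -a) : k ^ e ≤ Real.exp (-(a * X)) := by
  have h1 : 1 ≤ k := (Real.one_le_exp hX).trans hk
  calc k ^ e ≤ k ^ (-a) := Real.rpow_le_rpow_of_exponent_le h1 he
    _ ≤ (Real.exp X) ^ (-a) := Real.rpow_le_rpow_of_nonpos (Real.exp_pos _) hk (by linarith)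
    _ = _ := by rw [← Real.exp_mul]; congr 1; ring

lemma term6 : ∃ C : ℝ, 0 < C ∧ ∀ (D : ℕ) (χ : DirichletCharacter ℂ D) (p : ℕ) (ψ : DirichletCharacter ℂ p) (s : ℂ),
    Good D χ ψ s → ‖JJ (ZH D χ ψ (Tfun D χ ψ⁻¹)) s (Lam D) (-1/2)‖ ≤ C * Real.exp (-bigL D) := by
  obtain ⟨K, hK, hJ⟩ := JJ_bound
  obtain ⟨C, hC, hZ⟩ := Zt2
  have hSt := Stail_nonneg
  refine ⟨K * C * (Stail + 1) * 8, mul_pos (mul_pos (mul_pos hK hC) (by linarith)) (by norm_num), fun D χ p ψ s g => ?_⟩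
  obtain ⟨h4, h4', h5, h9, h10⟩ := poly_facts _ g.hL
  obtain ⟨b1, b2, b3, b4, b5, b6, b7⟩ := beta_facts _ g.hL
  have hL := g.hL
  have hs := g.hs1
  have hs2 := g.hs2
  have hhalf := g.exp_half
  obtain ⟨p1, p2⟩ := g.p_le
  have hz := fun v => hZ D χ p ψ s g (-1/2) v (Real.exp (bigL D + (1 + bigL D ^ 9))) le_rfl (by norm_num) (Or.inl (by norm_num))
    (by norm_num; exact p1.trans (Real.exp_le_exp.mpr (by linarith))) (by norm_num; push_cast at p2; exact p2)
  set L := bigL D with hLd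
  refine (hJ _ s (Lam D) (-1/2) (C * Real.exp (L + (1 + L^9))^2 * Real.exp (3120 * L) * (Stail * Real.exp (-(L^9/4)))) (by linarith) (fun v => ?_)).trans ?_
  · rw [ZH, norm_mul]
    have hT : ‖Tfun D χ ψ⁻¹ (1 - (((-1/2 : ℝ) : ℂ) + ((s.im + v : ℝ) : ℂ) * Complex.I))‖ ≤ Stail * Real.exp (-(L^9/4)) := by
      have hre : (1 - (((-1/2 : ℝ) : ℂ) + ((s.im + v : ℝ) : ℂ) * Complex.I)).re = 3/2 := by
        rw [Complex.sub_re, re_line, Complex.one_re]; norm_num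
      refine (Tfun_bound D χ ψ⁻¹ (by have := g.hD; omega) (by have := g.hp; omega) g.hDP _ (by rw [hre]; norm_num)).trans ?_
      rw [hre, bigP_sq, ← Real.exp_mul, ← hLd]
      gcongr
      linarith
    refine (mul_le_mul (hz v) hT (norm_nonneg _) (by positivity)).trans (le_of_eq (by ring))
  · have e2 : Lam D * (-1/2 - s.re) ≤ 2 * Real.pi - (2 * L^9 - L^5) := by
      have : Lam D = 2 * L^9 - L^5 := rfl
      linarith
    have e3 : |-1/2 - s.re| ^ (-(1/5) : ℝ) ≤ 8 := by
      apply eighth_rpow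
      rw [abs_of_neg (by linarith)]; linarith
    have e6 : (-1/2 - s.re)^2 ≤ 4 := by
      nlinarith
    have pi4 := Real.pi_lt_four
    calc _ ≤ K * (C * Real.exp (L + (1 + L^9))^2 * Real.exp (3120 * L) * (Stail * Real.exp (-(L^9/4))) * Real.exp (2 * Real.pi - (2 * L^9 - L^5))) * Real.exp 4 * 8 := by
          gcongr
      _ = K * C * Stail * 8 * Real.exp ((2:ℕ) * (L + (1 + L^9)) + 3120 * L + (-(L^9/4)) + (2 * Real.pi - (2 * L^9 - L^5)) + 4) := by
          generalize L + (1 + L^9) = a1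
          generalize 2 * Real.pi - (2 * L^9 - L^5) = a2
          generalize -(L^9/4) = a3
          rw [Real.exp_add, Real.exp_add, Real.exp_add, Real.exp_add, Real.exp_nat_mul]; ring
      _ ≤ _ := by
          gcongr
          · linarith
          · push_cast
            linarith

lemma term7 : ∃ C : ℝ, 0 < C ∧ ∀ (D : ℕ) (χ : DirichletCharacter ℂ D) (p : ℕ) (ψ : DirichletCharacter ℂ p) (s : ℂ),
    Good D χ ψ s → s.re ≤ 3/4 → ‖JJ (ZH D χ ψ (Ffun D χ ψ⁻¹)) s (Lam D) (7/8)‖ ≤ C * Real.exp (-bigL D) := by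
  obtain ⟨K, hK, hJ⟩ := JJ_bound
  obtain ⟨C, hC, hZ⟩ := Zt2
  refine ⟨K * C * 8, by positivity, fun D χ p ψ s g hs3 => ?_⟩
  obtain ⟨h4, h4', h5, h9, h10⟩ := poly_facts _ g.hL
  obtain ⟨b1, b2, b3, b4, b5, b6, b7⟩ := beta_facts _ g.hL
  have hL := g.hL
  have hs := g.hs1
  have hs2 := g.hs2
  have hhalf := g.exp_half
  obtain ⟨p1, p2⟩ := g.p_ge
  have hz := fun v => hZ D χ p ψ s g (7/8) v (Real.exp (-(3/8 * bigL D ^ 9))) (by norm_num) (by norm_num) (Or.inl le_rfl)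
    (rpow_neg_bd _ _ _ (3/8) (by linarith) p1 (by norm_num) (by norm_num))
    (rpow_neg_bd _ _ _ (3/8) (by linarith) p2 (by norm_num) (by norm_num))
  set L := bigL D with hLd
  refine (hJ _ s (Lam D) (7/8) (C * Real.exp (-(3/8 * L^9))^2 * Real.exp (3120 * L) * Real.exp L ^ 12) (by linarith) (fun v => ?_)).trans ?_
  · rw [ZH, norm_mul]
    have hF := Ffun_bound D χ ψ⁻¹ (1 - (((7/8 : ℝ) : ℂ) + ((s.im + v : ℝ) : ℂ) * Complex.I)) (by
        rw [Complex.sub_re, re_line, Complex.one_re]; norm_num)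
    rw [D_eq g.hD] at hF
    refine (mul_le_mul (hz v) hF (norm_nonneg _) (by positivity)).trans (le_of_eq (by ring))
  · have e2 : Lam D * (7/8 - s.re) ≤ 2 * Real.pi + 3/8 * (2 * L^9 - L^5) := by
      have : Lam D = 2 * L^9 - L^5 := rfl
      linarith
    have e3 : |7/8 - s.re| ^ (-(1/5) : ℝ) ≤ 8 := by
      apply eighth_rpow
      rw [abs_of_pos (by linarith)]; linarith
    have e6 : (7/8 - s.re)^2 ≤ 4 := by
      nlinarith
    have pi4 := Real.pi_lt_four
    calc _ ≤ K * (C * Real.exp (-(3/8 * L^9))^2 * Real.exp (3120 * L) * Real.exp L ^ 12 * Real.exp (2 * Real.pi + 3/8 * (2 * L^9 - L^5))) * Real.exp 4 * 8 := by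
          gcongr
      _ = K * C * 8 * Real.exp ((2:ℕ) * (-(3/8 * L^9)) + 3120 * L + (12:ℕ) * L + (2 * Real.pi + 3/8 * (2 * L^9 - L^5)) + 4) := by
          generalize 2 * Real.pi + 3/8 * (2 * L^9 - L^5) = a1
          generalize -(3/8 * L^9) = a2
          rw [Real.exp_add, Real.exp_add, Real.exp_add, Real.exp_add, Real.exp_nat_mul, Real.exp_nat_mul]; ring
      _ ≤ _ := by
          gcongr
          push_cast
          linarith

lemma term8 : ∃ C : ℝ, 0 < C ∧ ∀ (D : ℕ) (χ : DirichletCharacter ℂ D) (p : ℕ) (ψ : DirichletCharacter ℂ p) (s : ℂ),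
    Good D χ ψ s → 3/4 ≤ s.re → ‖JJ (ZH D χ ψ (Ffun D χ ψ⁻¹)) s (Lam D) (5/8)‖ ≤ C * Real.exp (-bigL D) := by
  obtain ⟨K, hK, hJ⟩ := JJ_bound
  obtain ⟨C, hC, hZ⟩ := Zt2
  refine ⟨K * C * 8, by positivity, fun D χ p ψ s g hs3 => ?_⟩
  obtain ⟨h4, h4', h5, h9, h10⟩ := poly_facts _ g.hL
  obtain ⟨b1, b2, b3, b4, b5, b6, b7⟩ := beta_facts _ g.hL
  have hL := g.hL
  have hs2 := g.hs2
  obtain ⟨p1, p2⟩ := g.p_ge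
  have hz := fun v => hZ D χ p ψ s g (5/8) v (Real.exp (-(1/8 * bigL D ^ 9))) (by norm_num) (by norm_num) (Or.inl (by norm_num))
    (rpow_neg_bd _ _ _ (1/8) (by linarith) p1 (by norm_num) (by norm_num))
    (rpow_neg_bd _ _ _ (1/8) (by linarith) p2 (by norm_num) (by norm_num))
  set L := bigL D with hLd
  refine (hJ _ s (Lam D) (5/8) (C * Real.exp (-(1/8 * L^9))^2 * Real.exp (3120 * L) * Real.exp L ^ 12) (by linarith) (fun v => ?_)).trans ?_
  · rw [ZH, norm_mul]
    have hF := Ffun_bound D χ ψ⁻¹ (1 - (((5/8 : ℝ) : ℂ) + ((s.im + v : ℝ) : ℂ) * Complex.I)) (by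
        rw [Complex.sub_re, re_line, Complex.one_re]; norm_num)
    rw [D_eq g.hD] at hF
    refine (mul_le_mul (hz v) hF (norm_nonneg _) (by positivity)).trans (le_of_eq (by ring))
  · have e2 : Lam D * (5/8 - s.re) ≤ 0 := by
      have : Lam D = 2 * L^9 - L^5 := rfl
      refine mul_nonpos_of_nonneg_of_nonpos ?_ ?_ <;> linarith
    have e3 : |5/8 - s.re| ^ (-(1/5) : ℝ) ≤ 8 := by
      apply eighth_rpow
      rw [abs_of_neg (by linarith)]; linarith
    have e6 : (5/8 - s.re)^2 ≤ 4 := by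
      nlinarith
    calc _ ≤ K * (C * Real.exp (-(1/8 * L^9))^2 * Real.exp (3120 * L) * Real.exp L ^ 12 * Real.exp 0) * Real.exp 4 * 8 := by
          gcongr
      _ = K * C * 8 * Real.exp ((2:ℕ) * (-(1/8 * L^9)) + 3120 * L + (12:ℕ) * L + 0 + 4) := by
          rw [Real.exp_add, Real.exp_add, Real.exp_add, Real.exp_add, Real.exp_nat_mul, Real.exp_nat_mul]; ring
      _ ≤ _ := by
          gcongr
          push_cast
          linarith

lemma term9 : ∃ C : ℝ, 0 < C ∧ ∀ (D : ℕ) (χ : DirichletCharacter ℂ D) (p : ℕ) (ψ : DirichletCharacter ℂ p) (s : ℂ),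
    Good D χ ψ s → 3/4 ≤ s.re → ‖Ztilde D χ ψ s * FfunBar D χ ψ s‖ ≤ C * Real.exp (-bigL D) := by
  obtain ⟨C, hC, hZ⟩ := Zt2
  refine ⟨C, hC, fun D χ p ψ s g hs3 => ?_⟩
  obtain ⟨h4, h4', h5, h9, h10⟩ := poly_facts _ g.hL
  obtain ⟨b1, b2, b3, b4, b5, b6, b7⟩ := beta_facts _ g.hL
  have hL := g.hL
  have hs2 := g.hs2
  obtain ⟨p1, p2⟩ := g.p_ge
  have hz := hZ D χ p ψ s g s.re 0 (Real.exp (-(1/4 * bigL D ^ 9))) (by linarith) (by linarith) (Or.inr rfl)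
    (rpow_neg_bd _ _ _ (1/4) (by linarith) p1 (by norm_num) (by linarith))
    (rpow_neg_bd _ _ _ (1/4) (by linarith) p2 (by norm_num) (by linarith))
  rw [add_zero, Complex.re_add_im, abs_zero, add_zero, one_pow, mul_one] at hz
  rw [norm_mul, FfunBar_eq]
  have hF := Ffun_bound D χ ψ⁻¹ (1 - s) (by rw [Complex.sub_re, Complex.one_re]; linarith)
  rw [D_eq g.hD] at hF
  set L := bigL D with hLd
  calc _ ≤ C * Real.exp (-(1/4 * L^9))^2 * Real.exp (3120 * L) * Real.exp L ^ 12 :=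
        mul_le_mul hz hF (norm_nonneg _) (by positivity)
    _ = C * Real.exp ((2:ℕ) * (-(1/4 * L^9)) + 3120 * L + (12:ℕ) * L) := by
        rw [Real.exp_add, Real.exp_add, Real.exp_nat_mul, Real.exp_nat_mul]; ring
    _ ≤ _ := by
        gcongr
        push_cast
        linarith

lemma mk_good (D : ℕ) (hL : 20 ≤ bigL D) (χ : DirichletCharacter ℂ D) (hr : IsRealChar χ) (hχ : χ.IsPrimitive)
    (p : ℕ) (ψ : DirichletCharacter ℂ p) (h : MemPsi1 D χ ψ) (s : ℂ) (hs : InOmega3 D s) : Good D χ ψ s := by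
  obtain ⟨⟨hpp, hP1, hP2⟩, hψ, _, h2, _⟩ := h
  obtain ⟨s1, s2, s3⟩ := hs
  obtain ⟨h4, h4', h5, h9, h10⟩ := poly_facts _ hL
  have hD : 1 < D := by
    by_contra hcon
    have : D = 0 ∨ D = 1 := by omega
    rcases this with h | h <;> · rw [h, bigL] at hL; norm_num at hL
  have ha : alphaD D = Real.pi / bigL D ^ 9 := by rw [alphaD, bigP, Real.log_exp]
  rw [ha] at s1 s2
  have hDe := D_eq hD
  have hDp : (D:ℝ) < p := by
    rw [hDe]
    refine lt_of_le_of_lt ?_ hP1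
    rw [bigP]
    exact Real.exp_le_exp.mpr (by linarith)
  have hDp' : D < p := by exact_mod_cast hDp
  refine ⟨hD, hpp.one_lt, ?_, hχ, hψ, hr, hL, hP1.le, ?_, ?_, h2, s1, s2, s3⟩
  · refine Nat.Coprime.symm ((Nat.Prime.coprime_iff_not_dvd hpp).mpr fun hd => ?_)
    have := Nat.le_of_dvd (by omega) hd
    omega
  · have : bigL D ^ (-68 : ℤ) ≤ 1 := zpow_le_one_of_nonpos₀ (by linarith) (by norm_num)
    have hp : 0 < bigP D := Real.exp_pos _
    nlinarith
  · refine Nat.le_floor ?_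
    rw [Nat.cast_pow, bigP_sq, hDe, ← Real.exp_nat_mul]
    refine Real.exp_le_exp.mpr ?_
    push_cast
    linarith

lemma main_bound : ∃ C : ℝ, 0 < C ∧ ∀ (D : ℕ) (χ : DirichletCharacter ℂ D) (p : ℕ) (ψ : DirichletCharacter ℂ p) (s : ℂ),
    Good D χ ψ s → ‖Aprod D χ ψ s - Ffun D χ ψ s - Ztilde D χ ψ s * FfunBar D χ ψ s‖ ≤ C * bigL D ^ (-179 : ℤ) := by
  obtain ⟨C0, p0, t0⟩ := exp_neg_le
  obtain ⟨C1, p1, t1⟩ := term1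
  obtain ⟨C2, p2, t2⟩ := term2
  obtain ⟨C3, p3, t3⟩ := term3
  obtain ⟨C4, p4, t4⟩ := term4
  obtain ⟨C5, p5, t5⟩ := term5
  obtain ⟨C6, p6, t6⟩ := term6
  obtain ⟨C7, p7, t7⟩ := term7
  obtain ⟨C8, p8, t8⟩ := term8
  obtain ⟨C9, p9, t9⟩ := term9
  refine ⟨(C1 + C4 + C6 + C7 + C8 + 8 * C9) * C0 + C2 + 8 * C3 + C5, by positivity, fun D χ p ψ s g => ?_⟩
  have hL := g.hL
  have u0 := t0 _ hL
  have u1 := t1 D χ p ψ s g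
  have u2 := t2 D χ p ψ s g
  have u3 := t3 D χ p ψ s g
  have u4 := t4 D χ p ψ s g
  have u5 := t5 D χ p ψ s g
  have u6 := t6 D χ p ψ s g
  obtain ⟨h4, h4', h5, h9, h10⟩ := poly_facts _ hL
  obtain ⟨b1, b2, b3, b4, b5, b6, b7⟩ := beta_facts _ hL
  have hs := g.hs1
  have hs2 := g.hs2
  have id := contour_id D χ ψ g.hD g.hp g.hc g.hχ g.hψ g.hr g.hDP s (Lam D) (bigL D ^ 5)⁻¹ (s.re + bigL D ^ 5 / 2)
    b2 b3 (by linarith) (by linarith) (by linarith)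
  set J1 := JJ (Ffun D χ ψ) s (Lam D) (s.re - (bigL D ^ 5)⁻¹)
  set J2 := JJ (Mfun D χ ψ) s (Lam D) (s.re - (bigL D ^ 5)⁻¹)
  set J4 := JJ (Tfun D χ ψ) s (Lam D) (s.re + bigL D ^ 5 / 2)
  set J5 := JJ (ZH D χ ψ (Mfun D χ ψ⁻¹)) s (Lam D) (1/2 - (bigL D ^ 5)⁻¹)
  set J6 := JJ (ZH D χ ψ (Tfun D χ ψ⁻¹)) s (Lam D) (-1/2)
  set A := Aprod D χ ψ s
  set F := Ffun D χ ψ s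
  set M := Mfun D χ ψ s
  set Z := Ztilde D χ ψ s * FfunBar D χ ψ s
  set E := A - F - Z
  set ε := Real.exp (-bigL D)
  set q := bigL D ^ (-179 : ℤ) with hq
  have hq0 : 0 ≤ q := by positivity
  have hε : 0 ≤ ε := (Real.exp_pos _).le
  have n2 : ‖(2 * Real.pi : ℂ)‖ = 2 * Real.pi := by
    rw [norm_mul, Complex.norm_real, Real.norm_of_nonneg Real.pi_pos.le]; norm_num
  have pi3 := Real.pi_gt_three
  have pi4 := Real.pi_lt_four
  have hE : ‖E‖ ≤ ‖2 * Real.pi * E‖ := by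
    rw [norm_mul, n2]
    nlinarith [norm_nonneg E]
  have hM : ‖2 * Real.pi * M‖ ≤ 8 * (C3 * q) := by
    rw [norm_mul, n2]
    exact mul_le_mul (by linarith) u3 (norm_nonneg _) (by norm_num)
  have tri : ∀ a1 a2 a4 a5 a6 a7 m z : ℂ, ‖a1 + a2 + a4 - (a7 + a5 + a6) + m - z‖ ≤ ‖a1‖ + ‖a2‖ + ‖a4‖ + (‖a7‖ + ‖a5‖ + ‖a6‖) + ‖m‖ + ‖z‖ := by
    intro a1 a2 a4 a5 a6 a7 m z
    refine (norm_sub_le _ _).trans ?_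
    gcongr
    refine (norm_add_le _ _).trans ?_
    gcongr
    refine (norm_sub_le _ _).trans ?_
    gcongr
    · exact norm_add₃_le
    · exact norm_add₃_le
  have hεq : ∀ c, 0 ≤ c → c * ε ≤ c * C0 * q := fun c hc => by
    rw [mul_assoc]; exact mul_le_mul_of_nonneg_left u0 hc
  have v1 := hεq C1 p1.le
  have v4 := hεq C4 p4.le
  have v6 := hεq C6 p6.le
  have v7 := hεq C7 p7.le
  have v8 := hεq C8 p8.le
  have v9 := hεq C9 p9.le
  have w1 : 0 ≤ C7 * C0 * q := by positivity
  have w2 : 0 ≤ C8 * C0 * q := by positivity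
  have w3 : 0 ≤ C9 * C0 * q := by positivity
  have expand : ((C1 + C4 + C6 + C7 + C8 + 8 * C9) * C0 + C2 + 8 * C3 + C5) * q =
    C1 * C0 * q + C4 * C0 * q + C6 * C0 * q + C7 * C0 * q + C8 * C0 * q + 8 * (C9 * C0 * q) + C2 * q + 8 * (C3 * q) + C5 * q := by ring
  rw [expand]
  by_cases hc : s.re ≤ 3/4
  · have u7 := t7 D χ p ψ s g hc
    have sh := ZF_shift_low D χ ψ g.hD g.hp g.hc g.hχ g.hψ s (Lam D) (by linarith) (by linarith)
    rw [sh] at id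
    set J7 := JJ (ZH D χ ψ (Ffun D χ ψ⁻¹)) s (Lam D) (7/8)
    have e : 2 * Real.pi * E = J1 + J2 + J4 - (J7 + J5 + J6) + 2 * Real.pi * M - 0 := by
      simp only [E]
      linear_combination id
    have := tri J1 J2 J4 J5 J6 J7 (2 * Real.pi * M) 0
    rw [← e, norm_zero] at this
    linarith
  · push Not at hc
    have u8 := t8 D χ p ψ s g hc.le
    have u9 := t9 D χ p ψ s g hc.le
    have sh := ZF_shift_high D χ ψ g.hD g.hp g.hc g.hχ g.hψ s (Lam D) (by linarith)
    rw [sh] at id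
    set J8 := JJ (ZH D χ ψ (Ffun D χ ψ⁻¹)) s (Lam D) (5/8)
    have e : 2 * Real.pi * E = J1 + J2 + J4 - (J8 + J5 + J6) + 2 * Real.pi * M - 2 * Real.pi * Z := by
      simp only [E]
      linear_combination id
    have hZ : ‖2 * Real.pi * Z‖ ≤ 8 * (C9 * ε) := by
      rw [norm_mul, n2]
      exact mul_le_mul (by linarith) u9 (norm_nonneg _) (by norm_num)
    have := tri J1 J2 J4 J5 J6 J8 (2 * Real.pi * M) (2 * Real.pi * Z)
    rw [← e] at this
    linarith

/-- For every `ψ ∈ Ψ₁` and every `s ∈ Ω₃`,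
`|L(s,ψ)L(s,χψ) - F(s,ψ) - Z̃(s,ψ) F(1-s,ψ̄)| ≤ C 𝓛^{-179}`. -/
theorem statement10 :
    ∃ C : ℝ, 0 < C ∧ ∃ D₀ : ℕ, ∀ D : ℕ, D₀ ≤ D → ∀ χ : DirichletCharacter ℂ D,
      IsRealChar χ → χ.IsPrimitive →
        ∀ (p : ℕ) (ψ : DirichletCharacter ℂ p), MemPsi1 D χ ψ →
          ∀ s : ℂ, InOmega3 D s →
            ‖Lfun ψ s * Lfun (chiPsi D χ ψ) s - Ffun D χ ψ s -
                Ztilde D χ ψ s * FfunBar D χ ψ s‖ ≤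
              C * bigL D ^ (-179 : ℤ) := by
  obtain ⟨C, hC, h⟩ := main_bound
  refine ⟨C, hC, ⌈Real.exp 20⌉₊, fun D hD χ hr hχ p ψ hm s hs => ?_⟩
  have hL : 20 ≤ bigL D := by
    have : Real.exp 20 ≤ D := Nat.ceil_le.mp hD
    rw [bigL, Real.le_log_iff_exp_le (lt_of_lt_of_le (Real.exp_pos _) this)]
    exact this
  exact h D χ p ψ s (mk_good D hL χ hr hχ p ψ hm s hs)

end
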